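/- Capacity estimate on the hexagonal lattice: suppose the inverse temperature sequence β = β_L satisfies L^{10} ≪ e^{β_L} and let (A,B) be a proper partition of Ω. Then Cap_β(S(A), S(B)) = [12|A|(q−|A|)/q + o_L(1)] · e^{−(2L+2)β} as L → ∞. -/

import Mathlib

open scoped Classical BigOperators

namespace IsingHex

/-- Sites of the hexagonal lattice of side length `L` with periodic boundary conditions,
identified with the `2L²` triangular faces of the dual triangular lattice `Λ*`:
`(p, false)` is the up-triangle and `(p, true)` the down-triangle in the rhombic cell `p`. -/
abbrev Site (L : ℕ) : Type := (ZMod L × ZMod L) × Bool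

/-- Spin configurations `X = Ω^Λ` with spin set `Ω = Fin q`. -/
abbrev Conf (L q : ℕ) : Type := Site L → Fin q

/-- Adjacency of the hexagonal lattice: the up-triangle `(p, false)` is adjacent to the
down-triangles `(p, true)`, `(p - (1,0), true)` and `(p - (0,1), true)`. -/
def hexAdj {L : ℕ} (v w : Site L) : Prop :=
  (v.2 = false ∧ w.2 = true ∧
     (w.1 = v.1 ∨ w.1 = (v.1.1 - 1, v.1.2) ∨ w.1 = (v.1.1, v.1.2 - 1))) ∨
  (v.2 = true ∧ w.2 = false ∧
     (v.1 = w.1 ∨ v.1 = (w.1.1 - 1, w.1.2) ∨ v.1 = (w.1.1, w.1.2 - 1)))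

/-- The Hamiltonian `H(σ)`: the number of edges of `Λ` whose endpoints carry different
spins; each edge is counted exactly once through its unique up-triangle endpoint. -/
noncomputable def Ham (L q : ℕ) (σ : Conf L q) : ℕ :=
  Nat.card {e : Site L × Site L // e.1.2 = false ∧ hexAdj e.1 e.2 ∧ σ e.1 ≠ σ e.2}

/-- The monochromatic ground state `𝐚`. -/
def groundConf (L q : ℕ) (a : Fin q) : Conf L q := fun _ => a

/-- The set `S = {𝟏, …, 𝐪}` of ground states. -/
def groundSet (L q : ℕ) : Set (Conf L q) := {σ | ∃ a : Fin q, σ = groundConf L q a}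

/-- Partition function `Z_β`. -/
noncomputable def Zfun (L q : ℕ) (β : ℝ) : ℝ :=
  ∑' σ : Conf L q, Real.exp (-β * (Ham L q σ : ℝ))

/-- Gibbs measure of a set of configurations. -/
noncomputable def gibbsP (L q : ℕ) (β : ℝ) (A : Set (Conf L q)) : ℝ :=
  (∑' σ : Conf L q, A.indicator (fun ζ => Real.exp (-β * (Ham L q ζ : ℝ))) σ) / Zfun L q β

/-- `σ ∼ ζ`: the two configurations differ at exactly one site. -/
def oneFlip {L q : ℕ} (σ ζ : Conf L q) : Prop :=
  ∃ x : Site L, σ x ≠ ζ x ∧ ∀ y : Site L, y ≠ x → σ y = ζ y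

/-- Metropolis jump rates `c_β(σ, ζ)`. -/
noncomputable def rate (L q : ℕ) (β : ℝ) (σ ζ : Conf L q) : ℝ :=
  if oneFlip σ ζ then Real.exp (-β * max ((Ham L q ζ : ℝ) - (Ham L q σ : ℝ)) 0) else 0

/-- There is a `t`-path of single spin flips connecting `σ` and `ζ`. -/
def ConnBelow (L q : ℕ) (t : ℕ) (σ ζ : Conf L q) : Prop :=
  ∃ (N : ℕ) (ω : ℕ → Conf L q), ω 0 = σ ∧ ω N = ζ ∧
    (∀ n < N, oneFlip (ω n) (ω (n + 1))) ∧ ∀ n ≤ N, Ham L q (ω n) ≤ t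

/-- Communication height `Φ(σ, ζ)`. -/
noncomputable def commHeight (L q : ℕ) (σ ζ : Conf L q) : ℕ :=
  sInf {t : ℕ | ConnBelow L q t σ ζ}

/-- The strip of index `ℓ` in direction `d` (`0` = horizontal, `1` = vertical,
`2` = diagonal): `2L` consecutive triangles winding around the torus. -/
def stripSet (L : ℕ) (d : Fin 3) (ℓ : ZMod L) : Set (Site L) :=
  if d = 0 then {v | v.1.2 = ℓ}
  else if d = 1 then {v | v.1.1 = ℓ}
  else {v | (v.2 = false ∧ v.1.1 + v.1.2 = ℓ) ∨ (v.2 = true ∧ v.1.1 + v.1.2 = ℓ - 1)}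

/-- Strip energy `ΔH_s(σ)`: number of adjacent pairs inside the strip with different spins. -/
noncomputable def stripEnergy (L q : ℕ) (σ : Conf L q) (d : Fin 3) (ℓ : ZMod L) : ℕ :=
  Nat.card {e : Site L × Site L //
    e.1.2 = false ∧ e.1 ∈ stripSet L d ℓ ∧ e.2 ∈ stripSet L d ℓ ∧
      hexAdj e.1 e.2 ∧ σ e.1 ≠ σ e.2}

/-- The strip `(d, ℓ)` is an `a`-bridge of `σ`. -/
def IsBridgeWith (L q : ℕ) (σ : Conf L q) (d : Fin 3) (ℓ : ZMod L) (a : Fin q) : Prop :=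
  ∀ v ∈ stripSet L d ℓ, σ v = a

/-- The strip `(d, ℓ)` is a bridge of `σ`. -/
def IsBridge (L q : ℕ) (σ : Conf L q) (d : Fin 3) (ℓ : ZMod L) : Prop :=
  ∃ a : Fin q, IsBridgeWith L q σ d ℓ a

/-- Cyclic enumeration of the strip `(d, ℓ)` by `ZMod (2L)`, consecutive triangles
being adjacent. -/
def stripCycle (L : ℕ) (d : Fin 3) (ℓ : ZMod L) (k : ZMod (2 * L)) : Site L :=
  let t : ZMod L := ((k.val / 2 : ℕ) : ZMod L)
  if d = 0 then ((t, ℓ), decide (k.val % 2 = 1))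
  else if d = 1 then ((ℓ, t), decide (k.val % 2 = 1))
  else if k.val % 2 = 1 then ((t, ℓ - 1 - t), true) else ((t, ℓ - t), false)

/-- A set of triangles is an arc (a set of consecutive triangles) of the strip `(d, ℓ)`. -/
def IsArc (L : ℕ) (d : Fin 3) (ℓ : ZMod L) (S : Set (Site L)) : Prop :=
  ∃ (s : ZMod (2 * L)) (m : ℕ),
    S = (fun k : ℕ => stripCycle L d ℓ (s + (k : ZMod (2 * L)))) '' Set.Iio m

/-- The strip `(d, ℓ)` is an `{a,b}`-semibridge of `σ`: it carries exactly the two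
spins `a ≠ b`, and the sites carrying each spin are consecutive in the strip. -/
def IsSemibridgePair (L q : ℕ) (σ : Conf L q) (d : Fin 3) (ℓ : ZMod L) (a b : Fin q) : Prop :=
  a ≠ b ∧ (∀ v ∈ stripSet L d ℓ, σ v = a ∨ σ v = b) ∧
    (∃ v ∈ stripSet L d ℓ, σ v = a) ∧ (∃ v ∈ stripSet L d ℓ, σ v = b) ∧
    IsArc L d ℓ {v ∈ stripSet L d ℓ | σ v = a} ∧ IsArc L d ℓ {v ∈ stripSet L d ℓ | σ v = b}

/-- The strip `(d, ℓ)` is a semibridge of `σ`. -/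
def IsSemibridge (L q : ℕ) (σ : Conf L q) (d : Fin 3) (ℓ : ZMod L) : Prop :=
  ∃ a b : Fin q, IsSemibridgePair L q σ d ℓ a b

/-- `σ` has an `a`-cross: two `a`-bridges in different directions. -/
def HasCross (L q : ℕ) (σ : Conf L q) (a : Fin q) : Prop :=
  ∃ (d d' : Fin 3) (ℓ ℓ' : ZMod L),
    d ≠ d' ∧ IsBridgeWith L q σ d ℓ a ∧ IsBridgeWith L q σ d' ℓ' a

/-- `σ` is cross-free. -/
def CrossFree (L q : ℕ) (σ : Conf L q) : Prop := ∀ a : Fin q, ¬ HasCross L q σ a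

/-- Connected subsets of the torus `𝕋_L` of strip indices (the collection `𝔖_L`). -/
def CircConn (L : ℕ) (P : Set (ZMod L)) : Prop :=
  ∀ x ∈ P, ∀ y ∈ P, ∃ (N : ℕ) (γ : ℕ → ZMod L), γ 0 = x ∧ γ N = y ∧
    (∀ n ≤ N, γ n ∈ P) ∧ ∀ n < N, γ (n + 1) = γ n + 1 ∨ γ (n + 1) = γ n - 1

/-- Union of the strips with indices in `P`, in direction `d`. -/
def stripUnion (L : ℕ) (d : Fin 3) (P : Set (ZMod L)) : Set (Site L) :=
  ⋃ ℓ ∈ P, stripSet L d ℓ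

/-- The configuration `ξ^{a,b}_U`: spin `b` on `U` and spin `a` elsewhere. -/
noncomputable def xiConf (L q : ℕ) (a b : Fin q) (U : Set (Site L)) : Conf L q :=
  fun v => if v ∈ U then b else a

/-- `σ ∈ R_n^{a,b}`: a regular configuration between `𝐚` and `𝐛` built from `n` strips. -/
def IsRegular (L q : ℕ) (σ : Conf L q) (a b : Fin q) (n : ℕ) : Prop :=
  ∃ (d : Fin 3) (P : Set (ZMod L)), CircConn L P ∧ P.ncard = n ∧
    σ = xiConf L q a b (stripUnion L d P)

/-- The vertices (in the triangular lattice) of the triangle `v`. -/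
def triVerts (L : ℕ) (v : Site L) : Set (ZMod L × ZMod L) :=
  if v.2 = false then {v.1, (v.1.1 + 1, v.1.2), (v.1.1, v.1.2 + 1)}
  else {(v.1.1 + 1, v.1.2), (v.1.1, v.1.2 + 1), (v.1.1 + 1, v.1.2 + 1)}

/-- A connected set of triangles (connected through shared sides). -/
def ConnSet (L : ℕ) (U : Set (Site L)) : Prop :=
  ∀ x ∈ U, ∀ y ∈ U, ∃ (N : ℕ) (γ : ℕ → Site L), γ 0 = x ∧ γ N = y ∧
    (∀ n ≤ N, γ n ∈ U) ∧ ∀ n < N, hexAdj (γ n) (γ (n + 1))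

/-- A one-dimensional canonical set inside the strip `(d, ℓ)`. -/
def OneDimCanonical (L : ℕ) (d : Fin 3) (ℓ : ZMod L) (U : Set (Site L)) : Prop :=
  U ⊆ stripSet L d ℓ ∧ U.Nonempty ∧ U ≠ stripSet L d ℓ ∧
  (ConnSet L U ∨
    (Even U.ncard ∧ ∃ (U₁ : Set (Site L)) (y : Site L),
      U = U₁ ∪ {y} ∧ y ∉ U₁ ∧ U₁.Nonempty ∧ ConnSet L U₁ ∧
      (∀ x ∈ U₁, ¬ hexAdj x y) ∧ ∃ x ∈ U₁, (triVerts L x ∩ triVerts L y).Nonempty))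

/-- `P ≺ P'`: connected index sets with `P ⊆ P'` and `|P'| = |P| + 1`. -/
def StepPair (L : ℕ) (P P' : Set (ZMod L)) : Prop :=
  CircConn L P ∧ CircConn L P' ∧ P ⊆ P' ∧ P'.ncard = P.ncard + 1

/-- A protuberance attached to `s(P)` inside the strip `(d, ℓ)`: a one-dimensional
canonical set such that, when `1 ≤ |P| ≤ L-2`, at least half of its triangles share a
side with `s(P)`. -/
def IsProtuberance (L : ℕ) (d : Fin 3) (P : Set (ZMod L)) (ℓ : ZMod L)
    (U : Set (Site L)) : Prop :=
  OneDimCanonical L d ℓ U ∧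
    (1 ≤ P.ncard → P.ncard ≤ L - 2 →
      U.ncard ≤ 2 * {x ∈ U | ∃ y ∈ stripUnion L d P, hexAdj x y}.ncard)

/-- `‖σ‖_a`: the number of sites with spin `a`. -/
noncomputable def spinCount (L q : ℕ) (σ : Conf L q) (a : Fin q) : ℕ :=
  Nat.card {x : Site L // σ x = a}

/-- `N̂(S)`: configurations connected to a ground state by a `(2L+2)`-path. -/
def NHatGround (L q : ℕ) : Set (Conf L q) :=
  {ζ | ∃ a : Fin q, ConnBelow L q (2 * L + 2) (groundConf L q a) ζ}

/-- A nice pair of configurations (relative to the partition class `A`). -/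
def NicePair (L q : ℕ) (A : Finset (Fin q)) (σ ζ : Conf L q) : Prop :=
  σ ∉ NHatGround L q ∧ ζ ∉ NHatGround L q ∧ oneFlip σ ζ ∧
    (∑ a ∈ A, spinCount L q σ a) = L ^ 2 ∧ (∑ a ∈ A, spinCount L q ζ a) = L ^ 2 - 1

/-- `u` is the vector of mean hitting times `σ ↦ E_σ[τ_A]` of the Metropolis dynamics:
it vanishes on `A` and satisfies the first-step (harmonicity) equations off `A`. -/
def IsMeanHittingTime (L q : ℕ) (β : ℝ) (A : Set (Conf L q)) (u : Conf L q → ℝ) : Prop :=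
  (∀ σ ∈ A, u σ = 0) ∧
    ∀ σ ∉ A, (∑' ζ : Conf L q, rate L q β σ ζ) * u σ =
      1 + ∑' ζ : Conf L q, rate L q β σ ζ * u ζ

/-- Gibbs weight `μ_β(σ)`. -/
noncomputable def gibbsWeight (L q : ℕ) (β : ℝ) (σ : Conf L q) : ℝ :=
  Real.exp (-β * (Ham L q σ : ℝ)) / Zfun L q β

/-- The Dirichlet form `D_β(f)`. -/
noncomputable def dirichletForm (L q : ℕ) (β : ℝ) (f : Conf L q → ℝ) : ℝ :=
  (1 / 2) * ∑' p : Conf L q × Conf L q,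
    gibbsWeight L q β p.1 * rate L q β p.1 p.2 * (f p.2 - f p.1) ^ 2

/-- `h` is the equilibrium potential `h^β_{A,B}(σ) = P_σ[τ_A < τ_B]`: it equals `1` on
`A`, `0` on `B`, and is harmonic for the Metropolis dynamics off `A ∪ B`. -/
def IsEqPotential (L q : ℕ) (β : ℝ) (A B : Set (Conf L q)) (h : Conf L q → ℝ) : Prop :=
  (∀ σ ∈ A, h σ = 1) ∧ (∀ σ ∈ B, h σ = 0) ∧
    ∀ σ, σ ∉ A → σ ∉ B → (∑' ζ : Conf L q, rate L q β σ ζ * (h σ - h ζ)) = 0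


section P1
variable {L q : ℕ}

/-- mismatch indicator -/
def mm {α : Type*} [DecidableEq α] (a b : α) : ℕ := if a = b then 0 else 1

lemma mm_self {α : Type*} [DecidableEq α] (a : α) : mm a a = 0 := by simp [mm]
lemma mm_ne {α : Type*} [DecidableEq α] {a b : α} (h : a ≠ b) : mm a b = 1 := by simp [mm, h]
lemma mm_eq_zero {α : Type*} [DecidableEq α] {a b : α} : mm a b = 0 ↔ a = b := by
  unfold mm; split_ifs <;> simp_all
lemma mm_le_one {α : Type*} [DecidableEq α] (a b : α) : mm a b ≤ 1 := by
  unfold mm; split_ifs <;> simp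
lemma mm_comm {α : Type*} [DecidableEq α] (a b : α) : mm a b = mm b a := by
  unfold mm; simp only [eq_comm]
lemma mm_map_le {α γ : Type*} [DecidableEq α] [DecidableEq γ] (f : α → γ) (a b : α) :
    mm (f a) (f b) ≤ mm a b := by
  unfold mm; split_ifs <;> simp_all

/-- the three neighbours of a site -/
def nb (i : Fin 3) (z : Site L) : Site L :=
  match i, z with
  | 0, (p, b) => (p, !b)
  | 1, ((x, y), false) => ((x - 1, y), true)
  | 1, ((x, y), true) => ((x + 1, y), false)
  | 2, ((x, y), false) => ((x, y - 1), true)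
  | 2, ((x, y), true) => ((x, y + 1), false)

lemma nb_nb (i : Fin 3) (z : Site L) : nb i (nb i z) = z := by
  obtain ⟨⟨x, y⟩, b⟩ := z
  fin_cases i <;> cases b <;> simp [nb]

lemma nb_snd (i : Fin 3) (z : Site L) : (nb i z).2 = !z.2 := by
  obtain ⟨⟨x, y⟩, b⟩ := z
  fin_cases i <;> cases b <;> simp [nb]

lemma nb_ne (i : Fin 3) (z : Site L) : nb i z ≠ z := by
  intro h
  have := nb_snd i z
  rw [h] at this
  simp at this

/-- number of mismatches of colour `c` at `z` -/
def mis (σ : Conf L q) (z : Site L) (c : Fin q) : ℕ := ∑ i : Fin 3, mm c (σ (nb i z))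

lemma mis_le (σ : Conf L q) (z : Site L) (c : Fin q) : mis σ z c ≤ 3 := by
  unfold mis
  simp only [Fin.sum_univ_three]
  have := mm_le_one c (σ (nb 0 z))
  have := mm_le_one c (σ (nb 1 z))
  have := mm_le_one c (σ (nb 2 z))
  omega

variable [NeZero L]

lemma sum_site {M : Type*} [AddCommMonoid M] (f : Site L → M) :
    ∑ v, f v = (∑ p : ZMod L × ZMod L, f (p, false)) + ∑ p : ZMod L × ZMod L, f (p, true) := by
  rw [Fintype.sum_prod_type]
  simp only [Fintype.sum_bool, Finset.sum_add_distrib]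
  rw [add_comm]

lemma ham_up [Fact (1 < L)] (σ : Conf L q) :
    Ham L q σ = ∑ p : ZMod L × ZMod L, mis σ (p, false) (σ (p, false)) := by
  unfold Ham
  rw [Nat.card_eq_fintype_card, Fintype.card_subtype, Finset.card_filter, Fintype.sum_prod_type,
    sum_site]
  simp only [Bool.true_eq_false, false_and, if_false, Finset.sum_const_zero, add_zero]
  refine Finset.sum_congr rfl fun p _ => ?_
  rw [sum_site]
  obtain ⟨x, y⟩ := p
  have h10 : (1 : ZMod L) ≠ 0 := one_ne_zero
  have key : ∀ w : ZMod L × ZMod L,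
      (if True ∧ hexAdj (((x, y), false) : Site L) (w, true) ∧ σ ((x, y), false) ≠ σ (w, true)
        then 1 else 0) =
      (if w = (x, y) then mm (σ ((x, y), false)) (σ (w, true)) else 0) +
      ((if w = (x - 1, y) then mm (σ ((x, y), false)) (σ (w, true)) else 0) +
      (if w = (x, y - 1) then mm (σ ((x, y), false)) (σ (w, true)) else 0)) := by
    intro w
    have e1 : ((x, y) : ZMod L × ZMod L) ≠ (x - 1, y) := by
      intro h; have := (Prod.ext_iff.1 h).1; apply h10; linear_combination this
    have e2 : ((x, y) : ZMod L × ZMod L) ≠ (x, y - 1) := by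
      intro h; have := (Prod.ext_iff.1 h).2; apply h10; linear_combination this
    have e3 : ((x - 1, y) : ZMod L × ZMod L) ≠ (x, y - 1) := by simp
    unfold hexAdj mm
    by_cases h1 : w = (x, y)
    · subst h1; simp [e1, e2]
    by_cases h2 : w = (x - 1, y)
    · subst h2; simp [e3]
    by_cases h3 : w = (x, y - 1)
    · subst h3; simp
    simp [h1, h2, h3]
  simp only [hexAdj, Bool.false_eq_true, false_and, and_false, or_false, false_or, if_false,
    Finset.sum_const_zero, zero_add] at key ⊢
  rw [Finset.sum_congr rfl fun w _ => key w]
  simp only [Finset.sum_add_distrib, Finset.sum_ite_eq', Finset.mem_univ, if_true]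
  simp [mis, Fin.sum_univ_three, nb, add_assoc]

lemma ham_dn [Fact (1 < L)] (σ : Conf L q) :
    Ham L q σ = ∑ p : ZMod L × ZMod L, mis σ (p, true) (σ (p, true)) := by
  rw [ham_up]
  simp only [mis, Fin.sum_univ_three, Finset.sum_add_distrib]
  congr 1
  · congr 1
    · exact Finset.sum_congr rfl fun p _ => by simp [nb, mm_comm]
    · refine Fintype.sum_equiv (Equiv.prodCongr (Equiv.subRight 1) (Equiv.refl _)) _ _ ?_
      rintro ⟨x, y⟩
      simp [nb, mm_comm]
  · refine Fintype.sum_equiv (Equiv.prodCongr (Equiv.refl _) (Equiv.subRight 1)) _ _ ?_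
    rintro ⟨x, y⟩
    simp [nb, mm_comm]

lemma ham_flip [Fact (1 < L)] (σ : Conf L q) (z : Site L) (c : Fin q) :
    Ham L q (Function.update σ z c) + mis σ z (σ z) = Ham L q σ + mis σ z c := by
  obtain ⟨p, b⟩ := z
  have hz : mis (Function.update σ (p, b) c) (p, b) c = mis σ (p, b) c := by
    unfold mis
    refine Finset.sum_congr rfl fun i _ => ?_
    rw [Function.update_of_ne (nb_ne i _)]
  have hne : ∀ p', p' ≠ p → mis (Function.update σ (p, b) c) (p', b)
      (Function.update σ (p, b) c (p', b)) = mis σ (p', b) (σ (p', b)) := by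
    intro p' hp
    have h1 : ((p', b) : Site L) ≠ (p, b) := by simpa using hp
    rw [Function.update_of_ne h1]
    unfold mis
    refine Finset.sum_congr rfl fun i _ => ?_
    rw [Function.update_of_ne]
    intro h
    have := nb_snd i (p', b)
    rw [h] at this
    simp at this
  have hh : ∀ τ : Conf L q, Ham L q τ = ∑ p : ZMod L × ZMod L, mis τ (p, b) (τ (p, b)) := by
    intro τ; cases b
    · exact ham_up τ
    · exact ham_dn τ
  rw [hh, hh, ← Finset.add_sum_erase _ _ (Finset.mem_univ p),
    ← Finset.add_sum_erase _ (fun p => mis σ (p, b) (σ (p, b))) (Finset.mem_univ p),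
    Finset.sum_congr rfl (fun p' hp => hne p' (Finset.ne_of_mem_erase hp))]
  simp only [Function.update_self, hz]
  omega

lemma oneFlip_iff (σ ζ : Conf L q) :
    oneFlip σ ζ ↔ ∃ z c, c ≠ σ z ∧ ζ = Function.update σ z c := by
  constructor
  · rintro ⟨z, h1, h2⟩
    refine ⟨z, ζ z, h1.symm, ?_⟩
    funext w
    by_cases h : w = z
    · subst h; simp
    · rw [Function.update_of_ne h, h2 w h]
  · rintro ⟨z, c, h1, rfl⟩
    refine ⟨z, by simpa using h1.symm, fun y hy => ?_⟩
    rw [Function.update_of_ne hy]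

lemma oneFlip_symm {σ ζ : Conf L q} (h : oneFlip σ ζ) : oneFlip ζ σ := by
  obtain ⟨z, h1, h2⟩ := h
  exact ⟨z, h1.symm, fun y hy => (h2 y hy).symm⟩

/-- lattice automorphisms -/
def th (d : Fin 3) (v : Site L) : Site L :=
  match d, v with
  | 0, v => v
  | 1, ((x, y), b) => ((y, x), b)
  | 2, ((x, y), false) => ((x, -(x + y)), false)
  | 2, ((x, y), true) => ((x, -(x + y) - 1), true)

lemma th_th (d : Fin 3) (v : Site L) : th d (th d v) = v := by
  obtain ⟨⟨x, y⟩, b⟩ := v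
  fin_cases d <;> cases b <;> simp [th] <;> ring

def thE (d : Fin 3) : Site L ≃ Site L := ⟨th d, th d, th_th d, th_th d⟩

lemma ham_th [Fact (1 < L)] (d : Fin 3) (σ : Conf L q) : Ham L q (σ ∘ th d) = Ham L q σ := by
  rw [ham_up, ham_up]
  fin_cases d
  · rfl
  · refine Fintype.sum_equiv (Equiv.prodComm _ _) _ _ ?_
    rintro ⟨x, y⟩
    simp [mis, Fin.sum_univ_three, nb, th]
    ring
  · refine Fintype.sum_equiv ⟨fun p => (p.1, -(p.1 + p.2)), fun p => (p.1, -(p.1 + p.2)),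
      fun p => by simp, fun p => by simp⟩ _ _ ?_
    rintro ⟨x, y⟩
    have e1 : -(x - 1 + y) - 1 = -(x + y) := by ring
    have e2 : -(x + (y - 1)) - 1 = -(x + y) := by ring
    simp only [mis, Fin.sum_univ_three, nb, th, Function.comp, e1, e2, Equiv.coe_fn_mk,
      Bool.not_false, Fin.reduceFinMk]
    ring

lemma oneFlip_th (d : Fin 3) {σ ζ : Conf L q} (h : oneFlip σ ζ) :
    oneFlip (σ ∘ th d) (ζ ∘ th d) := by
  obtain ⟨z, h1, h2⟩ := h
  refine ⟨th d z, by simpa [th_th] using h1, fun y hy => h2 _ ?_⟩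
  rintro rfl
  exact hy (th_th d y).symm

lemma comp_th_th (d : Fin 3) (σ : Conf L q) : (σ ∘ th d) ∘ th d = σ := by
  funext v; simp [th_th]

lemma oneFlip_th_iff (d : Fin 3) {σ ζ : Conf L q} :
    oneFlip (σ ∘ th d) (ζ ∘ th d) ↔ oneFlip σ ζ := by
  refine ⟨fun h => ?_, oneFlip_th d⟩
  have := oneFlip_th d h
  rwa [comp_th_th, comp_th_th] at this

/-- number of sites with colours in `A` -/
noncomputable def V (A : Finset (Fin q)) (σ : Conf L q) : ℕ :=
  ∑ v : Site L, if σ v ∈ A then 1 else 0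

lemma V_th (A : Finset (Fin q)) (d : Fin 3) (σ : Conf L q) : V A (σ ∘ th d) = V A σ := by
  unfold V
  exact Fintype.sum_equiv (thE d) _ _ fun v => rfl

lemma V_update (A : Finset (Fin q)) (σ : Conf L q) (z : Site L) (c : Fin q) :
    V A (Function.update σ z c) + (if σ z ∈ A then 1 else 0) = V A σ + if c ∈ A then 1 else 0 := by
  unfold V
  rw [← Finset.add_sum_erase _ _ (Finset.mem_univ z),
    ← Finset.add_sum_erase _ (fun v => if σ v ∈ A then 1 else 0) (Finset.mem_univ z),
    Finset.sum_congr rfl (fun p' hp => by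
      rw [Function.update_of_ne (Finset.ne_of_mem_erase hp)])]
  simp only [Function.update_self]
  omega

lemma V_le (A : Finset (Fin q)) (σ : Conf L q) : V A σ ≤ 2 * L * L := by
  unfold V
  calc _ ≤ ∑ v : Site L, 1 := Finset.sum_le_sum fun v _ => by split_ifs <;> simp
    _ = 2 * L * L := by simp [ZMod.card]; ring

/-- strip index -/
def sidx (d : Fin 3) (v : Site L) : ZMod L :=
  match d, v with
  | 0, v => v.1.2
  | 1, v => v.1.1
  | 2, ((x, y), false) => x + y
  | 2, ((x, y), true) => x + y + 1

/-- direction permutation induced by `th d` -/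
def tp (d e : Fin 3) : Fin 3 :=
  match d, e with
  | 0, e => e
  | 1, 0 => 1
  | 1, 1 => 0
  | 1, 2 => 2
  | 2, 0 => 2
  | 2, 1 => 1
  | 2, 2 => 0

lemma tp_tp (d e : Fin 3) : tp d (tp d e) = e := by revert d e; decide

lemma sidx_th (d e : Fin 3) (v w : Site L) :
    sidx (tp d e) (th d v) = sidx (tp d e) (th d w) ↔ sidx e v = sidx e w := by
  obtain ⟨⟨x, y⟩, b⟩ := v
  obtain ⟨⟨x', y'⟩, b'⟩ := w
  fin_cases d <;> fin_cases e <;> cases b <;> cases b' <;> simp [sidx, th, tp] <;>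
   first
   | done
   | (constructor <;> intro h <;> linear_combination h)
   | (constructor <;> intro h <;> linear_combination -h)

/-- cyclic energy of a strip -/
def cycE {α : Type*} [DecidableEq α] (k : ZMod L → α × α) : ℕ :=
  ∑ x, (mm (k x).1 (k x).2 + mm (k x).1 (k (x - 1)).2)

def row (σ : Conf L q) (y : ZMod L) (x : ZMod L) : Fin q × Fin q :=
  (σ ((x, y), false), σ ((x, y), true))
def col (σ : Conf L q) (x : ZMod L) (y : ZMod L) : Fin q × Fin q :=
  (σ ((x, y), false), σ ((x, y), true))
def dia (σ : Conf L q) (l : ZMod L) (x : ZMod L) : Fin q × Fin q :=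
  (σ ((x, l - x), false), σ ((x, l - 1 - x), true))
def E0 (σ : Conf L q) : ℕ := ∑ y, cycE (row σ y)
def E1 (σ : Conf L q) : ℕ := ∑ x, cycE (col σ x)
def E2 (σ : Conf L q) : ℕ := ∑ l, cycE (dia σ l)

lemma two_ham [Fact (1 < L)] (σ : Conf L q) : 2 * Ham L q σ = E0 σ + E1 σ + E2 σ := by
  have h2 : E2 σ = ∑ x : ZMod L, ∑ y : ZMod L, (mm (σ ((x, y), false)) (σ ((x, y - 1), true)) +
      mm (σ ((x, y), false)) (σ ((x - 1, y), true))) := by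
    unfold E2 cycE dia
    rw [Finset.sum_comm]
    refine Finset.sum_congr rfl fun x _ => ?_
    refine Fintype.sum_equiv (Equiv.subRight x) _ _ fun l => ?_
    have e1 : l - 1 - x = l - x - 1 := by ring
    have e2 : l - 1 - (x - 1) = l - x := by ring
    simp [e1, e2]
  have h0 : E0 σ = ∑ x : ZMod L, ∑ y : ZMod L, (mm (σ ((x, y), false)) (σ ((x, y), true)) +
      mm (σ ((x, y), false)) (σ ((x - 1, y), true))) := by
    unfold E0 cycE row
    rw [Finset.sum_comm]
  have h1 : E1 σ = ∑ x : ZMod L, ∑ y : ZMod L, (mm (σ ((x, y), false)) (σ ((x, y), true)) +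
      mm (σ ((x, y), false)) (σ ((x, y - 1), true))) := rfl
  rw [ham_up, h0, h1, h2, Fintype.sum_prod_type]
  simp only [mis, Fin.sum_univ_three, nb, Finset.sum_add_distrib, Bool.not_false]
  omega

/-! cycle lemmas -/

lemma zmod_const {α : Type*} (f : ZMod L → α) (h : ∀ x, f x = f (x - 1)) (x y : ZMod L) :
    f x = f y := by
  have key : ∀ n : ℕ, f (n : ZMod L) = f 0 := by
    intro n
    induction n with
    | zero => simp
    | succ k ih => rw [h]; simpa using ih
  have : ∀ x : ZMod L, f x = f 0 := fun x => by
    have := key x.val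
    rwa [ZMod.natCast_zmod_val] at this
  rw [this x, this y]

def kconst {α : Type*} (k : ZMod L → α × α) (a : α) : Prop := ∀ x, (k x).1 = a ∧ (k x).2 = a

lemma cyc_zero {α : Type*} [DecidableEq α] (k : ZMod L → α × α) (h : cycE k = 0) :
    kconst k (k 0).1 := by
  unfold cycE at h
  simp only [Finset.sum_eq_zero_iff, Finset.mem_univ, true_imp_iff, Nat.add_eq_zero_iff,
    mm_eq_zero] at h
  have h1 : ∀ x, (k x).1 = (k (x - 1)).1 := fun x => by rw [(h x).2, ← (h (x - 1)).1]
  intro x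
  have := zmod_const (fun x => (k x).1) h1 x 0
  exact ⟨this, by rw [← (h x).1]; exact this⟩

lemma cyc_bool_even (k : ZMod L → Bool × Bool) : Even (cycE k) := by
  rw [← ZMod.natCast_eq_zero_iff_even]
  unfold cycE
  have hm : ∀ a b : Bool, ((mm a b : ℕ) : ZMod 2) = (a.toNat : ZMod 2) + (b.toNat : ZMod 2) := by
    decide
  push_cast
  simp only [hm, Finset.sum_add_distrib]
  have : ∑ x, (((k (x - 1)).2.toNat : ℕ) : ZMod 2) = ∑ x, (((k x).2.toNat : ℕ) : ZMod 2) :=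
    Fintype.sum_equiv (Equiv.subRight 1) _ _ fun x => rfl
  rw [this]
  have h2 : ∀ a : ZMod 2, a + a = 0 := by decide
  generalize ∑ x, (((k x).1.toNat : ℕ) : ZMod 2) = a
  generalize ∑ x, (((k x).2.toNat : ℕ) : ZMod 2) = b
  revert a b; decide

/-- value `a` occurs in the cycle -/
def occ {α : Type*} (k : ZMod L → α × α) (a : α) : Prop := ∃ x, (k x).1 = a ∨ (k x).2 = a

lemma cyc_map_le {α γ : Type*} [DecidableEq α] [DecidableEq γ] (f : α → γ) (k : ZMod L → α × α) :
    cycE (fun x => (f (k x).1, f (k x).2)) ≤ cycE k := by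
  unfold cycE
  exact Finset.sum_le_sum fun x _ => add_le_add (mm_map_le f _ _) (mm_map_le f _ _)

lemma cyc_bool_ge (k : ZMod L → Bool × Bool) (h1 : occ k true) (h2 : occ k false) :
    2 ≤ cycE k := by
  have he := cyc_bool_even k
  have h0 : cycE k ≠ 0 := by
    intro h
    have hc := cyc_zero k h
    obtain ⟨x, hx⟩ := h1
    obtain ⟨y, hy⟩ := h2
    have h1 := hc x
    have h2 := hc y
    rcases hx with hx | hx <;> rcases hy with hy | hy <;> simp_all
  obtain ⟨r, hr⟩ := he
  omega

lemma occ_map {α γ : Type*} (f : α → γ) {k : ZMod L → α × α} {a : α} (h : occ k a) :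
    occ (fun x => (f (k x).1, f (k x).2)) (f a) := by
  obtain ⟨x, hx⟩ := h
  exact ⟨x, by rcases hx with hx | hx <;> simp [hx]⟩

lemma cyc_ge_two {α : Type*} [DecidableEq α] (k : ZMod L → α × α) {a b : α} (hab : a ≠ b)
    (ha : occ k a) (hb : occ k b) : 2 ≤ cycE k := by
  refine le_trans ?_ (cyc_map_le (fun c => decide (c = a)) k)
  apply cyc_bool_ge
  · simpa using occ_map (fun c => decide (c = a)) ha
  · simpa [hab.symm] using occ_map (fun c => decide (c = a)) hb

lemma cyc_ge_three {α : Type*} [DecidableEq α] (k : ZMod L → α × α) {a b c : α} (hab : a ≠ b)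
    (hac : a ≠ c) (hbc : b ≠ c)
    (ha : occ k a) (hb : occ k b) (hc : occ k c) : 3 ≤ cycE k := by
  have hA : 2 ≤ cycE (fun x => (decide ((k x).1 = a), decide ((k x).2 = a))) := by
    apply cyc_bool_ge
    · simpa using occ_map (fun c => decide (c = a)) ha
    · simpa [hab.symm] using occ_map (fun c => decide (c = a)) hb
  have hB : 2 ≤ cycE (fun x => (decide ((k x).1 = b), decide ((k x).2 = b))) := by
    apply cyc_bool_ge
    · simpa using occ_map (fun c => decide (c = b)) hb
    · simpa [hbc.symm] using occ_map (fun d => decide (d = b)) hc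
  have hC : 2 ≤ cycE (fun x => (decide ((k x).1 = c), decide ((k x).2 = c))) := by
    apply cyc_bool_ge
    · simpa using occ_map (fun d => decide (d = c)) hc
    · simpa [hbc] using occ_map (fun d => decide (d = c)) hb
  have hm : ∀ u v : α, mm (decide (u = a)) (decide (v = a)) + mm (decide (u = b)) (decide (v = b)) +
      mm (decide (u = c)) (decide (v = c)) ≤ 2 * mm u v := by
    intro u v
    unfold mm
    by_cases huv : u = v
    · subst huv; simp
    · by_cases h1 : u = a <;> by_cases h2 : u = b <;> by_cases h3 : u = c <;>
      by_cases h4 : v = a <;> by_cases h5 : v = b <;> by_cases h6 : v = c <;>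
      simp [h1, h2, h3, h4, h5, h6] <;> simp_all
  have : cycE (fun x => (decide ((k x).1 = a), decide ((k x).2 = a))) +
    cycE (fun x => (decide ((k x).1 = b), decide ((k x).2 = b))) +
    cycE (fun x => (decide ((k x).1 = c), decide ((k x).2 = c))) ≤ 2 * cycE k := by
    unfold cycE
    rw [← Finset.sum_add_distrib, ← Finset.sum_add_distrib, Finset.mul_sum]
    refine Finset.sum_le_sum fun x _ => ?_
    have h1 := hm (k x).1 (k x).2
    have h2 := hm (k x).1 (k (x - 1)).2
    simp only
    omega
  omega

lemma cyc_ne_one {α : Type*} [DecidableEq α] (k : ZMod L → α × α) : cycE k ≠ 1 := by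
  intro h
  by_cases hc : kconst k (k 0).1
  · have : cycE k = 0 := by
      unfold cycE
      refine Finset.sum_eq_zero fun x _ => ?_
      rw [(hc x).1, (hc x).2, (hc (x - 1)).2]; simp [mm_self]
    omega
  · unfold kconst at hc
    push Not at hc
    obtain ⟨x, hx⟩ := hc
    have : ∃ b, b ≠ (k 0).1 ∧ occ k b := by
      by_cases h1 : (k x).1 = (k 0).1
      · exact ⟨_, hx h1, x, Or.inr rfl⟩
      · exact ⟨_, h1, x, Or.inl rfl⟩
    obtain ⟨b, hb, ho⟩ := this
    have := cyc_ge_two k hb ho ⟨0, Or.inl rfl⟩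
    omega

end P1

section P2
variable {L q : ℕ} [NeZero L]

/-- no strip of direction `d` is monochromatic in the `A`-sense -/
def NoBr (A : Finset (Fin q)) (d : Fin 3) (σ : Conf L q) : Prop :=
  ∀ v0 : Site L, (∃ v, sidx d v = sidx d v0 ∧ σ v ∈ A) ∧ (∃ v, sidx d v = sidx d v0 ∧ σ v ∉ A)

def CF (A : Finset (Fin q)) (σ : Conf L q) : Prop := ∃ d, ∀ d', d' ≠ d → NoBr A d' σ

def NB (A : Finset (Fin q)) (σ : Conf L q) : Prop := NoBr A 1 σ ∧ NoBr A 2 σ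

def ABr (A : Finset (Fin q)) (σ : Conf L q) : Prop :=
  ∃ (d : Fin 3) (v0 : Site L), ∀ v, sidx d v = sidx d v0 → σ v ∈ A

lemma NoBr_th (A : Finset (Fin q)) (d e : Fin 3) (σ : Conf L q) :
    NoBr A e (σ ∘ th d) ↔ NoBr A (tp d e) σ := by
  constructor
  · intro h v0
    obtain ⟨⟨v, hv, ha⟩, ⟨w, hw, hb⟩⟩ := h (th d v0)
    refine ⟨⟨th d v, ?_, ha⟩, ⟨th d w, ?_, hb⟩⟩
    · have := (sidx_th d e v (th d v0)).2 hv
      rwa [th_th] at this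
    · have := (sidx_th d e w (th d v0)).2 hw
      rwa [th_th] at this
  · intro h v0
    obtain ⟨⟨v, hv, ha⟩, ⟨w, hw, hb⟩⟩ := h (th d v0)
    refine ⟨⟨th d v, ?_, by simpa [th_th] using ha⟩, ⟨th d w, ?_, by simpa [th_th] using hb⟩⟩
    · apply (sidx_th d e _ _).1
      simpa [th_th] using hv
    · apply (sidx_th d e _ _).1
      simpa [th_th] using hw

lemma CF_iff (A : Finset (Fin q)) (σ : Conf L q) : CF A σ ↔ ∃ d, NB A (σ ∘ th d) := by
  unfold CF NB
  simp only [NoBr_th]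
  constructor
  · rintro ⟨d, hd⟩
    refine ⟨d, hd _ ?_, hd _ ?_⟩ <;> clear hd <;> revert d <;> decide
  · rintro ⟨d, h1, h2⟩
    refine ⟨d, fun d' hd' => ?_⟩
    have : d' = tp d 1 ∨ d' = tp d 2 := by clear h1 h2; revert d d'; decide
    rcases this with rfl | rfl <;> assumption

lemma tp_inj (d : Fin 3) {e e' : Fin 3} (h : tp d e = tp d e') : e = e' := by
  rw [← tp_tp d e, h, tp_tp]

lemma CF_th (A : Finset (Fin q)) (d : Fin 3) (σ : Conf L q) : CF A (σ ∘ th d) ↔ CF A σ := by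
  unfold CF
  simp only [NoBr_th]
  constructor
  · rintro ⟨e, he⟩
    refine ⟨tp d e, fun d' hd' => ?_⟩
    have := he (tp d d') (fun h => hd' (by rw [← h, tp_tp]))
    rwa [tp_tp] at this
  · rintro ⟨e, he⟩
    refine ⟨tp d e, fun d' hd' => he _ (fun h => hd' (by rw [← h, tp_tp]))⟩

lemma ABr_th (A : Finset (Fin q)) (d : Fin 3) (σ : Conf L q) : ABr A (σ ∘ th d) ↔ ABr A σ := by
  have key : ∀ τ : Conf L q, ABr A τ → ABr A (τ ∘ th d) := by
    rintro τ ⟨e, v0, h⟩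
    refine ⟨tp d e, th d v0, fun v hv => h _ ?_⟩
    apply (sidx_th d e _ _).1
    simpa [th_th] using hv
  refine ⟨fun h => ?_, key σ⟩
  have := key _ h
  rwa [comp_th_th] at this

lemma strip_meet [Fact (1 < L)] {d d' : Fin 3} (h : d ≠ d') (v0 w0 : Site L) :
    ∃ u1 u2 : Site L, u1 ≠ u2 ∧ sidx d u1 = sidx d v0 ∧ sidx d u2 = sidx d v0 ∧
      sidx d' u1 = sidx d' w0 ∧ sidx d' u2 = sidx d' w0 := by
  generalize sidx d v0 = l
  generalize sidx d' w0 = m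
  have key : ∀ e e' : Fin 3, e < e' → ∀ l m : ZMod L, ∃ u1 u2 : Site L, u1 ≠ u2 ∧
      sidx e u1 = l ∧ sidx e u2 = l ∧ sidx e' u1 = m ∧ sidx e' u2 = m := by
    intro e e' hee l m
    have : (e = 0 ∧ e' = 1) ∨ (e = 0 ∧ e' = 2) ∨ (e = 1 ∧ e' = 2) := by revert e e'; decide
    rcases this with ⟨rfl, rfl⟩ | ⟨rfl, rfl⟩ | ⟨rfl, rfl⟩
    · exact ⟨((m, l), false), ((m, l), true), by simp, by simp [sidx]⟩
    · exact ⟨((m - l, l), false), ((m - 1 - l, l), true), by simp, by simp [sidx]⟩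
    · exact ⟨((l, m - l), false), ((l, m - 1 - l), true), by simp, by simp [sidx]⟩
  rcases lt_or_gt_of_ne h with h | h
  · exact key d d' h l m
  · obtain ⟨u1, u2, a, b, c, e, f⟩ := key d' d h m l
    exact ⟨u1, u2, a, e, f, b, c⟩

lemma nonCF_bridge {A : Finset (Fin q)} {σ : Conf L q} (h : ¬ CF A σ) (d : Fin 3) :
    ∃ d', d' ≠ d ∧ ∃ v0 : Site L, (∀ v, sidx d' v = sidx d' v0 → σ v ∈ A) ∨
      (∀ v, sidx d' v = sidx d' v0 → σ v ∉ A) := by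
  unfold CF at h
  push Not at h
  obtain ⟨d', hd', h⟩ := h d
  refine ⟨d', hd', ?_⟩
  unfold NoBr at h
  push Not at h
  obtain ⟨v0, h⟩ := h
  refine ⟨v0, ?_⟩
  by_cases h1 : ∃ v, sidx d' v = sidx d' v0 ∧ σ v ∈ A
  · exact Or.inl (h h1)
  · push Not at h1
    exact Or.inr h1

/-- an `A`-bridge of `σ` and a `B`-bridge of `ζ` in different directions are incompatible
with a single flip -/
lemma bridge_conflict [Fact (1 < L)] {A : Finset (Fin q)} {σ ζ : Conf L q}
    (hf : σ = ζ ∨ oneFlip σ ζ)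
    {d d' : Fin 3} (hd : d ≠ d') {v0 w0 : Site L} (h1 : ∀ v, sidx d v = sidx d v0 → σ v ∈ A)
    (h2 : ∀ v, sidx d' v = sidx d' w0 → ζ v ∉ A) : False := by
  obtain ⟨u1, u2, hne, a1, a2, b1, b2⟩ := strip_meet hd v0 w0
  have e1 : σ u1 ≠ ζ u1 := fun h => h2 _ b1 (h ▸ h1 _ a1)
  have e2 : σ u2 ≠ ζ u2 := fun h => h2 _ b2 (h ▸ h1 _ a2)
  rcases hf with rfl | ⟨z, hz, hz'⟩
  · exact e1 rfl
  · have h1 : u1 = z := by by_contra h; exact e1 (hz' _ h)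
    have h2 : u2 = z := by by_contra h; exact e2 (hz' _ h)
    exact hne (h1.trans h2.symm)

lemma X1 [Fact (1 < L)] {A : Finset (Fin q)} {σ ζ : Conf L q} (hf : oneFlip σ ζ)
    (h2 : ¬ CF A ζ) (hb : ABr A σ) : ABr A ζ := by
  obtain ⟨d, v0, h⟩ := hb
  obtain ⟨d', hd', w0, hw | hw⟩ := nonCF_bridge h2 d
  · exact ⟨d', w0, hw⟩
  · exact (bridge_conflict (Or.inr hf) hd'.symm h hw).elim

lemma nonCF_B [Fact (1 < L)] {A : Finset (Fin q)} {σ : Conf L q} (h : ¬ CF A σ)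
    {d : Fin 3} {v0 : Site L} (hb : ∀ v, sidx d v = sidx d v0 → σ v ∉ A) : ¬ ABr A σ := by
  rintro ⟨e, w0, he⟩
  by_cases hde : e = d
  · subst hde
    obtain ⟨d', hd', w1, hw | hw⟩ := nonCF_bridge h e
    · exact bridge_conflict (Or.inl rfl) hd' hw hb
    · exact bridge_conflict (Or.inl rfl) hd'.symm he hw
  · exact bridge_conflict (Or.inl rfl) hde he hb

/-! energies of cross-free configurations -/

lemma NB_col {A : Finset (Fin q)} {σ : Conf L q} (h : NoBr A 1 σ) (x : ZMod L) :
    2 ≤ cycE (col σ x) := by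
  obtain ⟨⟨⟨⟨x1, y1⟩, b1⟩, h1, h1'⟩, ⟨⟨⟨x2, y2⟩, b2⟩, h2, h2'⟩⟩ := h ((x, 0), false)
  simp only [sidx] at h1 h2
  subst h1 h2
  refine cyc_ge_two _ (fun he => h2' (he ▸ h1')) (a := σ ((x2, y1), b1)) (b := σ ((x2, y2), b2))
    ⟨y1, ?_⟩ ⟨y2, ?_⟩
  · cases b1 <;> simp [col]
  · cases b2 <;> simp [col]

lemma dia_occ (σ : Conf L q) (v : Site L) (l : ZMod L) (h : sidx 2 v = l) :
    occ (dia σ l) (σ v) := by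
  obtain ⟨⟨x, y⟩, b⟩ := v
  subst h
  refine ⟨x, ?_⟩
  cases b
  · left; simp [dia, sidx]
  · right
    have : x + y + 1 - 1 - x = y := by ring
    simp [dia, sidx, this]

lemma col_occ (σ : Conf L q) (v : Site L) : occ (col σ v.1.1) (σ v) := by
  obtain ⟨⟨x, y⟩, b⟩ := v
  refine ⟨y, ?_⟩
  cases b <;> simp [col]

lemma row_occ (σ : Conf L q) (v : Site L) : occ (row σ v.1.2) (σ v) := by
  obtain ⟨⟨x, y⟩, b⟩ := v
  refine ⟨x, ?_⟩
  cases b <;> simp [row]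

lemma NB_dia {A : Finset (Fin q)} {σ : Conf L q} (h : NoBr A 2 σ) (l : ZMod L) :
    2 ≤ cycE (dia σ l) := by
  obtain ⟨⟨v, h1, h1'⟩, ⟨w, h2, h2'⟩⟩ := h ((l, 0), false)
  have e : sidx 2 (((l, 0), false) : Site L) = l := by simp [sidx]
  rw [e] at h1 h2
  exact cyc_ge_two _ (fun he : σ v = σ w => h2' (he ▸ h1')) (dia_occ σ v l h1) (dia_occ σ w l h2)

lemma sum_ge_two (f : ZMod L → ℕ) (h : ∀ x, 2 ≤ f x) : 2 * L ≤ ∑ x, f x := by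
  calc 2 * L = ∑ x : ZMod L, 2 := by simp [ZMod.card]; ring
    _ ≤ _ := Finset.sum_le_sum fun x _ => h x

lemma NB_E1 {A : Finset (Fin q)} {σ : Conf L q} (h : NB A σ) : 2 * L ≤ E1 σ :=
  sum_ge_two _ (NB_col h.1)
lemma NB_E2 {A : Finset (Fin q)} {σ : Conf L q} (h : NB A σ) : 2 * L ≤ E2 σ :=
  sum_ge_two _ (NB_dia h.2)

/-- set of non-constant rows -/
noncomputable def ncr (σ : Conf L q) : Finset (ZMod L) := Finset.univ.filter fun y => cycE (row σ y) ≠ 0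

lemma ncr_card (σ : Conf L q) : 2 * (ncr σ).card ≤ E0 σ := by
  calc 2 * (ncr σ).card = ∑ y ∈ ncr σ, 2 := by simp [mul_comm]
    _ ≤ ∑ y ∈ ncr σ, cycE (row σ y) := Finset.sum_le_sum fun y hy => by
        have h1 : cycE (row σ y) ≠ 0 := by simpa [ncr] using hy
        have h2 := cyc_ne_one (row σ y)
        omega
    _ ≤ _ := Finset.sum_le_sum_of_subset (Finset.subset_univ _)

noncomputable def Vr (A : Finset (Fin q)) (σ : Conf L q) (y : ZMod L) : ℕ :=
  ∑ x : ZMod L, ((if σ ((x, y), false) ∈ A then 1 else 0) + (if σ ((x, y), true) ∈ A then 1 else 0))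

lemma V_rows (A : Finset (Fin q)) (σ : Conf L q) : V A σ = ∑ y, Vr A σ y := by
  unfold V Vr
  rw [sum_site, Fintype.sum_prod_type, Fintype.sum_prod_type, Finset.sum_comm,
    ← Finset.sum_add_distrib, ]
  rw [Finset.sum_comm (s := Finset.univ) (t := Finset.univ) (f := fun y x => (if σ ((x, y), false) ∈ A then 1 else 0) + (if σ ((x, y), true) ∈ A then 1 else 0))]
  simp only [Finset.sum_add_distrib]
  congr 1
  rw [Finset.sum_comm]

lemma Vr_le (A : Finset (Fin q)) (σ : Conf L q) (y : ZMod L) : Vr A σ y ≤ 2 * L := by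
  unfold Vr
  calc _ ≤ ∑ x : ZMod L, 2 := Finset.sum_le_sum fun x _ => by split_ifs <;> simp
    _ = 2 * L := by simp [ZMod.card]; ring

lemma row_const {σ : Conf L q} {y : ZMod L} (h : cycE (row σ y) = 0) (v : Site L)
    (hv : v.1.2 = y) : σ v = (row σ y 0).1 := by
  obtain ⟨⟨x, y'⟩, b⟩ := v
  simp only at hv
  subst hv
  have := cyc_zero _ h x
  cases b
  · exact this.1
  · exact this.2

lemma Vr_const (A : Finset (Fin q)) {σ : Conf L q} {y : ZMod L} (h : cycE (row σ y) = 0) :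
    Vr A σ y = if (row σ y 0).1 ∈ A then 2 * L else 0 := by
  unfold Vr
  have : ∀ x b, σ ((x, y), b) = (row σ y 0).1 := fun x b => row_const h _ rfl
  simp only [this]
  split_ifs <;> simp [ZMod.card, mul_comm]

/-- if all constant rows have colour in `A` then `V` is large -/
lemma V_ge_of_rows (A : Finset (Fin q)) (σ : Conf L q)
    (h : ∀ y, cycE (row σ y) = 0 → (row σ y 0).1 ∈ A) :
    2 * L * L ≤ V A σ + 2 * L * (ncr σ).card := by
  rw [V_rows]
  have : ∀ y : ZMod L, 2 * L ≤ Vr A σ y + if y ∈ ncr σ then 2 * L else 0 := by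
    intro y
    by_cases hy : cycE (row σ y) = 0
    · rw [Vr_const A hy, if_pos (h y hy)]; omega
    · rw [if_pos (by simpa [ncr] using hy)]; omega
  have h2 := Finset.sum_le_sum (s := Finset.univ) fun y _ => this y
  rw [Finset.sum_add_distrib] at h2
  simp only [Finset.sum_const, Finset.card_univ, ZMod.card, smul_eq_mul, Finset.sum_ite_mem,
    Finset.univ_inter] at h2
  nlinarith

lemma V_le_of_rows (A : Finset (Fin q)) (σ : Conf L q)
    (h : ∀ y, cycE (row σ y) = 0 → (row σ y 0).1 ∉ A) :
    V A σ ≤ 2 * L * (ncr σ).card := by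
  rw [V_rows]
  have : ∀ y : ZMod L, Vr A σ y ≤ if y ∈ ncr σ then 2 * L else 0 := by
    intro y
    by_cases hy : cycE (row σ y) = 0
    · rw [Vr_const A hy, if_neg (h y hy)]; omega
    · rw [if_pos (by simpa [ncr] using hy)]; exact Vr_le _ _ _
  have h2 := Finset.sum_le_sum (s := Finset.univ) fun y _ => this y
  simp only [Finset.sum_const, smul_eq_mul, Finset.sum_ite_mem,
    Finset.univ_inter] at h2
  nlinarith

lemma row_eq_of_oneFlip {σ ζ : Conf L q} (hf : oneFlip σ ζ) {u1 u2 : Site L} (h : u1 ≠ u2) :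
    σ u1 = ζ u1 ∨ σ u2 = ζ u2 := by
  obtain ⟨z, hz, hz'⟩ := hf
  by_cases h1 : u1 = z
  · right; apply hz'; rintro rfl; exact h h1
  · left; exact hz' _ h1

lemma X2aux [Fact (1 < L)] {A : Finset (Fin q)} {σ ζ : Conf L q} (hf : oneFlip σ ζ)
    (h1 : ¬ CF A σ) (h2 : NB A ζ) (hH : Ham L q ζ ≤ 2 * L + 4) :
    (ABr A σ ∧ 2 * L * L ≤ V A ζ + 2 * L * 4) ∨ (¬ ABr A σ ∧ V A ζ ≤ 2 * L * 4) := by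
  have hE := two_ham ζ
  have hE1 := NB_E1 h2
  have hE2 := NB_E2 h2
  have hc := ncr_card ζ
  have hc4 : (ncr ζ).card ≤ 4 := by omega
  have hc4' : 2 * L * (ncr ζ).card ≤ 2 * L * 4 := Nat.mul_le_mul_left _ hc4
  obtain ⟨d', hd', v0, hb | hb⟩ := nonCF_bridge h1 0
  · left
    refine ⟨⟨d', v0, hb⟩, le_trans (V_ge_of_rows A ζ fun y hy => ?_) (by omega)⟩
    obtain ⟨u1, u2, hne, a1, a2, b1, b2⟩ := strip_meet (L := L) hd' v0 ((0, y), false)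
    rcases row_eq_of_oneFlip hf hne with h | h
    · rw [← row_const hy u1 b1, ← h]; exact hb _ a1
    · rw [← row_const hy u2 b2, ← h]; exact hb _ a2
  · right
    refine ⟨nonCF_B h1 hb, le_trans (V_le_of_rows A ζ fun y hy => ?_) hc4'⟩
    obtain ⟨u1, u2, hne, a1, a2, b1, b2⟩ := strip_meet (L := L) hd' v0 ((0, y), false)
    rcases row_eq_of_oneFlip hf hne with h | h
    · rw [← row_const hy u1 b1, ← h]; exact hb _ a1
    · rw [← row_const hy u2 b2, ← h]; exact hb _ a2

lemma X2 [Fact (1 < L)] {A : Finset (Fin q)} {σ ζ : Conf L q} (hf : oneFlip σ ζ)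
    (h1 : ¬ CF A σ) (h2 : CF A ζ) (hH : Ham L q ζ ≤ 2 * L + 4) :
    (ABr A σ ∧ 2 * L * L ≤ V A ζ + 2 * L * 4) ∨ (¬ ABr A σ ∧ V A ζ ≤ 2 * L * 4) := by
  obtain ⟨d, hd⟩ := (CF_iff A ζ).1 h2
  have := X2aux (oneFlip_th d hf) (by rwa [CF_th]) hd (by rwa [ham_th])
  rwa [ABr_th, V_th] at this

end P2

section P3
variable {L q : ℕ} [NeZero L]

def lowConf (a b : Fin q) (y0 : ZMod L) (n : ℕ) (x0 : ZMod L) (p : ℕ) : Conf L q := fun v =>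
  if (v.1.2 - y0).val = 0 then (if (v.1.1 - x0).val + v.2.toNat < p then b else a)
  else if (v.1.2 - y0).val ≤ n then a else b

lemma sum_zmod {M : Type*} [AddCommMonoid M] (f : ZMod L → M) (y0 : ZMod L) :
    ∑ y, f y = ∑ j ∈ Finset.range L, f (y0 + (j : ZMod L)) := by
  symm
  refine Finset.sum_bij (fun j _ => y0 + (j : ZMod L)) (fun _ _ => Finset.mem_univ _) ?_ ?_
    (fun _ _ => rfl)
  · intro i hi j hj h
    have h2 : (i : ZMod L) = j := add_left_cancel h
    have := congrArg ZMod.val h2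
    rwa [ZMod.val_natCast_of_lt (Finset.mem_range.1 hi),
      ZMod.val_natCast_of_lt (Finset.mem_range.1 hj)] at this
  · intro y _
    exact ⟨(y - y0).val, Finset.mem_range.2 (ZMod.val_lt _), by simp⟩

lemma exists_idx (x x0 : ZMod L) : ∃ i < L, x = x0 + (i : ZMod L) :=
  ⟨(x - x0).val, ZMod.val_lt _, by simp⟩

lemma val_idx (x0 : ZMod L) {i : ℕ} (hi : i < L) : (x0 + (i : ZMod L) - x0).val = i := by
  rw [add_sub_cancel_left, ZMod.val_natCast_of_lt hi]

lemma idx_inj (x0 : ZMod L) {i j : ℕ} (hi : i < L) (hj : j < L)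
    (h : x0 + (i : ZMod L) = x0 + (j : ZMod L)) : i = j := by
  have := val_idx x0 hi
  rw [h, val_idx x0 hj] at this
  exact this.symm

lemma idx_pred (x0 : ZMod L) : x0 - 1 = x0 + ((L - 1 : ℕ) : ZMod L) := by
  have : 1 ≤ L := Nat.one_le_iff_ne_zero.2 (NeZero.ne L)
  push_cast [Nat.cast_sub this]
  simp; ring

lemma idx_succ_sub (x0 : ZMod L) (i : ℕ) : x0 + ((i + 1 : ℕ) : ZMod L) - 1 = x0 + (i : ZMod L) := by
  push_cast; ring

lemma lowConf_at (a b : Fin q) (y0 : ZMod L) (n : ℕ) (x0 : ZMod L) (p : ℕ) {i j : ℕ} (hi : i < L)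
    (hj : j < L) (c : Bool) :
    lowConf a b y0 n x0 p ((x0 + (i : ZMod L), y0 + (j : ZMod L)), c) =
      if j = 0 then (if i + c.toNat < p then b else a) else if j ≤ n then a else b := by
  unfold lowConf
  simp only [val_idx _ hi, val_idx _ hj]

lemma lowConf_row0 (a b : Fin q) (y0 : ZMod L) (n : ℕ) (x0 : ZMod L) (p : ℕ) {i : ℕ} (hi : i < L)
    (c : Bool) :
    lowConf a b y0 n x0 p ((x0 + (i : ZMod L), y0), c) = if i + c.toNat < p then b else a := by
  have h0 : 0 < L := NeZero.pos L
  have := lowConf_at a b y0 n x0 p hi h0 c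
  simpa using this

lemma lowConf_rowj (a b : Fin q) (y0 : ZMod L) (n : ℕ) (x0 x : ZMod L) (p : ℕ) {j : ℕ} (hj : j < L)
    (hj0 : j ≠ 0) (c : Bool) :
    lowConf a b y0 n x0 p ((x, y0 + (j : ZMod L)), c) = if j ≤ n then a else b := by
  obtain ⟨i, hi, rfl⟩ := exists_idx x x0
  rw [lowConf_at a b y0 n x0 p hi hj c, if_neg hj0]

lemma sum_lt_ite (L k d : ℕ) (h : k ≤ L) : ∑ j ∈ Finset.range L, (if j < k then d else 0) = k * d := by
  rw [← Finset.sum_filter]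
  have : (Finset.range L).filter (· < k) = Finset.range k := by
    ext; simp; omega
  rw [this]; simp

lemma sum_ge_ite (L k d : ℕ) (h : k ≤ L) :
    ∑ j ∈ Finset.range L, (if j < k then 0 else d) = (L - k) * d := by
  have h1 := sum_lt_ite L k d h
  have h2 : ∑ j ∈ Finset.range L, ((if j < k then 0 else d) + (if j < k then d else 0)) = L * d := by
    rw [Finset.sum_congr rfl (g := fun _ => d)]
    · simp
    · intro j _; split_ifs <;> simp
  rw [Finset.sum_add_distrib, h1] at h2
  rw [Nat.sub_mul]; omega

lemma lowConf_Vr0 (A : Finset (Fin q)) (a b : Fin q) (y0 : ZMod L) (n : ℕ) (x0 : ZMod L) (p : ℕ)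
    (hp : 1 ≤ p) (hpL : p ≤ L) :
    Vr A (lowConf a b y0 n x0 p) y0 = (if b ∈ A then 2 * p - 1 else 0) +
      (if a ∈ A then 2 * L - 2 * p + 1 else 0) := by
  unfold Vr
  rw [sum_zmod _ x0]
  have h1 : ∀ i ∈ Finset.range L, ((if lowConf a b y0 n x0 p ((x0 + (i : ZMod L), y0), false) ∈ A then 1 else 0)
     + (if lowConf a b y0 n x0 p ((x0 + (i : ZMod L), y0), true) ∈ A then 1 else 0)) =
     ((if i < p then (if b ∈ A then 1 else 0) else 0) + (if i < p then 0 else (if a ∈ A then 1 else 0)))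
     + ((if i < p - 1 then (if b ∈ A then 1 else 0) else 0) + (if i < p - 1 then 0 else (if a ∈ A then 1 else 0))) := by
    intro i hi
    rw [lowConf_row0 a b y0 n x0 p (Finset.mem_range.1 hi), lowConf_row0 a b y0 n x0 p (Finset.mem_range.1 hi)]
    simp only [Bool.toNat_false, Bool.toNat_true, add_zero]
    have : i + 1 < p ↔ i < p - 1 := by omega
    simp only [this]
    congr 1 <;> split_ifs <;> simp_all
  rw [Finset.sum_congr rfl h1]
  simp only [Finset.sum_add_distrib]
  rw [sum_lt_ite _ _ _ hpL, sum_ge_ite _ _ _ hpL, sum_lt_ite _ _ _ (by omega), sum_ge_ite _ _ _ (by omega)]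
  split_ifs <;> omega

lemma lowConf_Vrj (A : Finset (Fin q)) (a b : Fin q) (y0 : ZMod L) (n : ℕ) (x0 : ZMod L) (p : ℕ)
    {j : ℕ} (hj : j < L) (hj0 : j ≠ 0) :
    Vr A (lowConf a b y0 n x0 p) (y0 + (j : ZMod L)) =
     if (if j ≤ n then a else b) ∈ A then 2 * L else 0 := by
  unfold Vr
  simp only [lowConf_rowj a b y0 n x0 _ p hj hj0]
  split_ifs <;> simp [ZMod.card, mul_comm]

lemma lowConf_V (A : Finset (Fin q)) (a b : Fin q) (y0 : ZMod L) (n : ℕ) (x0 : ZMod L) (p : ℕ)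
    (hp : 1 ≤ p) (hpL : p ≤ L) (hn : n + 1 ≤ L) :
    V A (lowConf a b y0 n x0 p) = (if b ∈ A then 2 * L * (L - 1 - n) + 2 * p - 1 else 0) +
      (if a ∈ A then 2 * L * n + 2 * L - 2 * p + 1 else 0) := by
  rw [V_rows, sum_zmod _ y0]
  have h1 : ∀ j ∈ Finset.range L, Vr A (lowConf a b y0 n x0 p) (y0 + (j : ZMod L)) =
      (if j = 0 then Vr A (lowConf a b y0 n x0 p) y0 else 0) + 
      ((if j < 1 then 0 else (if a ∈ A then 2 * L else 0)) + (if j < n + 1 then 0 else (if b ∈ A then 2 * L else 0)))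
      - (if j < n + 1 then 0 else (if a ∈ A then 2 * L else 0)) := by
    intro j hj
    by_cases hj0 : j = 0
    · subst hj0; simp
    · rw [lowConf_Vrj A a b y0 n x0 p (Finset.mem_range.1 hj) hj0]
      have e1 : ¬ j < 1 := by omega
      have e2 : j < n + 1 ↔ j ≤ n := by omega
      simp only [e1, e2, hj0]
      split_ifs <;> simp_all
  have h2 : ∑ j ∈ Finset.range L, (Vr A (lowConf a b y0 n x0 p) (y0 + (j : ZMod L)) +
     (if j < n + 1 then 0 else (if a ∈ A then 2 * L else 0))) =
     ∑ j ∈ Finset.range L, ((if j = 0 then Vr A (lowConf a b y0 n x0 p) y0 else 0) + 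
      ((if j < 1 then 0 else (if a ∈ A then 2 * L else 0)) + (if j < n + 1 then 0 else (if b ∈ A then 2 * L else 0)))) := by
    refine Finset.sum_congr rfl fun j hj => ?_
    rw [h1 j hj]
    split_ifs <;> omega
  simp only [Finset.sum_add_distrib] at h2
  rw [sum_ge_ite _ _ _ hn, sum_ge_ite _ _ _ hn, sum_ge_ite _ _ _ (by omega), Finset.sum_ite_eq', if_pos
    (Finset.mem_range.2 (NeZero.pos L)), lowConf_Vr0 A a b y0 n x0 p hp hpL] at h2
  have e3 : (L - (n + 1)) * (2 * L) = 2 * L * (L - 1 - n) := by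
    rw [mul_comm]; congr 1; omega
  have e4 : (L - 1) * (2 * L) = 2 * L * n + 2 * L * (L - 1 - n) := by
    rw [← Nat.mul_add, mul_comm]; congr 1; omega
  generalize ∑ j ∈ Finset.range L, Vr A (lowConf a b y0 n x0 p) (y0 + (j : ZMod L)) = S at *
  split_ifs at h2 ⊢ <;> (try simp only [mul_zero, add_zero, zero_add] at h2) <;>
    generalize (L - (n + 1)) * (2 * L) = X at * <;>
    generalize 2 * L * (L - 1 - n) = Y at * <;>
    generalize (L - 1) * (2 * L) = W at * <;>
    generalize 2 * L * n = U at * <;> omega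

lemma ham_rows [Fact (1 < L)] (σ : Conf L q) : Ham L q σ =
    ∑ y : ZMod L, (cycE (row σ y) + ∑ x : ZMod L, mm (σ ((x, y), false)) (σ ((x, y - 1), true))) := by
  rw [ham_up, Fintype.sum_prod_type, Finset.sum_comm]
  refine Finset.sum_congr rfl fun y _ => ?_
  unfold cycE row
  rw [← Finset.sum_add_distrib]
  refine Finset.sum_congr rfl fun x _ => ?_
  simp [mis, Fin.sum_univ_three, nb]

lemma lowConf_ham [Fact (1 < L)] {a b : Fin q} (hab : a ≠ b) (y0 : ZMod L) (n : ℕ) (x0 : ZMod L)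
    (p : ℕ) (hp : 1 ≤ p) (hpL : p ≤ L) (hn : 1 ≤ n) (hnL : n + 2 ≤ L) :
    Ham L q (lowConf a b y0 n x0 p) = 2 * L + 1 := by
  rw [ham_rows, sum_zmod _ y0]
  have hL : 3 ≤ L := by omega
  set σ := lowConf a b y0 n x0 p with hσ
  have key : ∀ j ∈ Finset.range L, (cycE (row σ (y0 + (j : ZMod L))) + ∑ x : ZMod L,
      mm (σ ((x, y0 + (j : ZMod L)), false)) (σ ((x, y0 + (j : ZMod L) - 1), true))) =
      (if j = 0 then 2 + (L - p) else 0) + ((if j = 1 then p - 1 else 0) + (if j = n + 1 then L else 0)) := by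
    intro j hj
    have hjL := Finset.mem_range.1 hj
    rcases Nat.eq_zero_or_pos j with rfl | hj0
    · have e1 : y0 + ((0 : ℕ) : ZMod L) = y0 := by simp
      rw [e1]
      have hc : cycE (row σ y0) = 2 := by
        unfold cycE row
        rw [sum_zmod _ x0]
        have : ∀ i ∈ Finset.range L, (mm (σ ((x0 + (i : ZMod L), y0), false)) (σ ((x0 + (i : ZMod L), y0), true))
          + mm (σ ((x0 + (i : ZMod L), y0), false)) (σ ((x0 + (i : ZMod L) - 1, y0), true))) =
          (if i = p - 1 then 1 else 0) + (if i = 0 then 1 else 0) := by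
          intro i hi
          have hiL := Finset.mem_range.1 hi
          rw [hσ, lowConf_row0 a b y0 n x0 p hiL, lowConf_row0 a b y0 n x0 p hiL]
          congr 1
          · unfold mm
            by_cases h1 : i + 1 < p
            · have : i + 0 < p := by omega
              have h3 : i ≠ p - 1 := by omega
              simp [h1, h3]; omega
            · by_cases h2 : i < p
              · have h3 : i = p - 1 := by omega
                subst h3; simp [hab.symm, hp]; intro h; omega
              · have h3 : i ≠ p - 1 := by omega
                simp [h1, h2, h3]
          · rcases Nat.eq_zero_or_pos i with rfl | hi0
            · have e2 : x0 + ((0 : ℕ) : ZMod L) - 1 = x0 + ((L - 1 : ℕ) : ZMod L) := by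
                rw [← idx_pred]; simp
              rw [e2, lowConf_row0 a b y0 n x0 p (by omega)]
              unfold mm
              have h5 : ¬ (L - 1 + 1 < p) := by omega
              simp [h5, hab.symm]; omega
            · obtain ⟨i', rfl⟩ : ∃ i', i = i' + 1 := ⟨i - 1, by omega⟩
              rw [idx_succ_sub, lowConf_row0 a b y0 n x0 p (by omega)]
              simp [mm]
        rw [Finset.sum_congr rfl this, Finset.sum_add_distrib, Finset.sum_ite_eq', Finset.sum_ite_eq',
          if_pos (Finset.mem_range.2 (by omega)), if_pos (Finset.mem_range.2 (by omega))]
      rw [hc]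
      have : ∑ x : ZMod L, mm (σ ((x, y0), false)) (σ ((x, y0 - 1), true)) = L - p := by
        rw [sum_zmod _ x0, idx_pred]
        rw [Finset.sum_congr rfl (g := fun i => if i < p then 0 else 1), sum_ge_ite _ _ _ hpL, mul_one]
        intro i hi
        have hiL := Finset.mem_range.1 hi
        rw [hσ, lowConf_row0 a b y0 n x0 p hiL, lowConf_rowj a b y0 n x0 _ p (by omega) (by omega)]
        have h6 : ¬ (L - 1 ≤ n) := by omega
        unfold mm
        by_cases h7 : i < p <;> simp [h6, h7, hab]
      rw [this]
      simp
    · obtain ⟨j', rfl⟩ : ∃ j', j = j' + 1 := ⟨j - 1, by omega⟩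
      have hc : cycE (row σ (y0 + ((j' + 1 : ℕ) : ZMod L))) = 0 := by
        unfold cycE row
        refine Finset.sum_eq_zero fun x _ => ?_
        rw [hσ]
        simp only [lowConf_rowj a b y0 n x0 _ p hjL (by omega), mm_self, add_zero]
      rw [hc, idx_succ_sub, zero_add]
      rcases Nat.eq_zero_or_pos j' with rfl | hj'0
      · have e1 : y0 + ((0 : ℕ) : ZMod L) = y0 := by simp
        rw [e1, sum_zmod _ x0]
        rw [Finset.sum_congr rfl (g := fun i => if i < p - 1 then 1 else 0), sum_lt_ite _ _ _ (by omega), mul_one]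
        · have h8 : 0 + 1 ≠ n + 1 := by omega
          simp [h8]; omega
        · intro i hi
          have hiL := Finset.mem_range.1 hi
          rw [hσ, lowConf_row0 a b y0 n x0 p hiL, lowConf_rowj a b y0 n x0 _ p (by omega) (by omega)]
          have h6 : i + 1 < p ↔ i < p - 1 := by omega
          have h7 : 0 + 1 ≤ n := by omega
          simp only [Bool.toNat_true, h6, h7]
          unfold mm
          by_cases h9 : i < p - 1 <;> simp [h9, hab]
      · rw [hσ]
        simp only [lowConf_rowj a b y0 n x0 _ p hjL (by omega),
          lowConf_rowj a b y0 n x0 _ p (show j' < L by omega) (by omega)]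
        have h1 : j' + 1 ≠ 0 := by omega
        have h2 : j' + 1 ≠ 1 := by omega
        simp only [Finset.sum_const, Finset.card_univ, ZMod.card, smul_eq_mul, h1, h2, if_false, zero_add]
        unfold mm
        by_cases h3 : j' + 1 ≤ n
        · have h4 : j' ≤ n := by omega
          have h5 : j' ≠ n := by omega
          simp [h3, h4, h5]
        · by_cases h4 : j' ≤ n
          · have h5 : j' = n := by omega
            subst h5; simp [hab.symm]
          · have h5 : j' ≠ n := by omega
            simp [h3, h4, h5]
  rw [Finset.sum_congr rfl key, Finset.sum_add_distrib, Finset.sum_add_distrib, Finset.sum_ite_eq',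
    Finset.sum_ite_eq', Finset.sum_ite_eq', if_pos (Finset.mem_range.2 (by omega)),
    if_pos (Finset.mem_range.2 (by omega)), if_pos (Finset.mem_range.2 (by omega))]
  omega

end P3

section P4
variable {L q : ℕ} [NeZero L]

lemma sum_one_unique {ι : Type*} [DecidableEq ι] (s : Finset ι) (f : ι → ℕ)
    (h : ∑ i ∈ s, f i = 1) :
    ∃ i ∈ s, f i = 1 ∧ ∀ j ∈ s, j ≠ i → f j = 0 := by
  have h1 : ∃ i ∈ s, f i ≠ 0 := by
    by_contra hc
    push Not at hc
    rw [Finset.sum_eq_zero hc] at h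
    omega
  obtain ⟨i, hi, hfi⟩ := h1
  rw [← Finset.add_sum_erase _ _ hi] at h
  refine ⟨i, hi, by omega, fun j hj hji => ?_⟩
  have h2 : ∑ x ∈ s.erase i, f x = 0 := by omega
  exact (Finset.sum_eq_zero_iff.1 h2) j (Finset.mem_erase.2 ⟨hji, hj⟩)

lemma all_two (f : ZMod L → ℕ) (h : ∀ x, 2 ≤ f x) (hs : ∑ x, f x ≤ 2 * L) (x : ZMod L) : f x = 2 := by
  by_contra hx
  have h3 : 3 ≤ f x := by have := h x; omega
  have : ∑ x : ZMod L, 2 < ∑ x, f x :=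
    Finset.sum_lt_sum (fun i _ => h i) ⟨x, Finset.mem_univ _, by omega⟩
  simp [ZMod.card] at this
  omega

/-- number of colour changes of `c` outside `y0` -/
def TT (c : ZMod L → Fin q) (y0 : ZMod L) : ℕ :=
  ∑ j ∈ Finset.Ico 2 L, mm (c (y0 + (j : ZMod L))) (c (y0 + ((j - 1 : ℕ) : ZMod L)))

lemma cyc_rows (hL : 3 ≤ L) (k : ZMod L → Fin q × Fin q) (c : ZMod L → Fin q) (y0 : ZMod L)
    (h : ∀ y, y ≠ y0 → k y = (c y, c y)) :
    cycE k = mm (k y0).1 (k y0).2 + mm (k y0).1 (c (y0 - 1)) + mm (c (y0 + 1)) (k y0).2 + TT c y0 := by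
  unfold cycE
  have hne : ∀ j, j < L → j ≠ 0 → y0 + (j : ZMod L) ≠ y0 := by
    intro j hj hj0 he
    apply hj0
    have : y0 + (j : ZMod L) = y0 + ((0 : ℕ) : ZMod L) := by simpa using he
    exact idx_inj y0 hj (by omega) this
  rw [sum_zmod _ y0, Finset.range_eq_Ico, Finset.sum_eq_sum_Ico_succ_bot (by omega),
    Finset.sum_eq_sum_Ico_succ_bot (by omega)]
  have h2 : ∑ j ∈ Finset.Ico (0 + 1 + 1) L, (mm (k (y0 + (j : ZMod L))).1 (k (y0 + (j : ZMod L))).2 +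
      mm (k (y0 + (j : ZMod L))).1 (k (y0 + (j : ZMod L) - 1)).2) = TT c y0 := by
    unfold TT
    refine Finset.sum_congr rfl fun j hj => ?_
    have hj' := Finset.mem_Ico.1 hj
    obtain ⟨i, rfl⟩ : ∃ i, j = i + 1 := ⟨j - 1, by omega⟩
    rw [idx_succ_sub, h _ (hne _ hj'.2 (by omega)), h _ (hne i (by omega) (by omega))]
    simp [mm_self]
  rw [h2]
  have e0 : y0 + ((0 : ℕ) : ZMod L) = y0 := by simp
  have e1 : y0 + ((0 + 1 : ℕ) : ZMod L) - 1 = y0 := by rw [idx_succ_sub, e0]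
  have e2 : y0 + ((0 + 1 : ℕ) : ZMod L) = y0 + 1 := by simp
  have e3 : k (y0 + 1) = (c (y0 + 1), c (y0 + 1)) := h _ (by rw [← e2]; exact hne 1 (by omega) (by omega))
  have e4 : k (y0 - 1) = (c (y0 - 1), c (y0 - 1)) :=
    h _ (by rw [idx_pred]; exact hne (L - 1) (by omega) (by omega))
  rw [e0, e1, e2, e3, e4]
  simp only [mm_self]
  omega

lemma dia_cyc (σ : Conf L q) (l : ZMod L) :
    cycE (dia σ l) = cycE (fun y => (σ ((l - y, y), false), σ ((l - 1 - y, y), true))) := by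
  unfold cycE dia
  refine Fintype.sum_equiv (Equiv.subLeft l) _ _ fun x => ?_
  have e1 : l - (l - x) = x := by ring
  have e2 : l - 1 - (l - x) = x - 1 := by ring
  have e3 : l - 1 - (l - x - 1) = x := by ring
  have e4 : l - x - 1 = l - 1 - x := by ring
  have e5 : l - 1 - (x - 1) = l - x := by ring
  simp only [Equiv.subLeft_apply, e1, e2, e3, e4, e5]
  have e6 : l - 1 - (l - 1 - x) = x := by ring
  rw [e6]
  omega

lemma seq_const {C : ℕ → Fin q} {s e : ℕ} (h : ∀ j, s < j → j < e → C j = C (j - 1)) :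
    ∀ j, s ≤ j → j < e → C j = C s := by
  intro j hj
  induction j, hj using Nat.le_induction with
  | base => intro _; rfl
  | succ k hk ih =>
    intro hke
    rw [h (k + 1) (by omega) hke]
    exact ih (by omega)

/-- main combinatorial classification of low configurations -/
lemma low_class [Fact (1 < L)] (hL : 3 ≤ L) {A : Finset (Fin q)} {σ : Conf L q} (hN : NB A σ)
    (hH : Ham L q σ ≤ 2 * L + 1) :
    2 * L ∣ V A σ ∨ V A σ ≤ 2 * L ∨ 2 * L * L ≤ V A σ + 2 * L ∨
    ∃ a b y0 n x0 p, ((a ∈ A ∧ b ∉ A) ∨ (a ∉ A ∧ b ∈ A)) ∧ 1 ≤ n ∧ n + 2 ≤ L ∧ 1 ≤ p ∧ p ≤ L ∧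
      σ = lowConf a b y0 n x0 p := by
  have hE := two_ham σ
  have hE1 := NB_E1 hN
  have hE2 := NB_E2 hN
  by_cases hall : ∀ y, cycE (row σ y) = 0
  · left
    rw [V_rows]
    refine Finset.dvd_sum fun y _ => ?_
    rw [Vr_const A (hall y)]
    split_ifs <;> simp
  push Not at hall
  obtain ⟨y0, hy0⟩ := hall
  right
  have hy0' := cyc_ne_one (row σ y0)
  have hE0 : cycE (row σ y0) + ∑ y ∈ Finset.univ.erase y0, cycE (row σ y) = E0 σ :=
    Finset.add_sum_erase _ (fun y => cycE (row σ y)) (Finset.mem_univ _)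
  have hrow : cycE (row σ y0) = 2 := by omega
  have hoth : ∀ y, y ≠ y0 → cycE (row σ y) = 0 := by
    have : ∑ y ∈ Finset.univ.erase y0, cycE (row σ y) = 0 := by omega
    intro y hy
    exact (Finset.sum_eq_zero_iff.1 this) y (Finset.mem_erase.2 ⟨hy, Finset.mem_univ _⟩)
  have hcol : ∀ x, cycE (col σ x) = 2 := all_two _ (NB_col hN.1) (by unfold E1 at *; omega)
  have hdia : ∀ l, cycE (dia σ l) = 2 := all_two _ (NB_dia hN.2) (by unfold E2 at *; omega)
  have hcard : (ncr σ).card ≤ 1 := by have := ncr_card σ; omega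
  have hcard' : 2 * L * (ncr σ).card ≤ 2 * L := by nlinarith
  set c : ZMod L → Fin q := fun y => (row σ y 0).1 with hc
  have hσc : ∀ x y b, y ≠ y0 → σ ((x, y), b) = c y := fun x y b hy => row_const (hoth y hy) _ rfl
  set u : ZMod L → Fin q := fun x => σ ((x, y0), false) with hu
  set v : ZMod L → Fin q := fun x => σ ((x, y0), true) with hv
  set a := c (y0 + 1) with ha
  set b := c (y0 - 1) with hb
  have hC : ∀ x, mm (u x) (v x) + mm (u x) b + mm a (v x) + TT c y0 = 2 := by
    intro x
    rw [← hcol x, cyc_rows hL (col σ x) c y0 (fun y hy => by simp [col, hσc _ _ _ hy])]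
    rfl
  have hD : ∀ x, mm (u x) (v (x - 1)) + mm (u x) b + mm a (v (x - 1)) + TT c y0 = 2 := by
    intro x
    rw [← hdia (x + y0), dia_cyc, cyc_rows hL _ c y0 (fun y hy => by simp [hσc _ _ _ hy])]
    have e1 : x + y0 - y0 = x := by ring
    have e2 : x + y0 - 1 - y0 = x - 1 := by ring
    simp only [e1, e2, hu, hv]
    rfl
  have hrow' : ∑ x, (mm (u x) (v x) + mm (u x) (v (x - 1))) = 2 := hrow
  have hT2 : TT c y0 ≤ 1 := by
    by_contra hT
    have h0 : ∑ x, (mm (u x) (v x) + mm (u x) (v (x - 1))) = 0 := by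
      refine Finset.sum_eq_zero fun x _ => ?_
      have := hC x
      have := hD x
      omega
    omega
  have hCj : ∀ y, y ≠ y0 → ∃ j, 1 ≤ j ∧ j < L ∧ y = y0 + (j : ZMod L) := by
    intro y hy
    obtain ⟨j, hj, rfl⟩ := exists_idx y y0
    refine ⟨j, ?_, hj, rfl⟩
    by_contra h
    have : j = 0 := by omega
    subst this
    simp at hy
  rcases Nat.eq_zero_or_pos (TT c y0) with hT | hT
  · -- all other rows have the same colour
    have hcc : ∀ y, y ≠ y0 → c y = c (y0 + ((1 : ℕ) : ZMod L)) := by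
      intro y hy
      obtain ⟨j, hj1, hjL, rfl⟩ := hCj y hy
      refine seq_const (C := fun j => c (y0 + (j : ZMod L))) (s := 1) (e := L) ?_ j hj1 hjL
      intro i hi hiL
      unfold TT at hT
      exact mm_eq_zero.1 ((Finset.sum_eq_zero_iff.1 hT) i (Finset.mem_Ico.2 ⟨by omega, hiL⟩))
    have hyy : ∀ y, cycE (row σ y) = 0 → y ≠ y0 := by rintro y hy rfl; omega
    by_cases hA : c (y0 + ((1 : ℕ) : ZMod L)) ∈ A
    · right; left
      refine le_trans (V_ge_of_rows A σ fun y hy => ?_) (by omega)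
      change c y ∈ A
      rw [hcc y (hyy y hy)]; exact hA
    · left
      refine le_trans (V_le_of_rows A σ fun y hy => ?_) hcard'
      change c y ∉ A
      rw [hcc y (hyy y hy)]; exact hA
  · right; right
    have hT1 : TT c y0 = 1 := by omega
    obtain ⟨j0, hj0, hj0', hj0''⟩ := sum_one_unique _ _ hT1
    have hj0I := Finset.mem_Ico.1 hj0
    have hne1 : c (y0 + (j0 : ZMod L)) ≠ c (y0 + ((j0 - 1 : ℕ) : ZMod L)) := by
      intro h; rw [mm_eq_zero.2 h] at hj0'; omega
    have hconstA : ∀ j, 1 ≤ j → j < j0 → c (y0 + (j : ZMod L)) = c (y0 + ((1 : ℕ) : ZMod L)) :=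
      seq_const (C := fun j => c (y0 + (j : ZMod L))) (fun i hi hiL =>
        mm_eq_zero.1 (hj0'' i (Finset.mem_Ico.2 ⟨by omega, by omega⟩) (by omega)))
    have hconstB : ∀ j, j0 ≤ j → j < L → c (y0 + (j : ZMod L)) = c (y0 + (j0 : ZMod L)) :=
      seq_const (C := fun j => c (y0 + (j : ZMod L))) (fun i hi hiL =>
        mm_eq_zero.1 (hj0'' i (Finset.mem_Ico.2 ⟨by omega, by omega⟩) (by omega)))
    have haa : c (y0 + ((1 : ℕ) : ZMod L)) = a := by simp [ha]
    have hbb : c (y0 + (j0 : ZMod L)) = b := by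
      rw [hb, idx_pred]; exact (hconstB (L - 1) (by omega) (by omega)).symm
    have hab : a ≠ b := by
      rw [hconstA (j0 - 1) (by omega) (by omega), haa, hbb] at hne1
      exact hne1.symm
    have hC1 : ∀ x, mm (u x) (v x) + mm (u x) b + mm a (v x) = 1 := fun x => by have := hC x; omega
    have hD1 : ∀ x, mm (u x) (v (x - 1)) + mm (u x) b + mm a (v (x - 1)) = 1 :=
      fun x => by have := hD x; omega
    have hcase : ∀ s t : Fin q, mm s t + mm s b + mm a t = 1 →
        (s = b ∧ t = b) ∨ (s = b ∧ t = a) ∨ (s = a ∧ t = a) := by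
      intro s t h
      unfold mm at h
      by_cases h1 : s = t <;> by_cases h2 : s = b <;> by_cases h3 : a = t <;> simp_all
    -- counts
    have hS : ∑ x, mm (u x) (v (x - 1)) = 1 := by
      have e1 : ∀ s t : Fin q, mm s t + mm s b + mm a t = 1 → mm s t + mm a t = mm a s := by
        intro s t h
        rcases hcase s t h with ⟨rfl, rfl⟩ | ⟨rfl, rfl⟩ | ⟨rfl, rfl⟩ <;> simp [mm, hab, hab.symm]
      have s1 : ∑ x, (mm (u x) (v x) + mm a (v x)) = ∑ x, mm a (u x) :=
        Finset.sum_congr rfl fun x _ => e1 _ _ (hC1 x)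
      have s2 : ∑ x, (mm (u x) (v (x - 1)) + mm a (v (x - 1))) = ∑ x, mm a (u x) :=
        Finset.sum_congr rfl fun x _ => e1 _ _ (hD1 x)
      have s3 : ∑ x, mm a (v (x - 1)) = ∑ x, mm a (v x) :=
        Fintype.sum_equiv (Equiv.subRight 1) _ _ fun x => rfl
      rw [Finset.sum_add_distrib] at s1 s2 hrow'
      omega
    obtain ⟨x0, -, hx0, hx0'⟩ := sum_one_unique _ _ hS
    have hux0 : u x0 = b := by
      rcases hcase _ _ (hD1 x0) with h | h | h
      · exact h.1
      · exact h.1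
      · rw [h.1, h.2, mm_self] at hx0; omega
    have hvx0 : v (x0 - 1) = a := by
      rcases hcase _ _ (hD1 x0) with h | h | h
      · rw [h.1, h.2, mm_self] at hx0; omega
      · exact h.2
      · exact h.2
    have hstep : ∀ x, x ≠ x0 → u x = v (x - 1) := fun x hx => mm_eq_zero.1 (hx0' x (Finset.mem_univ _) hx)
    have hva : ∀ x, u x = a → v x = a := by
      intro x hx
      rcases hcase _ _ (hC1 x) with h | h | h
      · exact absurd (hx.symm.trans h.1) hab
      · exact h.2
      · exact h.2
    have hvab : ∀ x, v x = a ∨ v x = b := by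
      intro x
      rcases hcase _ _ (hC1 x) with h | h | h
      · exact Or.inr h.2
      · exact Or.inl h.2
      · exact Or.inl h.2
    have hidx : ∀ i, i < L → i ≠ 0 → x0 + (i : ZMod L) ≠ x0 := by
      intro i hi hi0 he
      apply hi0
      have : x0 + (i : ZMod L) = x0 + ((0 : ℕ) : ZMod L) := by simpa using he
      exact idx_inj x0 hi (by omega) this
    have hex : ∃ m : ℕ, v (x0 + (m : ZMod L)) = a := ⟨L - 1, by rw [← idx_pred]; exact hvx0⟩
    set m := Nat.find hex with hm
    have hmv : v (x0 + (m : ZMod L)) = a := Nat.find_spec hex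
    have hmL : m ≤ L - 1 := Nat.find_min' hex (by rw [← idx_pred]; exact hvx0)
    have hlt : ∀ i, i < m → v (x0 + (i : ZMod L)) = b := fun i hi =>
      (hvab _).resolve_left (Nat.find_min hex hi)
    have hult : ∀ i, i ≤ m → u (x0 + (i : ZMod L)) = b := by
      intro i hi
      rcases Nat.eq_zero_or_pos i with rfl | hi0
      · simpa using hux0
      · obtain ⟨i', rfl⟩ : ∃ i', i = i' + 1 := ⟨i - 1, by omega⟩
        rw [hstep _ (hidx _ (by omega) (by omega)), idx_succ_sub]
        exact hlt _ (by omega)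
    have hge : ∀ i, m ≤ i → i < L → v (x0 + (i : ZMod L)) = a ∧ (m < i → u (x0 + (i : ZMod L)) = a) := by
      intro i hi
      induction i, hi using Nat.le_induction with
      | base => intro _; exact ⟨hmv, fun h => absurd h (lt_irrefl _)⟩
      | succ k hk ih =>
        intro hkL
        have h1 : u (x0 + ((k + 1 : ℕ) : ZMod L)) = a := by
          rw [hstep _ (hidx _ (by omega) (by omega)), idx_succ_sub]
          exact (ih (by omega)).1
        exact ⟨hva _ h1, fun _ => h1⟩
    refine ⟨a, b, y0, j0 - 1, x0, m + 1, ?_, by omega, by omega, by omega, by omega, ?_⟩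
    · -- one colour in A, the other not
      have hcolv : ∀ w : Site L, w.1.1 = x0 → σ w = a ∨ σ w = b := by
        rintro ⟨⟨x, y⟩, t⟩ hw
        simp only at hw
        subst hw
        by_cases hy : y = y0
        · subst hy
          cases t
          · exact Or.inr hux0
          · exact hvab _
        · rw [hσc _ _ _ hy]
          obtain ⟨j, hj1, hjL, rfl⟩ := hCj y hy
          by_cases hjj : j < j0
          · left; rw [hconstA j hj1 hjj, haa]
          · right; rw [hconstB j (by omega) hjL, hbb]
      obtain ⟨⟨w1, h1, h1'⟩, ⟨w2, h2, h2'⟩⟩ := hN.1 ((x0, 0), false)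
      have k1 := hcolv w1 h1
      have k2 := hcolv w2 h2
      by_cases hA : a ∈ A <;> by_cases hB : b ∈ A
      · rcases k2 with k2 | k2 <;> rw [k2] at h2' <;> contradiction
      · exact Or.inl ⟨hA, hB⟩
      · exact Or.inr ⟨hA, hB⟩
      · rcases k1 with k1 | k1 <;> rw [k1] at h1' <;> contradiction
    · funext w
      obtain ⟨⟨x, y⟩, t⟩ := w
      by_cases hy : y = y0
      · subst hy
        obtain ⟨i, hi, rfl⟩ := exists_idx x x0
        rw [lowConf_row0 _ _ _ _ _ _ hi]
        cases t
        · by_cases him : i < m + 1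
          · rw [if_pos (by simpa using him)]; exact hult i (by omega)
          · rw [if_neg (by simpa using him)]; exact (hge i (by omega) hi).2 (by omega)
        · by_cases him : i < m
          · rw [if_pos (by simpa using him)]; exact hlt i (by omega)
          · rw [if_neg (by simpa using him)]; exact (hge i (by omega) hi).1
      · rw [hσc _ _ _ hy]
        obtain ⟨j, hj1, hjL, rfl⟩ := hCj y hy
        rw [lowConf_rowj _ _ _ _ _ _ _ hjL (by omega)]
        by_cases hjj : j < j0
        · rw [if_pos (by omega), hconstA j hj1 hjj, haa]
        · rw [if_neg (by omega), hconstB j (by omega) hjL, hbb]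

end P4

section P5
variable {L q : ℕ} [NeZero L]

def low (A : Finset (Fin q)) (ζ : Conf L q) : Prop := CF A ζ ∧ Ham L q ζ ≤ 2 * L + 1

lemma low_th (A : Finset (Fin q)) [Fact (1 < L)] (d : Fin 3) (ζ : Conf L q) :
    low A (ζ ∘ th d) ↔ low A ζ := by
  unfold low; rw [CF_th, ham_th]

lemma lowConf_V_cases {A : Finset (Fin q)} {a b : Fin q} (hab : (a ∈ A ∧ b ∉ A) ∨ (a ∉ A ∧ b ∈ A))
    (y0 : ZMod L) (n : ℕ) (x0 : ZMod L) (p : ℕ)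
    (hp : 1 ≤ p) (hpL : p ≤ L) (hn : n + 1 ≤ L) :
    (a ∈ A ∧ b ∉ A ∧ V A (lowConf a b y0 n x0 p) = 2 * L * n + (2 * L - 2 * p + 1)) ∨
    (a ∉ A ∧ b ∈ A ∧ V A (lowConf a b y0 n x0 p) = 2 * L * (L - 1 - n) + (2 * p - 1)) := by
  rw [lowConf_V A a b y0 n x0 p hp hpL hn]
  rcases hab with ⟨h1, h2⟩ | ⟨h1, h2⟩
  · left; refine ⟨h1, h2, ?_⟩; simp only [h1, h2, if_true, if_false]
    generalize 2 * L * n = X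
    omega
  · right; refine ⟨h1, h2, ?_⟩; simp only [h1, h2, if_true, if_false]
    generalize 2 * L * (L - 1 - n) = X
    omega

lemma low_V [Fact (1 < L)] (hL : 3 ≤ L) {A : Finset (Fin q)} {σ : Conf L q} (h : low A σ) :
    2 * L ∣ V A σ ∨ V A σ ≤ 2 * L ∨ 2 * L * L ≤ V A σ + 2 * L ∨ V A σ % 2 = 1 := by
  obtain ⟨d, hd⟩ := (CF_iff A σ).1 h.1
  rcases low_class hL hd (by rw [ham_th]; exact h.2) with h1 | h1 | h1 | h1
  · rw [V_th] at h1; exact Or.inl h1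
  · rw [V_th] at h1; exact Or.inr (Or.inl h1)
  · rw [V_th] at h1; exact Or.inr (Or.inr (Or.inl h1))
  · obtain ⟨a, b, y0, n, x0, p, hab, hn, hnL, hp, hpL, he⟩ := h1
    right; right; right
    rw [← V_th A d, he]
    rcases lowConf_V_cases hab y0 n x0 p hp hpL (by omega) with ⟨-, -, h⟩ | ⟨-, -, h⟩ <;> rw [h]
    · rw [mul_assoc]; omega
    · rw [mul_assoc]; omega

lemma V_oneFlip {A : Finset (Fin q)} {σ ζ : Conf L q} (h : oneFlip σ ζ) :
    V A σ ≤ V A ζ + 1 ∧ V A ζ ≤ V A σ + 1 := by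
  obtain ⟨z, c, hc, rfl⟩ := (oneFlip_iff σ ζ).1 h
  have := V_update A σ z c
  split_ifs at this <;> omega

lemma Vr_oneFlip {A : Finset (Fin q)} {σ ζ : Conf L q} (h : oneFlip σ ζ) (y : ZMod L) :
    Vr A σ y ≤ Vr A ζ y + 1 := by
  obtain ⟨⟨⟨x0, y0⟩, t⟩, hz, hz'⟩ := h
  unfold Vr
  have key : ∀ x, ((if σ ((x, y), false) ∈ A then 1 else 0) + (if σ ((x, y), true) ∈ A then 1 else 0)) ≤
      ((if ζ ((x, y), false) ∈ A then 1 else 0) + (if ζ ((x, y), true) ∈ A then 1 else 0)) +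
      (if x = x0 then 1 else 0) := by
    intro x
    by_cases hx : x = x0
    · subst hx
      cases t
      · rw [hz' ((x, y), true) (by simp), if_pos rfl]
        have : (if σ ((x, y), false) ∈ A then 1 else 0) ≤ 1 := by split_ifs <;> simp
        omega
      · rw [hz' ((x, y), false) (by simp), if_pos rfl]
        have : (if σ ((x, y), true) ∈ A then 1 else 0) ≤ 1 := by split_ifs <;> simp
        omega
    · rw [hz' ((x, y), true) (by simp [hx]), hz' ((x, y), false) (by simp [hx])]
      simp [hx]
  refine le_trans (Finset.sum_le_sum fun x _ => key x) ?_
  rw [Finset.sum_add_distrib]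
  simp

/-- two flips changing `V` by two -/
lemma two_step {A : Finset (Fin q)} {σ ζ ζ' : Conf L q} (h1 : oneFlip σ ζ) (h2 : oneFlip σ ζ')
    (hV : V A ζ' = V A ζ + 2) :
    ∃ z z', z ≠ z' ∧ (∀ v, v ≠ z → v ≠ z' → ζ v = ζ' v) ∧
     σ = Function.update ζ z (ζ' z) ∧ σ = Function.update ζ' z' (ζ z') ∧
     ζ z ∉ A ∧ ζ' z ∈ A ∧ ζ z' ∉ A ∧ ζ' z' ∈ A := by
  obtain ⟨z, c, hc, e1⟩ := (oneFlip_iff ζ σ).1 (oneFlip_symm h1)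
  obtain ⟨z', c', hc', e2⟩ := (oneFlip_iff ζ' σ).1 (oneFlip_symm h2)
  have v1 := V_update A ζ z c
  have v2 := V_update A ζ' z' c'
  rw [← e1] at v1
  rw [← e2] at v2
  have hA1 : ζ z ∉ A := by intro h; simp only [h, if_true] at v1; split_ifs at v1 v2 <;> omega
  have hA2 : c ∈ A := by
    by_contra h; simp only [h, hA1, if_false] at v1; split_ifs at v2 <;> omega
  simp only [hA1, hA2, if_true, if_false] at v1
  have hA3 : ζ' z' ∈ A := by by_contra h; simp only [h, if_false] at v2; split_ifs at v2 <;> omega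
  have hA4 : c' ∉ A := by intro h; simp only [h, hA3, if_true] at v2; omega
  have hne : z ≠ z' := by
    rintro rfl
    have : σ z = c := by rw [e1]; simp
    have : σ z = c' := by rw [e2]; simp
    exact hA4 (by rw [← this, ‹σ z = c›]; exact hA2)
  have s1 : σ z = ζ' z := by rw [e2, Function.update_of_ne hne]
  have s2 : σ z' = ζ z' := by rw [e1, Function.update_of_ne hne.symm]
  have hcz : c = ζ' z := by rw [← s1, e1]; simp
  have hcz' : c' = ζ z' := by rw [← s2, e2]; simp
  refine ⟨z, z', hne, ?_, hcz ▸ e1, hcz' ▸ e2, hA1, hcz ▸ hA2, hcz' ▸ hA4, hA3⟩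
  intro v hv hv'
  have t1 : σ v = ζ v := by rw [e1, Function.update_of_ne hv]
  have t2 : σ v = ζ' v := by rw [e2, Function.update_of_ne hv']
  rw [← t1, t2]

lemma common_le_two (A : Finset (Fin q)) (ζ ζ' : Conf L q)
    (hV : V A ζ' = V A ζ + 2 ∨ V A ζ = V A ζ' + 2) :
    (Finset.univ.filter fun σ : Conf L q => oneFlip σ ζ ∧ oneFlip σ ζ').card ≤ 2 := by
  rcases Finset.eq_empty_or_nonempty
    (Finset.univ.filter fun σ : Conf L q => oneFlip σ ζ ∧ oneFlip σ ζ') with he | ⟨σ, hσ⟩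
  · rw [he]; simp
  have hσ' := (Finset.mem_filter.1 hσ).2
  have main : ∀ ζ ζ' : Conf L q, V A ζ' = V A ζ + 2 → (oneFlip σ ζ ∧ oneFlip σ ζ') →
      (Finset.univ.filter fun σ : Conf L q => oneFlip σ ζ ∧ oneFlip σ ζ').card ≤ 2 := by
    intro ζ ζ' hV h
    obtain ⟨z, z', hne, hoff, -, -, -⟩ := two_step h.1 h.2 hV
    have : (Finset.univ.filter fun σ : Conf L q => oneFlip σ ζ ∧ oneFlip σ ζ') ⊆
        Finset.image (fun w => Function.update ζ w (ζ' w)) {z, z'} := by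
      intro τ hτ
      have hτ' := (Finset.mem_filter.1 hτ).2
      obtain ⟨w, w', -, -, e, -, g1, g2, -⟩ := two_step hτ'.1 hτ'.2 hV
      refine Finset.mem_image.2 ⟨w, ?_, e.symm⟩
      by_contra hw
      simp only [Finset.mem_insert, Finset.mem_singleton, not_or] at hw
      exact g1 (hoff w hw.1 hw.2 ▸ g2)
    refine le_trans (Finset.card_le_card this) (le_trans Finset.card_image_le ?_)
    exact Finset.card_le_two
  rcases hV with hV | hV
  · exact main ζ ζ' hV hσ'
  · have := main ζ' ζ hV hσ'.symm
    simpa only [and_comm] using this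

lemma arc_sub {a b : Fin q} (hab : a ≠ b) {y0 : ZMod L} {n : ℕ} {x0 x2 : ZMod L} {p p2 : ℕ}
    (hp2 : 1 ≤ p2) (hp : p2 + 1 = p) (hpL : p ≤ L)
    (hsub : ∀ v, lowConf a b y0 n x2 p2 v = b → lowConf a b y0 n x0 p v = b) :
    x2 = x0 ∨ x2 = x0 + 1 := by
  obtain ⟨i, hi, rfl⟩ := exists_idx x2 x0
  have h0 : 0 < L := NeZero.pos L
  have h1 := hsub ((x0 + (i : ZMod L), y0), false) (by
    have := lowConf_row0 a b y0 n (x0 + (i : ZMod L)) p2 h0 false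
    simp only [Nat.cast_zero, add_zero] at this
    rw [this, if_pos (by simpa using (Nat.lt_of_lt_of_le Nat.zero_lt_one hp2))])
  rw [lowConf_row0 a b y0 n x0 p hi] at h1
  have hip : i < p := by
    by_contra h
    rw [if_neg (by simpa using h)] at h1
    exact hab h1
  by_cases hi2 : i ≤ 1
  · have : i = 0 ∨ i = 1 := by omega
    rcases this with rfl | rfl
    · left; simp
    · right; simp
  exfalso
  have e : x0 + ((p - 1 : ℕ) : ZMod L) = x0 + (i : ZMod L) + ((p - 1 - i : ℕ) : ZMod L) := by
    rw [add_assoc, ← Nat.cast_add]; congr 2; omega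
  have h2 := hsub ((x0 + ((p - 1 : ℕ) : ZMod L), y0), true) (by
    rw [e, lowConf_row0 a b y0 n (x0 + (i : ZMod L)) p2 (by omega)]
    rw [if_pos (by simp only [Bool.toNat_true]; omega)])
  rw [lowConf_row0 a b y0 n x0 p (by omega), if_neg (by simp only [Bool.toNat_true]; omega)] at h2
  exact hab h2

lemma CF_to_NB {A : Finset (Fin q)} {σ : Conf L q} (h : CF A σ) (y : ZMod L)
    (hr : ∀ v : Site L, v.1.2 = y → σ v ∈ A) : NB A σ := by
  obtain ⟨d, hd⟩ := h
  have hd0 : d = 0 := by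
    by_contra hne
    obtain ⟨-, ⟨v, hv, hv'⟩⟩ := hd 0 (Ne.symm hne) ((0, y), false)
    exact hv' (hr v hv)
  subst hd0
  exact ⟨hd 1 (by decide), hd 2 (by decide)⟩

lemma CF_to_NB' {A : Finset (Fin q)} {σ : Conf L q} (h : CF A σ) (y : ZMod L)
    (hr : ∀ v : Site L, v.1.2 = y → σ v ∉ A) : NB A σ := by
  obtain ⟨d, hd⟩ := h
  have hd0 : d = 0 := by
    by_contra hne
    obtain ⟨⟨v, hv, hv'⟩, -⟩ := hd 0 (Ne.symm hne) ((0, y), false)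
    exact hr v hv hv'
  subst hd0
  exact ⟨hd 1 (by decide), hd 2 (by decide)⟩

/-- residues in the bulk -/
def bulk (L : ℕ) (m : ℕ) : Prop :=
  12 * L ≤ m ∧ m + 12 * L ≤ 2 * L * L ∧ 4 ≤ m % (2 * L) ∧ m % (2 * L) + 4 ≤ 2 * L

lemma row_agree [Fact (1 < L)] {ζ ζ' : Conf L q} {z z' : Site L}
    (hoff : ∀ v, v ≠ z → v ≠ z' → ζ v = ζ' v) (y : ZMod L) : ∃ x t, ζ ((x, y), t) = ζ' ((x, y), t) := by
  have h10 : (1 : ZMod L) ≠ 0 := one_ne_zero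
  by_contra hc
  push Not at hc
  have k : ∀ x t, ((x, y), t) = z ∨ ((x, y), t) = z' := by
    intro x t
    by_contra h
    push Not at h
    exact hc x t (hoff _ h.1 h.2)
  rcases k 0 false with h1 | h1 <;> rcases k 0 true with h2 | h2 <;> rcases k 1 false with h3 | h3 <;>
      first
      | (have e1 := h1.trans h2.symm; simp at e1; done)
      | (have e3 := h2.trans h3.symm; simp at e3; done)
      | (have e2 := h1.trans h3.symm; simp only [Prod.mk.injEq] at e2; exact absurd e2.1.1.symm h10)

lemma lowConf_Vr0_mod {A : Finset (Fin q)} {a b : Fin q} (hab : (a ∈ A ∧ b ∉ A) ∨ (a ∉ A ∧ b ∈ A))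
    (y0 : ZMod L) (n : ℕ) (x0 : ZMod L) (p : ℕ)
    (hp : 1 ≤ p) (hpL : p ≤ L) (hn : n + 1 ≤ L) :
    V A (lowConf a b y0 n x0 p) % (2 * L) = Vr A (lowConf a b y0 n x0 p) y0 := by
  rw [lowConf_Vr0 A a b y0 n x0 p hp hpL]
  rcases lowConf_V_cases hab y0 n x0 p hp hpL hn with ⟨h1, h2, h⟩ | ⟨h1, h2, h⟩ <;>
    rw [h, Nat.mul_add_mod, Nat.mod_eq_of_lt (by omega)] <;> simp [h1, h2]

/-- pinning: low configurations two steps away from a bulk low configuration -/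
lemma pinning [Fact (1 < L)] (hL : 40 ≤ L) {A : Finset (Fin q)} {a b : Fin q}
    (hab : (a ∈ A ∧ b ∉ A) ∨ (a ∉ A ∧ b ∈ A)) {y0 : ZMod L} {n : ℕ} {x0 : ZMod L} {p : ℕ}
    (hn : 6 ≤ n) (hnL : n + 7 ≤ L) (hp : 1 ≤ p) (hpL : p ≤ L)
    (hbulk : bulk L (V A (lowConf a b y0 n x0 p)))
    {σ ζ' : Conf L q} (h1 : oneFlip σ (lowConf a b y0 n x0 p)) (h2 : oneFlip σ ζ') (hlow : low A ζ')
    (hV : V A ζ' = V A (lowConf a b y0 n x0 p) + 2 ∨ V A (lowConf a b y0 n x0 p) = V A ζ' + 2) :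
    ζ' = lowConf a b y0 n x0 (p - 1) ∨ ζ' = lowConf a b y0 n (x0 + 1) (p - 1) ∨
    ζ' = lowConf a b y0 n x0 (p + 1) ∨ ζ' = lowConf a b y0 n (x0 - 1) (p + 1) := by
  have hab' : a ≠ b := by rintro rfl; tauto
  set ζ := lowConf a b y0 n x0 p with hζ
  -- difference set
  obtain ⟨z, z', hoff, hdir1, hdir2⟩ : ∃ z z', (∀ v, v ≠ z → v ≠ z' → ζ v = ζ' v) ∧
      (V A ζ' = V A ζ + 2 → ∀ v, ζ v ≠ ζ' v → ζ v ∉ A ∧ ζ' v ∈ A) ∧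
      (V A ζ = V A ζ' + 2 → ∀ v, ζ v ≠ ζ' v → ζ v ∈ A ∧ ζ' v ∉ A) := by
    rcases hV with hV | hV
    · obtain ⟨z, z', -, h, -, -, g1, g2, g3, g4⟩ := two_step h1 h2 hV
      refine ⟨z, z', h, fun _ v hv => ?_, fun hV' => by omega⟩
      by_cases e1 : v = z
      · subst e1; exact ⟨g1, g2⟩
      by_cases e2 : v = z'
      · subst e2; exact ⟨g3, g4⟩
      exact absurd (h v e1 e2) hv
    · obtain ⟨z, z', -, h, -, -, g1, g2, g3, g4⟩ := two_step h2 h1 hV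
      refine ⟨z, z', fun v e e' => (h v e e').symm, fun hV' => by omega, fun _ v hv => ?_⟩
      by_cases e1 : v = z
      · subst e1; exact ⟨g2, g1⟩
      by_cases e2 : v = z'
      · subst e2; exact ⟨g4, g3⟩
      exact absurd (h v e1 e2).symm hv
  -- an untouched constant row
  have hrow : ∃ j : ℕ, 1 ≤ j ∧ j ≤ 3 ∧ y0 + (j : ZMod L) ≠ z.1.2 ∧ y0 + (j : ZMod L) ≠ z'.1.2 := by
    by_contra hc
    push Not at hc
    have k : ∀ j : ℕ, 1 ≤ j → j ≤ 3 → y0 + (j : ZMod L) = z.1.2 ∨ y0 + (j : ZMod L) = z'.1.2 := by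
      intro j j1 j2
      by_cases h : y0 + (j : ZMod L) = z.1.2
      · exact Or.inl h
      · exact Or.inr (hc j j1 j2 h)
    have i12 : y0 + ((1 : ℕ) : ZMod L) ≠ y0 + ((2 : ℕ) : ZMod L) := fun h => by
      have := idx_inj y0 (by omega) (by omega) h; omega
    have i13 : y0 + ((1 : ℕ) : ZMod L) ≠ y0 + ((3 : ℕ) : ZMod L) := fun h => by
      have := idx_inj y0 (by omega) (by omega) h; omega
    have i23 : y0 + ((2 : ℕ) : ZMod L) ≠ y0 + ((3 : ℕ) : ZMod L) := fun h => by
      have := idx_inj y0 (by omega) (by omega) h; omega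
    rcases k 1 (by omega) (by omega) with e1 | e1 <;> rcases k 2 (by omega) (by omega) with e2 | e2 <;>
      rcases k 3 (by omega) (by omega) with e3 | e3 <;>
      first
      | exact i12 (e1.trans e2.symm)
      | exact i13 (e1.trans e3.symm)
      | exact i23 (e2.trans e3.symm)
  obtain ⟨j, hj1, hj3, hjz, hjz'⟩ := hrow
  have hrowa : ∀ v : Site L, v.1.2 = y0 + (j : ZMod L) → ζ' v = a := by
    rintro ⟨⟨x, y⟩, t⟩ hv
    simp only at hv
    subst hv
    rw [← hoff _ (by rintro rfl; exact hjz rfl) (by rintro rfl; exact hjz' rfl), hζ,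
      lowConf_rowj a b y0 n x0 x p (by omega) (by omega), if_pos (by omega)]
  have hNB : NB A ζ' := by
    by_cases ha : a ∈ A
    · exact CF_to_NB hlow.1 _ (fun v hv => by rw [hrowa v hv]; exact ha)
    · exact CF_to_NB' hlow.1 _ (fun v hv => by rw [hrowa v hv]; exact ha)
  obtain ⟨b1, b2, b3, b4⟩ := hbulk
  have hodd : V A ζ % 2 = 1 := by
    rcases lowConf_V_cases hab y0 n x0 p hp hpL (by omega) with ⟨-, -, h⟩ | ⟨-, -, h⟩ <;> rw [← hζ] at h <;>
      rw [h, mul_assoc] <;> omega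
  rcases low_class (by omega) hNB hlow.2 with h | h | h | h
  · exfalso
    have : 2 ∣ V A ζ' := Dvd.dvd.trans ⟨L, rfl⟩ h
    omega
  · exfalso; omega
  · exfalso; omega
  obtain ⟨a2, b2', y2, n2, x2, p2, hab2, hn2, hnL2, hp2, hpL2, he⟩ := h
  have hy : y2 = y0 := by
    by_contra hne
    obtain ⟨i, hi, hyi⟩ := exists_idx y0 y2
    have hi0 : i ≠ 0 := by rintro rfl; apply hne; simpa using hyi.symm
    have hr2 := lowConf_Vrj A a2 b2' y2 n2 x2 p2 hi hi0
    rw [← hyi, ← he] at hr2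
    have hr0 := lowConf_Vr0_mod hab y0 n x0 p hp hpL (by omega)
    rw [← hζ] at hr0
    have t1 := Vr_oneFlip (A := A) h1 y0
    have t2 := Vr_oneFlip (A := A) h2 y0
    have t3 := Vr_oneFlip (A := A) (oneFlip_symm h1) y0
    have t4 := Vr_oneFlip (A := A) (oneFlip_symm h2) y0
    split_ifs at hr2 <;> omega
  subst hy
  have hagree : ∀ j, j ≠ 0 → j < L → (if j ≤ n then a else b) = if j ≤ n2 then a2 else b2' := by
    intro j hj0 hj
    obtain ⟨x, t, hx⟩ := row_agree hoff (y2 + (j : ZMod L))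
    rw [he, hζ, lowConf_rowj a b y2 n x0 x p hj hj0, lowConf_rowj a2 b2' y2 n2 x2 x p2 hj hj0] at hx
    exact hx
  have ea : a = a2 := by
    have := hagree 1 (by omega) (by omega)
    rwa [if_pos (by omega), if_pos (by omega)] at this
  have eb : b = b2' := by
    have := hagree (L - 1) (by omega) (by omega)
    rwa [if_neg (by omega), if_neg (by omega)] at this
  subst ea eb
  have en : n = n2 := by
    rcases lt_trichotomy n n2 with h | h | h
    · have := hagree (n + 1) (by omega) (by omega)
      rw [if_neg (by omega), if_pos (by omega)] at this
      exact absurd this.symm hab'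
    · exact h
    · have := hagree (n2 + 1) (by omega) (by omega)
      rw [if_pos (by omega), if_neg (by omega)] at this
      exact absurd this hab'
  subst en
  have hV1 := lowConf_V_cases hab y2 n x0 p hp hpL (by omega)
  have hV2 := lowConf_V_cases hab y2 n x2 p2 hp2 hpL2 (by omega)
  rw [← hζ] at hV1
  rw [← he] at hV2
  have hpp : (p2 + 1 = p ∧ (∀ v, ζ' v = b → ζ v = b)) ∨ (p + 1 = p2 ∧ (∀ v, ζ v = b → ζ' v = b)) := by
    rcases hV1 with ⟨ha, hb, e1⟩ | ⟨ha, hb, e1⟩ <;> rcases hV2 with ⟨ha2, hb2, e2⟩ | ⟨ha2, hb2, e2⟩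
    · rcases hV with hV | hV
      · left; refine ⟨by omega, fun v hv => ?_⟩
        by_contra hne
        have := (hdir1 hV v (by rw [hv]; exact hne)).2
        rw [hv] at this; contradiction
      · right; refine ⟨by omega, fun v hv => ?_⟩
        by_contra hne
        have := (hdir2 hV v (by rw [hv]; exact fun h => hne h.symm)).1
        rw [hv] at this; contradiction
    · contradiction
    · contradiction
    · rcases hV with hV | hV
      · right; refine ⟨by omega, fun v hv => ?_⟩
        by_contra hne
        have := (hdir1 hV v (by rw [hv]; exact fun h => hne h.symm)).1
        rw [hv] at this; contradiction
      · left; refine ⟨by omega, fun v hv => ?_⟩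
        by_contra hne
        have := (hdir2 hV v (by rw [hv]; exact hne)).2
        rw [hv] at this; contradiction
  rw [he]
  rcases hpp with ⟨hpp, hs⟩ | ⟨hpp, hs⟩
  · have e3 : p - 1 = p2 := by omega
    rw [e3]
    rw [he, hζ] at hs
    rcases arc_sub hab' hp2 hpp hpL hs with rfl | rfl
    · left; rfl
    · right; left; rfl
  · subst hpp
    rw [he, hζ] at hs
    rcases arc_sub hab' hp rfl hpL2 hs with rfl | rfl
    · right; right; left; rfl
    · right; right; right; simp

end P5

section P6
variable {L q : ℕ} [NeZero L]

lemma sum_ge_two_add (f : ZMod L → ℕ) (S : Finset (ZMod L)) (h : ∀ x, 2 ≤ f x) (hS : ∀ x ∈ S, 3 ≤ f x) :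
    2 * L + S.card ≤ ∑ x, f x := by
  have : ∑ x : ZMod L, (2 + if x ∈ S then 1 else 0) ≤ ∑ x, f x := by
    refine Finset.sum_le_sum fun x _ => ?_
    split_ifs with hx
    · exact hS x hx
    · exact h x
  refine le_trans (le_of_eq ?_) this
  rw [Finset.sum_add_distrib]
  simp [ZMod.card, mul_comm]

lemma third_colour [Fact (1 < L)] (hL : 5 ≤ L) {A : Finset (Fin q)} {τ : Conf L q}
    (hH : Ham L q τ = 2 * L + 2) {a b : Fin q} (ha : a ∈ A) (hb : b ∉ A) {y1 y2 : ZMod L}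
    (h1 : ∀ v : Site L, v.1.2 = y1 → τ v = a) (h2 : ∀ v : Site L, v.1.2 = y2 → τ v = b)
    (z0 : Site L) (hza : τ z0 ≠ a) (hzb : τ z0 ≠ b) :
    ∃ n, 2 * L * n ≤ V A τ + 1 ∧ V A τ ≤ 2 * L * n + 1 := by
  have hab : a ≠ b := by rintro rfl; contradiction
  have ca : ∀ x, occ (col τ x) a := fun x => by
    have := col_occ τ ((x, y1), false); rwa [h1 _ rfl] at this
  have cb : ∀ x, occ (col τ x) b := fun x => by
    have := col_occ τ ((x, y2), false); rwa [h2 _ rfl] at this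
  have da : ∀ l, occ (dia τ l) a := fun l => by
    have := dia_occ τ ((l - y1, y1), false) l (by simp [sidx]); rwa [h1 _ rfl] at this
  have db : ∀ l, occ (dia τ l) b := fun l => by
    have := dia_occ τ ((l - y2, y2), false) l (by simp [sidx]); rwa [h2 _ rfl] at this
  have c2 : ∀ x, 2 ≤ cycE (col τ x) := fun x => cyc_ge_two _ hab (ca x) (cb x)
  have d2 : ∀ x, 2 ≤ cycE (dia τ x) := fun x => cyc_ge_two _ hab (da x) (db x)
  have c3 : ∀ v : Site L, τ v ≠ a → τ v ≠ b → 3 ≤ cycE (col τ v.1.1) := fun v e1 e2 =>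
    cyc_ge_three _ hab (Ne.symm e1) (Ne.symm e2) (ca _) (cb _) (col_occ τ v)
  have d3 : ∀ v : Site L, τ v ≠ a → τ v ≠ b → 3 ≤ cycE (dia τ (sidx 2 v)) := fun v e1 e2 =>
    cyc_ge_three _ hab (Ne.symm e1) (Ne.symm e2) (da _) (db _) (dia_occ τ v _ rfl)
  have hE := two_ham τ
  have g1 := sum_ge_two_add _ {z0.1.1} c2 (by simpa using c3 z0 hza hzb)
  have g2 := sum_ge_two_add _ {sidx 2 z0} d2 (by simpa using d3 z0 hza hzb)
  simp only [Finset.card_singleton] at g1 g2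
  have e1 : E1 τ = ∑ x, cycE (col τ x) := rfl
  have e2 : E2 τ = ∑ x, cycE (dia τ x) := rfl
  rw [← e1] at g1
  rw [← e2] at g2
  have hrow : cycE (row τ z0.1.2) ≠ 0 := by
    intro h0
    have : ∀ x ∈ (Finset.univ : Finset (ZMod L)), 3 ≤ cycE (col τ x) := by
      intro x _
      have hx : τ ((x, z0.1.2), false) = τ z0 := by
        exact (row_const h0 ((x, z0.1.2), false) rfl).trans (row_const h0 z0 rfl).symm
      exact c3 ((x, z0.1.2), false) (by rwa [hx]) (by rwa [hx])
    have := sum_ge_two_add _ Finset.univ c2 this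
    rw [← e1, Finset.card_univ, ZMod.card] at this
    omega
  have hrow1 := cyc_ne_one (row τ z0.1.2)
  have hE0 : E0 τ = cycE (row τ z0.1.2) + ∑ y ∈ Finset.univ.erase z0.1.2, cycE (row τ y) :=
    (Finset.add_sum_erase _ _ (Finset.mem_univ _)).symm
  have hrest : ∑ y ∈ Finset.univ.erase z0.1.2, cycE (row τ y) = 0 := by omega
  have hconst : ∀ y, y ≠ z0.1.2 → cycE (row τ y) = 0 := fun y hy =>
    (Finset.sum_eq_zero_iff.1 hrest) y (Finset.mem_erase.2 ⟨hy, Finset.mem_univ _⟩)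
  have hoth : ∀ w : Site L, w.1.2 = z0.1.2 → w ≠ z0 → τ w = a ∨ τ w = b := by
    intro w hw hne
    by_contra hc
    push Not at hc
    by_cases hx : w.1.1 = z0.1.1
    · have hs : sidx 2 w ≠ sidx 2 z0 := by
        obtain ⟨⟨x, y⟩, t⟩ := w
        obtain ⟨⟨x', y'⟩, t'⟩ := z0
        simp only at hw hx
        subst hw hx
        cases t <;> cases t' <;> simp [sidx] at hne ⊢
      have := sum_ge_two_add _ {sidx 2 w, sidx 2 z0} d2 (by
        intro x hx
        simp only [Finset.mem_insert, Finset.mem_singleton] at hx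
        rcases hx with rfl | rfl
        · exact d3 w hc.1 hc.2
        · exact d3 z0 hza hzb)
      rw [Finset.card_pair hs, ← e2] at this
      omega
    · have := sum_ge_two_add _ {w.1.1, z0.1.1} c2 (by
        intro x hx
        simp only [Finset.mem_insert, Finset.mem_singleton] at hx
        rcases hx with rfl | rfl
        · exact c3 w hc.1 hc.2
        · exact c3 z0 hza hzb)
      rw [Finset.card_pair hx, ← e1] at this
      omega
  obtain ⟨e, he⟩ : ∃ e, ∀ w : Site L, w.1.2 = z0.1.2 → w ≠ z0 → τ w = e := by
    refine ⟨τ ((z0.1.1, z0.1.2), !z0.2), ?_⟩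
    intro w hw hne
    by_contra hc
    have hne2 : (((z0.1.1, z0.1.2), !z0.2) : Site L) ≠ z0 := by
      obtain ⟨⟨x, y⟩, t⟩ := z0
      cases t <;> simp
    have r0 := row_occ τ z0
    have r1 := row_occ τ w
    rw [hw] at r1
    have r2 := row_occ τ ((z0.1.1, z0.1.2), !z0.2)
    simp only at r2
    have hle : cycE (row τ z0.1.2) ≤ 2 := by omega
    have k1 := hoth w hw hne
    have k2 := hoth ((z0.1.1, z0.1.2), !z0.2) rfl hne2
    have := cyc_ge_three _ hc (fun h => by rcases k1 with k | k <;> rw [k] at h <;> [exact hza h.symm; exact hzb h.symm])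
      (fun h => by rcases k2 with k | k <;> rw [k] at h <;> [exact hza h.symm; exact hzb h.symm]) r1 r2 r0
    omega
  have hall : ∀ y, cycE (row (Function.update τ z0 e) y) = 0 := by
    intro y
    by_cases hy : y = z0.1.2
    · have : ∀ v : Site L, v.1.2 = y → Function.update τ z0 e v = e := by
        intro v hv
        by_cases hvz : v = z0
        · subst hvz; simp
        · rw [Function.update_of_ne hvz]; exact he v (hv.trans hy) hvz
      have hr : row (Function.update τ z0 e) y = fun x => (e, e) := by
        funext x
        simp only [row, this ((x, y), false) rfl, this ((x, y), true) rfl]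
      rw [hr]; simp [cycE, mm]
    · have hr : row (Function.update τ z0 e) y = row τ y := by
        funext x
        unfold row
        rw [Function.update_of_ne (by rintro rfl; exact hy rfl), Function.update_of_ne (by rintro rfl; exact hy rfl)]
      rw [hr]; exact hconst y hy
  have hdvd : 2 * L ∣ V A (Function.update τ z0 e) := by
    rw [V_rows]
    refine Finset.dvd_sum fun y _ => ?_
    rw [Vr_const A (hall y)]
    split_ifs
    · exact dvd_rfl
    · exact dvd_zero _
  obtain ⟨n, hn⟩ := hdvd
  refine ⟨n, ?_⟩
  rw [← hn]
  have := V_update A τ z0 e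
  split_ifs at this <;> omega

lemma exists_row (A : Finset (Fin q)) (σ : Conf L q) (y0 : ZMod L) (hV : 2 * L * ((ncr σ).card + 1) < V A σ) :
    ∃ y, y ≠ y0 ∧ cycE (row σ y) = 0 ∧ (row σ y 0).1 ∈ A := by
  by_contra hc
  push Not at hc
  have : V A σ ≤ ∑ y : ZMod L, if y ∈ insert y0 (ncr σ) then 2 * L else 0 := by
    rw [V_rows]
    refine Finset.sum_le_sum fun y _ => ?_
    split_ifs with h
    · exact Vr_le _ _ _
    · simp only [Finset.mem_insert, not_or, ncr, Finset.mem_filter, Finset.mem_univ, true_and, not_not] at h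
      rw [Vr_const A h.2, if_neg (hc y h.1 h.2)]
  rw [← Finset.sum_filter, Finset.sum_const, Finset.filter_mem_eq_inter, Finset.univ_inter, smul_eq_mul] at this
  have h2 : (insert y0 (ncr σ)).card ≤ (ncr σ).card + 1 := Finset.card_insert_le _ _
  have h3 := Nat.mul_le_mul_right (2 * L) h2
  rw [mul_comm _ (2 * L), mul_comm _ (2 * L)] at h3
  rw [mul_comm _ (2 * L)] at this
  omega

lemma exists_row' (A : Finset (Fin q)) (σ : Conf L q) (y0 : ZMod L)
    (hV : V A σ + 2 * L * ((ncr σ).card + 1) < 2 * L * L) :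
    ∃ y, y ≠ y0 ∧ cycE (row σ y) = 0 ∧ (row σ y 0).1 ∉ A := by
  by_contra hc
  push Not at hc
  have : ∑ y : ZMod L, 2 * L ≤ V A σ + ∑ y : ZMod L, if y ∈ insert y0 (ncr σ) then 2 * L else 0 := by
    rw [V_rows, ← Finset.sum_add_distrib]
    refine Finset.sum_le_sum fun y _ => ?_
    split_ifs with h
    · omega
    · simp only [Finset.mem_insert, not_or, ncr, Finset.mem_filter, Finset.mem_univ, true_and, not_not] at h
      rw [Vr_const A h.2, if_pos (hc y h.1 h.2)]; omega
  rw [← Finset.sum_filter, Finset.sum_const, Finset.sum_const, Finset.filter_mem_eq_inter, Finset.univ_inter,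
    smul_eq_mul, smul_eq_mul, Finset.card_univ, ZMod.card] at this
  have h2 : (insert y0 (ncr σ)).card ≤ (ncr σ).card + 1 := Finset.card_insert_le _ _
  have h3 := Nat.mul_le_mul_right (2 * L) h2
  rw [mul_comm _ (2 * L), mul_comm _ (2 * L)] at h3
  rw [mul_comm _ (2 * L), mul_comm (insert y0 (ncr σ)).card (2 * L)] at this
  omega

lemma C4aux [Fact (1 < L)] (hL : 40 ≤ L) {A : Finset (Fin q)} {σ σ' : Conf L q} (hf : oneFlip σ σ')
    (h1 : NB A σ) (hH : Ham L q σ = 2 * L + 2) (hH' : Ham L q σ' = 2 * L + 2)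
    (hv1 : 11 * L < V A σ) (hv2 : V A σ + 11 * L < 2 * L * L) :
    ∃ n, 2 * L * n ≤ V A σ + 2 ∧ V A σ ≤ 2 * L * n + 2 := by
  have hE := two_ham σ
  have hE1 := NB_E1 h1
  have hE2 := NB_E2 h1
  have hc := ncr_card σ
  have hc2 : 2 * L * ((ncr σ).card + 1) ≤ 2 * L * 3 := Nat.mul_le_mul_left _ (by omega)
  obtain ⟨z, c, hcz, rfl⟩ := (oneFlip_iff σ σ').1 hf
  obtain ⟨y1, hy1, r1, ha⟩ := exists_row A σ z.1.2 (by omega)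
  obtain ⟨y2, hy2, r2, hb⟩ := exists_row' A σ z.1.2 (by omega)
  set a := (row σ y1 0).1
  set b := (row σ y2 0).1
  have s1 : ∀ v : Site L, v.1.2 = y1 → σ v = a := fun v hv => row_const r1 v hv
  have s2 : ∀ v : Site L, v.1.2 = y2 → σ v = b := fun v hv => row_const r2 v hv
  have s1' : ∀ v : Site L, v.1.2 = y1 → Function.update σ z c v = a := fun v hv => by
    rw [Function.update_of_ne (by rintro rfl; exact hy1 hv.symm)]; exact s1 v hv
  have s2' : ∀ v : Site L, v.1.2 = y2 → Function.update σ z c v = b := fun v hv => by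
    rw [Function.update_of_ne (by rintro rfl; exact hy2 hv.symm)]; exact s2 v hv
  have hab : a ≠ b := fun h => hb (h ▸ ha)
  by_cases hT : ∃ w, σ w ≠ a ∧ σ w ≠ b
  · obtain ⟨w, hwa, hwb⟩ := hT
    obtain ⟨n, hn1, hn2⟩ := third_colour (by omega) hH ha hb s1 s2 w hwa hwb
    exact ⟨n, by omega, by omega⟩
  by_cases hT' : c ≠ a ∧ c ≠ b
  · obtain ⟨n, hn1, hn2⟩ := third_colour (by omega) hH' ha hb s1' s2' z (by simpa using hT'.1) (by simpa using hT'.2)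
    have := V_oneFlip (A := A) hf
    exact ⟨n, by omega, by omega⟩
  exfalso
  push Not at hT
  have hT2 : ∀ w, σ w = a ∨ σ w = b := fun w => by
    by_cases h : σ w = a
    · exact Or.inl h
    · exact Or.inr (hT w h)
  have hfl := ham_flip σ z c
  rw [hH, hH'] at hfl
  have hsum : mis σ z a + mis σ z b = 3 := by
    unfold mis
    rw [← Finset.sum_add_distrib]
    rw [Finset.sum_congr rfl (g := fun _ => 1)]
    · simp
    · intro i _
      rcases hT2 (nb i z) with h | h <;> rw [h]
      · rw [mm_self, mm_ne (Ne.symm hab)]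
      · rw [mm_self, mm_ne hab]
  have hc' : c = a ∨ c = b := by
    by_contra h; push Not at h; exact hT' h
  rcases hT2 z with h | h <;> rcases hc' with h' | h'
  · exact hcz (h'.trans h.symm)
  · rw [h, h'] at hfl; omega
  · rw [h, h'] at hfl; omega
  · exact hcz (h'.trans h.symm)

end P6

section P7
variable {L q : ℕ} [NeZero L]

def act (L j : ℕ) : Prop :=
  12 * L ≤ j ∧ j + 12 * L < 2 * L * L ∧ 4 ≤ j % (2 * L) ∧ j % (2 * L) + 4 < 2 * L

noncomputable def cnt (L m : ℕ) : ℕ := ((Finset.range m).filter (act L)).card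

noncomputable def NN (L : ℕ) : ℕ := cnt L (2 * L * L)

noncomputable def gg (L m : ℕ) : ℝ := (cnt L m : ℝ) / (NN L : ℝ)

lemma cnt_succ (L m : ℕ) : cnt L (m + 1) = cnt L m + if act L m then 1 else 0 := by
  unfold cnt
  rw [Finset.range_add_one, Finset.filter_insert]
  split_ifs with h
  · rw [Finset.card_insert_of_notMem (by simp)]
  · simp

lemma cnt_mono {L m m' : ℕ} (h : m ≤ m') : cnt L m ≤ cnt L m' :=
  Finset.card_le_card (Finset.filter_subset_filter _ (Finset.range_subset_range.2 h))

lemma cnt_add (L m k : ℕ) : cnt L (m + k) ≤ cnt L m + k := by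
  induction k with
  | zero => simp
  | succ k ih => rw [← add_assoc, cnt_succ]; split_ifs <;> omega

lemma cnt_noact {L m k : ℕ} (h : ∀ j, m ≤ j → j < m + k → ¬ act L j) : cnt L (m + k) = cnt L m := by
  induction k with
  | zero => simp
  | succ k ih =>
    rw [← add_assoc, cnt_succ, ih (fun j h1 h2 => h j h1 (by omega)), if_neg (h _ (by omega) (by omega))]
    simp

lemma cnt_noact' {L m m' : ℕ} (hm : m ≤ m') (h : ∀ j, m ≤ j → j < m' → ¬ act L j) : cnt L m' = cnt L m := by
  obtain ⟨k, rfl⟩ := Nat.exists_eq_add_of_le hm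
  exact cnt_noact h

lemma noact_near {L n j : ℕ} (hL : 40 ≤ L) (h1 : 2 * L * n ≤ j + 4) (h2 : j < 2 * L * n + 4) : ¬ act L j := by
  rintro ⟨-, -, h3, h4⟩
  by_cases h : 2 * L * n ≤ j
  · obtain ⟨k, rfl⟩ := Nat.exists_eq_add_of_le h
    rw [Nat.mul_add_mod, Nat.mod_eq_of_lt (by omega)] at h3
    omega
  · have hn : n ≠ 0 := by rintro rfl; simp at h
    obtain ⟨n', rfl⟩ := Nat.exists_eq_succ_of_ne_zero hn
    rw [Nat.succ_eq_add_one, mul_add, mul_one] at h1 h2 h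
    obtain ⟨k, rfl⟩ := Nat.exists_eq_add_of_le (show 2 * L * n' ≤ j by omega)
    rw [Nat.mul_add_mod, Nat.mod_eq_of_lt (by omega)] at h4
    omega

lemma gg_near {L n m m' : ℕ} (hL : 40 ≤ L) (h1 : 2 * L * n ≤ m + 4) (h2 : m ≤ 2 * L * n + 4)
    (h1' : 2 * L * n ≤ m' + 4) (h2' : m' ≤ 2 * L * n + 4) : gg L m = gg L m' := by
  unfold gg
  congr 2
  rcases le_total m m' with h | h
  · exact (cnt_noact' h fun j j1 j2 => noact_near (n := n) hL (by omega) (by omega)).symm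
  · exact (cnt_noact' h fun j j1 j2 => noact_near (n := n) hL (by omega) (by omega))

lemma cnt_low {L m : ℕ} (h : m ≤ 12 * L) : cnt L m = 0 := by
  have := cnt_noact' (Nat.zero_le m) (L := L) (fun j _ hj ha => by have := ha.1; omega)
  rw [this]; simp [cnt]

lemma gg_low {L m : ℕ} (h : m ≤ 12 * L) : gg L m = 0 := by
  unfold gg; rw [cnt_low h]; simp

lemma cnt_high {L m : ℕ} (h : 2 * L * L ≤ m + 12 * L) (hm : m ≤ 2 * L * L) : cnt L m = NN L :=
  (cnt_noact' hm (L := L) (fun j hj _ ha => by have := ha.2.1; omega)).symm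

lemma NN_ge {L : ℕ} (hL : 40 ≤ L) : (L - 12) * (2 * L - 8) ≤ NN L := by
  unfold NN cnt
  have : ((Finset.range (L - 12)) ×ˢ (Finset.range (2 * L - 8))).card = (L - 12) * (2 * L - 8) := by
    rw [Finset.card_product, Finset.card_range, Finset.card_range]
  rw [← this]
  refine Finset.card_le_card_of_injOn (fun p => 2 * L * (p.1 + 6) + (p.2 + 4)) ?_ ?_
  · rintro ⟨n, r⟩ h
    simp only [Finset.coe_product, Finset.coe_range, Set.mem_prod, Set.mem_Iio] at h
    have e1 : 2 * L * (n + 6 + 7) ≤ 2 * L * L := Nat.mul_le_mul_left _ (by omega)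
    have e2 : 2 * L * (n + 6 + 7) = 2 * L * (n + 6) + 14 * L := by ring
    have e3 : 2 * L * 6 ≤ 2 * L * (n + 6) := Nat.mul_le_mul_left _ (by omega)
    simp only [Finset.coe_filter, Finset.mem_range, Set.mem_setOf_eq, act]
    rw [Nat.mul_add_mod, Nat.mod_eq_of_lt (by omega)]
    refine ⟨by omega, by omega, by omega, by omega, by omega⟩
  · rintro ⟨n, r⟩ h ⟨n', r'⟩ h' he
    simp only [Finset.coe_product, Finset.coe_range, Set.mem_prod, Set.mem_Iio] at h h'
    simp only at he
    have m1 : (2 * L * (n + 6) + (r + 4)) % (2 * L) = r + 4 := by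
      rw [Nat.mul_add_mod, Nat.mod_eq_of_lt (by omega)]
    have m2 : (2 * L * (n' + 6) + (r' + 4)) % (2 * L) = r' + 4 := by
      rw [Nat.mul_add_mod, Nat.mod_eq_of_lt (by omega)]
    rw [he, m2] at m1
    have hr : r = r' := by omega
    subst hr
    have : 2 * L * (n + 6) = 2 * L * (n' + 6) := by omega
    have := Nat.eq_of_mul_eq_mul_left (by omega) this
    simp; omega

lemma NN_pos {L : ℕ} (hL : 40 ≤ L) : 0 < NN L :=
  lt_of_lt_of_le (Nat.mul_pos (by omega) (by omega)) (NN_ge hL)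

lemma gg_high {L m : ℕ} (hL : 40 ≤ L) (h : 2 * L * L ≤ m + 12 * L) (hm : m ≤ 2 * L * L) : gg L m = 1 := by
  unfold gg; rw [cnt_high h hm]
  exact div_self (by exact_mod_cast (NN_pos hL).ne')

lemma gg_nonneg (L m : ℕ) : 0 ≤ gg L m := by unfold gg; positivity

lemma gg_le_one {L m : ℕ} (hm : m ≤ 2 * L * L) : gg L m ≤ 1 := by
  unfold gg
  exact div_le_one_of_le₀ (by exact_mod_cast cnt_mono hm) (by positivity)

lemma gg_lip {L m m' k : ℕ} (h1 : m ≤ m' + k) (h2 : m' ≤ m + k) : |gg L m - gg L m'| ≤ k / (NN L : ℝ) := by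
  unfold gg
  rw [← sub_div, abs_div, Nat.abs_cast]
  refine div_le_div_of_nonneg_right ?_ (by positivity)
  have a1 : (cnt L m : ℝ) ≤ cnt L m' + k := by exact_mod_cast (cnt_mono h1).trans (cnt_add L m' k)
  have a2 : (cnt L m' : ℝ) ≤ cnt L m + k := by exact_mod_cast (cnt_mono h2).trans (cnt_add L m k)
  rw [abs_le]; constructor <;> linarith

lemma bulk_of_gg {L m m' : ℕ} (hL : 40 ≤ L) (h1 : m ≤ m' + 1) (h2 : m' ≤ m + 1) (hne : gg L m ≠ gg L m') :
    bulk L m ∧ m ≠ m' := by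
  have hmm : m ≠ m' := fun h => hne (by rw [h])
  refine ⟨?_, hmm⟩
  by_cases h : m' = m + 1
  · subst h
    have ha : act L m := by
      by_contra ha
      apply hne; unfold gg; rw [cnt_succ, if_neg ha, add_zero]
    obtain ⟨a1, a2, a3, a4⟩ := ha
    exact ⟨by omega, by omega, by omega, by omega⟩
  · have h : m = m' + 1 := by omega
    subst h
    have ha : act L m' := by
      by_contra ha
      apply hne; unfold gg; rw [cnt_succ, if_neg ha, add_zero]
    obtain ⟨a1, a2, a3, a4⟩ := ha
    have : (m' + 1) % (2 * L) = m' % (2 * L) + 1 := by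
      rw [Nat.add_mod, Nat.mod_eq_of_lt (a := 1) (by omega), Nat.mod_eq_of_lt (by omega)]
    exact ⟨by omega, by omega, by omega, by omega⟩

def isMid (A : Finset (Fin q)) (σ : Conf L q) : Prop :=
  (∃ ζ, low A ζ ∧ oneFlip σ ζ ∧ V A ζ = V A σ + 1) ∧ (∃ ζ, low A ζ ∧ oneFlip σ ζ ∧ V A σ = V A ζ + 1)

noncomputable def Vs (A : Finset (Fin q)) (σ : Conf L q) : ℕ :=
  if h : Ham L q σ = 2 * L + 2 ∧ ¬ isMid A σ ∧ ∃ ζ, low A ζ ∧ oneFlip σ ζ then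
    V A (Classical.choose h.2.2) else V A σ

noncomputable def ff (A : Finset (Fin q)) (σ : Conf L q) : ℝ :=
  if CF A σ then gg L (Vs A σ) else if ABr A σ then 1 else 0

def Active (A : Finset (Fin q)) (σ ζ : Conf L q) : Prop :=
  Ham L q σ = 2 * L + 2 ∧ low A ζ ∧ oneFlip σ ζ ∧ bulk L (V A ζ) ∧
   ∃ ζ', low A ζ' ∧ oneFlip σ ζ' ∧ (V A ζ' = V A ζ + 2 ∨ V A ζ = V A ζ' + 2)

lemma Vs_near (A : Finset (Fin q)) (σ : Conf L q) :
    Vs A σ ≤ V A σ + 1 ∧ V A σ ≤ Vs A σ + 1 ∧ Vs A σ ≤ 2 * L * L := by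
  unfold Vs
  split_ifs with h
  · have := Classical.choose_spec h.2.2
    have h2 := V_oneFlip (A := A) this.2
    exact ⟨h2.2, h2.1, V_le _ _⟩
  · exact ⟨by omega, by omega, V_le _ _⟩

lemma Vs_of_ne {A : Finset (Fin q)} {σ : Conf L q} (h : Ham L q σ ≠ 2 * L + 2) : Vs A σ = V A σ := by
  unfold Vs
  rw [dif_neg (fun h' => h h'.1)]

lemma ff_nonneg (A : Finset (Fin q)) (σ : Conf L q) : 0 ≤ ff A σ := by
  unfold ff; split_ifs
  · exact gg_nonneg _ _
  · norm_num
  · norm_num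

lemma ff_le_one (A : Finset (Fin q)) (σ : Conf L q) : ff A σ ≤ 1 := by
  unfold ff; split_ifs
  · exact gg_le_one (Vs_near A σ).2.2
  · norm_num
  · norm_num

lemma ground_not_CF (A : Finset (Fin q)) (a : Fin q) : ¬ CF A (groundConf L q a) := by
  rintro ⟨d, hd⟩
  obtain ⟨d', hd'⟩ : ∃ d' : Fin 3, d' ≠ d := by
    by_cases h : d = 0
    · exact ⟨1, by rw [h]; decide⟩
    · exact ⟨0, Ne.symm h⟩
  obtain ⟨⟨v, -, hv⟩, ⟨w, -, hw⟩⟩ := hd d' hd' ((0, 0), false)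
  exact hw hv

lemma ff_ground_A {A : Finset (Fin q)} {a : Fin q} (ha : a ∈ A) : ff A (groundConf L q a) = 1 := by
  unfold ff
  rw [if_neg (ground_not_CF A a), if_pos]
  exact ⟨0, ((0, 0), false), fun v _ => ha⟩

lemma ff_ground_B {A : Finset (Fin q)} {a : Fin q} (ha : a ∉ A) : ff A (groundConf L q a) = 0 := by
  unfold ff
  rw [if_neg (ground_not_CF A a), if_neg]
  rintro ⟨d, v0, h⟩
  exact ha (h v0 rfl)

/-- C4 -/
lemma ff_level [Fact (1 < L)] (hL : 40 ≤ L) {A : Finset (Fin q)} {σ σ' : Conf L q} (hf : oneFlip σ σ')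
    (h1 : CF A σ) (hH : Ham L q σ = 2 * L + 2) (hH' : Ham L q σ' = 2 * L + 2) :
    gg L (Vs A σ) = gg L (Vs A σ') := by
  obtain ⟨a1, a2, a3⟩ := Vs_near A σ
  obtain ⟨b1, b2, b3⟩ := Vs_near A σ'
  have hv := V_oneFlip (A := A) hf
  by_cases c1 : V A σ ≤ 11 * L
  · rw [gg_low (by omega), gg_low (by omega)]
  by_cases c2 : 2 * L * L ≤ V A σ + 11 * L
  · rw [gg_high hL (by omega) a3, gg_high hL (by omega) b3]
  obtain ⟨d, hd⟩ := (CF_iff A σ).1 h1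
  obtain ⟨n, n1, n2⟩ := C4aux hL (oneFlip_th d hf) hd (by rwa [ham_th]) (by rwa [ham_th])
    (by rw [V_th]; omega) (by rw [V_th]; omega)
  rw [V_th] at n1 n2
  exact gg_near (n := n) hL (by omega) (by omega) (by omega) (by omega)

/-- level-low edges -/
lemma ff_level_low [Fact (1 < L)] (hL : 40 ≤ L) {A : Finset (Fin q)} {σ ζ : Conf L q} (hf : oneFlip σ ζ)
    (hH : Ham L q σ = 2 * L + 2) (hlow : low A ζ) (hne : gg L (Vs A σ) ≠ gg L (V A ζ)) :
    |gg L (Vs A σ) - gg L (V A ζ)| ≤ 1 / (NN L : ℝ) ∧ Active A σ ζ := by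
  have hv := V_oneFlip (A := A) hf
  by_cases hm : isMid A σ
  · have hVs : Vs A σ = V A σ := by
      unfold Vs; rw [dif_neg]; rintro ⟨-, h, -⟩; exact h hm
    rw [hVs] at hne ⊢
    refine ⟨by have := gg_lip (L := L) (k := 1) hv.1 hv.2; simpa using this, ?_⟩
    obtain ⟨hb, hneq⟩ := bulk_of_gg hL hv.2 hv.1 (Ne.symm hne)
    refine ⟨hH, hlow, hf, hb, ?_⟩
    obtain ⟨⟨ζ1, l1, f1, e1⟩, ⟨ζ2, l2, f2, e2⟩⟩ := hm
    by_cases h : V A ζ = V A σ + 1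
    · exact ⟨ζ2, l2, f2, Or.inr (by omega)⟩
    · exact ⟨ζ1, l1, f1, Or.inl (by omega)⟩
  · exfalso
    have hex : Ham L q σ = 2 * L + 2 ∧ ¬ isMid A σ ∧ ∃ ζ, low A ζ ∧ oneFlip σ ζ := ⟨hH, hm, ζ, hlow, hf⟩
    have hVs : Vs A σ = V A (Classical.choose hex.2.2) := by unfold Vs; rw [dif_pos hex]
    obtain ⟨l0, f0⟩ := Classical.choose_spec hex.2.2
    rw [hVs] at hne
    set ζ0 := Classical.choose hex.2.2
    have hv0 := V_oneFlip (A := A) f0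
    have hneq : V A ζ0 ≠ V A ζ := fun h => hne (by rw [h])
    have hdiff : V A ζ0 ≤ V A ζ + 1 ∧ V A ζ ≤ V A ζ0 + 1 := by
      by_contra hc
      apply hm
      by_cases h : V A ζ0 = V A σ + 1
      · exact ⟨⟨ζ0, l0, f0, h⟩, ⟨ζ, hlow, hf, by omega⟩⟩
      · exact ⟨⟨ζ, hlow, hf, by omega⟩, ⟨ζ0, l0, f0, by omega⟩⟩
    have key : ∀ ζ1 ζ2 : Conf L q, low A ζ1 → V A ζ1 % 2 = 0 → V A ζ1 ≤ V A ζ2 + 1 → V A ζ2 ≤ V A ζ1 + 1 →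
        gg L (V A ζ1) = gg L (V A ζ2) := by
      intro ζ1 ζ2 hl he g1 g2
      rcases low_V (by omega) hl with h | h | h | h
      · obtain ⟨n, hn⟩ := h
        exact gg_near (n := n) hL (by omega) (by omega) (by omega) (by omega)
      · rw [gg_low (by omega), gg_low (by omega)]
      · rw [gg_high hL (by omega) (V_le _ _), gg_high hL (by omega) (V_le _ _)]
      · omega
    by_cases he : V A ζ0 % 2 = 0
    · exact hne (key ζ0 ζ l0 he hdiff.1 hdiff.2)
    · exact hne (key ζ ζ0 hlow (by omega) hdiff.2 hdiff.1).symm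

lemma ff_low_low [Fact (1 < L)] (hL : 40 ≤ L) {A : Finset (Fin q)} {σ ζ : Conf L q} (hf : oneFlip σ ζ)
    (h1 : low A σ) (h2 : low A ζ) : gg L (V A σ) = gg L (V A ζ) := by
  have hv := V_oneFlip (A := A) hf
  by_cases hneq : V A σ = V A ζ
  · rw [hneq]
  have key : ∀ ζ1 ζ2 : Conf L q, low A ζ1 → V A ζ1 % 2 = 0 → V A ζ1 ≤ V A ζ2 + 1 → V A ζ2 ≤ V A ζ1 + 1 →
      gg L (V A ζ1) = gg L (V A ζ2) := by
    intro ζ1 ζ2 hl he g1 g2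
    rcases low_V (by omega) hl with h | h | h | h
    · obtain ⟨n, hn⟩ := h
      exact gg_near (n := n) hL (by omega) (by omega) (by omega) (by omega)
    · rw [gg_low (by omega), gg_low (by omega)]
    · rw [gg_high hL (by omega) (V_le _ _), gg_high hL (by omega) (V_le _ _)]
    · omega
  by_cases he : V A σ % 2 = 0
  · exact key σ ζ h1 he hv.1 hv.2
  · exact (key ζ σ h2 (by omega) hv.2 hv.1).symm

lemma ff_mixed [Fact (1 < L)] (hL : 40 ≤ L) {A : Finset (Fin q)} {σ ζ : Conf L q} (hf : oneFlip σ ζ)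
    (h1 : ¬ CF A σ) (h2 : CF A ζ) (hH : Ham L q ζ ≤ 2 * L + 4) : ff A σ = ff A ζ := by
  unfold ff
  rw [if_neg h1, if_pos h2]
  obtain ⟨a1, a2, a3⟩ := Vs_near A ζ
  rcases X2 hf h1 h2 hH with ⟨h, hv⟩ | ⟨h, hv⟩
  · rw [if_pos h, gg_high hL (by omega) a3]
  · rw [if_neg h, gg_low (by omega)]

lemma ff_edge [Fact (1 < L)] (hL : 40 ≤ L) {A : Finset (Fin q)} {σ ζ : Conf L q} (hf : oneFlip σ ζ) :
    ff A σ = ff A ζ ∨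
    (|ff A σ - ff A ζ| ≤ 1 / (NN L : ℝ) ∧ (Active A σ ζ ∨ Active A ζ σ)) ∨
    (|ff A σ - ff A ζ| ≤ 3 / (NN L : ℝ) ∧ ((CF A σ ∧ 2 * L + 3 ≤ Ham L q σ) ∨ (CF A ζ ∧ 2 * L + 3 ≤ Ham L q ζ))) ∨
    (|ff A σ - ff A ζ| ≤ 1 ∧ ((CF A σ ∧ 2 * L + 5 ≤ Ham L q σ) ∨ (CF A ζ ∧ 2 * L + 5 ≤ Ham L q ζ))) := by
  have hfs := oneFlip_symm hf
  have habs : |ff A σ - ff A ζ| ≤ 1 := by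
    have := ff_nonneg A σ; have := ff_le_one A σ; have := ff_nonneg A ζ; have := ff_le_one A ζ
    rw [abs_le]; constructor <;> linarith
  by_cases c1 : CF A σ <;> by_cases c2 : CF A ζ
  · by_cases m1 : 2 * L + 3 ≤ Ham L q σ ∨ 2 * L + 3 ≤ Ham L q ζ
    · right; right; left
      refine ⟨?_, by tauto⟩
      unfold ff; rw [if_pos c1, if_pos c2]
      obtain ⟨a1, a2, a3⟩ := Vs_near A σ
      obtain ⟨b1, b2, b3⟩ := Vs_near A ζ
      have hv := V_oneFlip (A := A) hf
      exact_mod_cast gg_lip (L := L) (k := 3) (by omega) (by omega)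
    · push Not at m1
      unfold ff; rw [if_pos c1, if_pos c2]
      by_cases e1 : Ham L q σ = 2 * L + 2 <;> by_cases e2 : Ham L q ζ = 2 * L + 2
      · left; exact ff_level hL hf c1 e1 e2
      · rw [Vs_of_ne e2]
        by_cases hne : gg L (Vs A σ) = gg L (V A ζ)
        · exact Or.inl hne
        · right; left
          have := ff_level_low hL hf e1 ⟨c2, by omega⟩ hne
          exact ⟨this.1, Or.inl this.2⟩
      · rw [Vs_of_ne e1]
        by_cases hne : gg L (Vs A ζ) = gg L (V A σ)
        · exact Or.inl hne.symm
        · right; left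
          have := ff_level_low hL hfs e2 ⟨c1, by omega⟩ hne
          rw [abs_sub_comm]
          exact ⟨this.1, Or.inr this.2⟩
      · left; rw [Vs_of_ne e1, Vs_of_ne e2]
        exact ff_low_low hL hf ⟨c1, by omega⟩ ⟨c2, by omega⟩
  · by_cases m : 2 * L + 5 ≤ Ham L q σ
    · right; right; right; exact ⟨habs, Or.inl ⟨c1, m⟩⟩
    · left; exact (ff_mixed hL hfs c2 c1 (by omega)).symm
  · by_cases m : 2 * L + 5 ≤ Ham L q ζ
    · right; right; right; exact ⟨habs, Or.inr ⟨c2, m⟩⟩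
    · left; exact (ff_mixed hL hf c1 c2 (by omega))
  · left
    unfold ff; rw [if_neg c1, if_neg c2]
    have : ABr A σ ↔ ABr A ζ := ⟨X1 hf c2, X1 hfs c1⟩
    simp only [this]

end P7

section P8
variable {L q : ℕ} [NeZero L]

lemma bulk_class [Fact (1 < L)] (hL : 40 ≤ L) {A : Finset (Fin q)} {ζ : Conf L q} (h : low A ζ)
    (hb : bulk L (V A ζ)) :
    ∃ d a b y0 n x0 p, ((a ∈ A ∧ b ∉ A) ∨ (a ∉ A ∧ b ∈ A)) ∧ 6 ≤ n ∧ n + 7 ≤ L ∧ 1 ≤ p ∧ p ≤ L ∧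
      ζ ∘ th d = lowConf a b y0 n x0 p := by
  obtain ⟨d, hd⟩ := (CF_iff A ζ).1 h.1
  obtain ⟨b1, b2, b3, b4⟩ := hb
  rcases low_class (by omega) hd (by rw [ham_th]; exact h.2) with h1 | h1 | h1 | h1
  · rw [V_th] at h1
    have := Nat.mod_eq_zero_of_dvd h1
    omega
  · rw [V_th] at h1; omega
  · rw [V_th] at h1; omega
  · obtain ⟨a, b, y0, n, x0, p, hab, hn, hnL, hp, hpL, he⟩ := h1
    have hV := lowConf_V_cases hab y0 n x0 p hp hpL (by omega)
    rw [← he, V_th] at hV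
    refine ⟨d, a, b, y0, n, x0, p, hab, ?_, ?_, hp, hpL, he⟩
    · by_contra hc
      rcases hV with ⟨-, -, hV⟩ | ⟨-, -, hV⟩
      · have : 2 * L * n ≤ 2 * L * 5 := Nat.mul_le_mul_left _ (by omega)
        omega
      · have : 2 * L * (L - 6) ≤ 2 * L * (L - 1 - n) := Nat.mul_le_mul_left _ (by omega)
        have e : 2 * L * L = 2 * L * (L - 6) + 12 * L := by
          obtain ⟨k, rfl⟩ := Nat.exists_eq_add_of_le (show 6 ≤ L by omega)
          rw [Nat.add_sub_cancel_left]; ring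
        omega
    · by_contra hc
      rcases hV with ⟨-, -, hV⟩ | ⟨-, -, hV⟩
      · have : 2 * L * (L - 6) ≤ 2 * L * n := Nat.mul_le_mul_left _ (by omega)
        have e : 2 * L * L = 2 * L * (L - 6) + 12 * L := by
          obtain ⟨k, rfl⟩ := Nat.exists_eq_add_of_le (show 6 ≤ L by omega)
          rw [Nat.add_sub_cancel_left]; ring
        omega
      · have : 2 * L * (L - 1 - n) ≤ 2 * L * 5 := Nat.mul_le_mul_left _ (by omega)
        omega

lemma active_le_eight [Fact (1 < L)] (hL : 40 ≤ L) (A : Finset (Fin q)) (ζ : Conf L q) :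
    (Finset.univ.filter fun σ : Conf L q => Active A σ ζ).card ≤ 8 := by
  by_cases hζ : low A ζ ∧ bulk L (V A ζ)
  swap
  · rw [Finset.filter_false_of_mem]
    · simp
    · rintro σ - ⟨-, h1, -, h2, -⟩; exact hζ ⟨h1, h2⟩
  obtain ⟨d, a, b, y0, n, x0, p, hab, hn, hnL, hp, hpL, he⟩ := bulk_class hL hζ.1 hζ.2
  set O : Finset (Conf L q) := {lowConf a b y0 n x0 (p - 1) ∘ th d, lowConf a b y0 n (x0 + 1) (p - 1) ∘ th d,
    lowConf a b y0 n x0 (p + 1) ∘ th d, lowConf a b y0 n (x0 - 1) (p + 1) ∘ th d} with hO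
  have hsub : (Finset.univ.filter fun σ : Conf L q => Active A σ ζ) ⊆
      (O.filter fun ζ' => V A ζ' = V A ζ + 2 ∨ V A ζ = V A ζ' + 2).biUnion
        (fun ζ' => Finset.univ.filter fun σ : Conf L q => oneFlip σ ζ ∧ oneFlip σ ζ') := by
    intro σ hσ
    obtain ⟨-, -, f1, hbk, ζ', l', f2, hV⟩ := (Finset.mem_filter.1 hσ).2
    refine Finset.mem_biUnion.2 ⟨ζ', Finset.mem_filter.2 ⟨?_, hV⟩, Finset.mem_filter.2 ⟨Finset.mem_univ _, f1, f2⟩⟩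
    have := pinning (σ := σ ∘ th d) (ζ' := ζ' ∘ th d) (y0 := y0) (x0 := x0) hL hab hn hnL hp hpL
      (by rw [← he, V_th]; exact hbk) (by rw [← he]; exact oneFlip_th d f1) (oneFlip_th d f2)
      ((low_th A d ζ').2 l') (by rw [← he, V_th, V_th]; exact hV)
    rw [hO]
    simp only [Finset.mem_insert, Finset.mem_singleton]
    have e : ζ' = (ζ' ∘ th d) ∘ th d := (comp_th_th d ζ').symm
    rcases this with h | h | h | h
    · exact Or.inl (e.trans (congrArg (fun f => f ∘ th d) h))
    · exact Or.inr (Or.inl (e.trans (congrArg (fun f => f ∘ th d) h)))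
    · exact Or.inr (Or.inr (Or.inl (e.trans (congrArg (fun f => f ∘ th d) h))))
    · exact Or.inr (Or.inr (Or.inr (e.trans (congrArg (fun f => f ∘ th d) h))))
  refine le_trans (Finset.card_le_card hsub) (le_trans (Finset.card_biUnion_le_card_mul _ _ 2 ?_) ?_)
  · intro ζ' h'
    exact common_le_two A ζ ζ' (Finset.mem_filter.1 h').2
  · have : O.card ≤ 4 := Finset.card_le_four
    have := Finset.card_filter_le O (fun ζ' => V A ζ' = V A ζ + 2 ∨ V A ζ = V A ζ' + 2)
    omega

lemma bulk_count [Fact (1 < L)] (hL : 40 ≤ L) (A : Finset (Fin q)) :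
    (Finset.univ.filter fun ζ : Conf L q => low A ζ ∧ bulk L (V A ζ)).card ≤
      3 * (2 * (A.card * Aᶜ.card)) * (L * ((L - 12) * (L * L))) := by
  set P : Finset (Fin 3 × (Fin q × Fin q) × (ZMod L × (ℕ × (ZMod L × ℕ)))) :=
    Finset.univ ×ˢ ((A ×ˢ Aᶜ ∪ Aᶜ ×ˢ A) ×ˢ (Finset.univ ×ˢ (Finset.Icc 6 (L - 7) ×ˢ (Finset.univ ×ˢ Finset.Icc 1 L))))
    with hP
  have hsub : (Finset.univ.filter fun ζ : Conf L q => low A ζ ∧ bulk L (V A ζ)) ⊆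
      P.image (fun t => lowConf t.2.1.1 t.2.1.2 t.2.2.1 t.2.2.2.1 t.2.2.2.2.1 t.2.2.2.2.2 ∘ th t.1) := by
    intro ζ hζ
    obtain ⟨h1, h2⟩ := (Finset.mem_filter.1 hζ).2
    obtain ⟨d, a, b, y0, n, x0, p, hab, hn, hnL, hp, hpL, he⟩ := bulk_class hL h1 h2
    refine Finset.mem_image.2 ⟨(d, (a, b), y0, n, x0, p), ?_, ?_⟩
    · rw [hP]
      simp only [Finset.mem_product, Finset.mem_univ, Finset.mem_union, Finset.mem_compl, Finset.mem_Icc, true_and]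
      exact ⟨hab, ⟨by omega, by omega⟩, by omega, by omega⟩
    · simp only; rw [← he, comp_th_th]
  refine le_trans (Finset.card_le_card hsub) (le_trans Finset.card_image_le ?_)
  rw [hP]
  simp only [Finset.card_product, Finset.card_univ, ZMod.card, Fintype.card_fin, Nat.card_Icc]
  have e1 : L - 7 + 1 - 6 = L - 12 := by omega
  have e2 : L + 1 - 1 = L := by omega
  rw [e1, e2]
  have h3 : (A ×ˢ Aᶜ ∪ Aᶜ ×ˢ A).card ≤ 2 * (A.card * Aᶜ.card) := by
    refine le_trans (Finset.card_union_le _ _) ?_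
    rw [Finset.card_product, Finset.card_product, mul_comm Aᶜ.card]; omega
  rw [mul_assoc 3]
  gcongr

lemma active_count [Fact (1 < L)] (hL : 40 ≤ L) (A : Finset (Fin q)) :
    (∑ σ : Conf L q, ∑ ζ : Conf L q, if Active A σ ζ then (1 : ℝ) else 0) ≤
      48 * (A.card * Aᶜ.card) * (L * (((L - 12 : ℕ) : ℝ) * (L * L))) := by
  rw [Finset.sum_comm]
  have h1 : ∀ ζ : Conf L q, (∑ σ : Conf L q, if Active A σ ζ then (1 : ℝ) else 0) ≤
      if low A ζ ∧ bulk L (V A ζ) then 8 else 0 := by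
    intro ζ
    rw [← Finset.sum_filter, Finset.sum_const, nsmul_eq_mul, mul_one]
    split_ifs with h
    · exact_mod_cast active_le_eight hL A ζ
    · rw [Finset.filter_false_of_mem]
      · simp
      · rintro σ - ⟨-, h1, -, h2, -⟩; exact h ⟨h1, h2⟩
  refine le_trans (Finset.sum_le_sum fun ζ _ => h1 ζ) ?_
  rw [← Finset.sum_filter, Finset.sum_const, nsmul_eq_mul]
  have h2 := bulk_count hL A
  have h3 : ((Finset.univ.filter fun ζ : Conf L q => low A ζ ∧ bulk L (V A ζ)).card : ℝ) ≤
      3 * (2 * (A.card * Aᶜ.card)) * (L * (((L - 12 : ℕ) : ℝ) * (L * L))) := by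
    exact_mod_cast h2
  linarith

end P8

section P9
variable {L q : ℕ} [NeZero L]

lemma label_sum {S E : Type*} [Fintype S] [Fintype E] [DecidableEq S] (s t : E → S) (base : S)
    (hconn : ∀ P : S → Prop, (∀ e, P (s e) ↔ P (t e)) → P base → ∀ v, P v) (c : Fin q) (w : ℝ) (hw : 0 ≤ w) :
    ∑ σ : S → Fin q, (if σ base = c then ∏ e, w ^ (mm (σ (s e)) (σ (t e))) else 0) ≤
      (1 + (q : ℝ) ^ 2 * w) ^ (Fintype.card E) := by
  set wt : Option (Fin q × Fin q) → ℝ := fun o => match o with | none => 1 | some _ => w with hwt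
  have hwt0 : ∀ o, 0 ≤ wt o := by intro o; cases o <;> simp [hwt, hw]
  set lab : (S → Fin q) → E → Option (Fin q × Fin q) := fun σ e =>
    if σ (s e) = σ (t e) then none else some (σ (s e), σ (t e)) with hlab
  have hprod : ∀ σ : S → Fin q, ∏ e, w ^ (mm (σ (s e)) (σ (t e))) = ∏ e, wt (lab σ e) := by
    intro σ
    refine Finset.prod_congr rfl fun e _ => ?_
    simp only [hwt, hlab, mm]
    by_cases h : σ (s e) = σ (t e)
    · simp [h]
    · simp [h]
  have hR : (1 + (q : ℝ) ^ 2 * w) ^ (Fintype.card E) = ∑ l : E → Option (Fin q × Fin q), ∏ e, wt (l e) := by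
    have : (1 + (q : ℝ) ^ 2 * w) = ∑ o : Option (Fin q × Fin q), wt o := by
      rw [Fintype.sum_option]
      simp only [hwt, Finset.sum_const, Finset.card_univ, Fintype.card_prod, Fintype.card_fin, nsmul_eq_mul]
      push_cast; ring
    rw [this, ← Finset.card_univ, ← Finset.prod_const, Finset.prod_univ_sum]
    simp
  rw [hR, ← Finset.sum_filter, Finset.sum_congr rfl (fun σ _ => hprod σ)]
  have hinj : Set.InjOn lab (Finset.univ.filter fun σ : S → Fin q => σ base = c : Finset (S → Fin q)) := by
    intro σ hσ σ' hσ' he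
    simp only [Finset.coe_filter, Finset.mem_univ, true_and, Set.mem_ofPred_eq] at hσ hσ'
    funext v
    refine hconn (fun v => σ v = σ' v) ?_ (hσ.trans hσ'.symm) v
    intro e
    have := congrFun he e
    simp only [hlab] at this
    by_cases h1 : σ (s e) = σ (t e) <;> by_cases h2 : σ' (s e) = σ' (t e)
    · rw [h1, h2]
    · simp [h1, h2] at this
    · simp [h1, h2] at this
    · simp only [h1, h2, if_false, Option.some.injEq, Prod.mk.injEq] at this
      simp [this.1, this.2]
  rw [← Finset.sum_image (f := fun l => ∏ e, wt (l e)) hinj]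
  exact Finset.sum_le_sum_of_subset_of_nonneg (Finset.subset_univ _) fun l _ _ => Finset.prod_nonneg fun e _ => hwt0 _

lemma cyc_sum (x0 : ZMod L) (c : Fin q) (w : ℝ) (hw : 0 ≤ w) :
    ∑ k : ZMod L → Fin q × Fin q, (if (k x0).1 = c then w ^ cycE k else 0) ≤ (1 + (q : ℝ) ^ 2 * w) ^ (2 * L) := by
  have h := label_sum (S := ZMod L × Bool) (E := ZMod L × Bool) (fun e => (e.1, false))
    (fun e => if e.2 then (e.1 - 1, true) else (e.1, true)) (x0, false) (by
      intro P hP h0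
      have h1 : ∀ x, P (x, false) ↔ P (x, true) := fun x => by simpa using hP (x, false)
      have h2 : ∀ x, P (x, false) ↔ P (x - 1, true) := fun x => by simpa using hP (x, true)
      have h3 : ∀ x, P (x, false) := by
        intro x
        have := zmod_const (fun x => P (x, false)) (fun x => by simp only [h2 x, h1 (x - 1)]) x x0
        rwa [this]
      rintro ⟨x, b⟩
      cases b
      · exact h3 x
      · exact (h1 x).1 (h3 x)) c w hw
  rw [Fintype.card_prod, ZMod.card, Fintype.card_bool, mul_comm L 2] at h
  refine le_trans (le_of_eq ?_) h
  set ev : (ZMod L → Fin q × Fin q) ≃ (ZMod L × Bool → Fin q) :=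
    { toFun := fun k v => if v.2 then (k v.1).2 else (k v.1).1
      invFun := fun σ x => (σ (x, false), σ (x, true))
      left_inv := fun k => by funext x; simp
      right_inv := fun σ => by funext ⟨x, b⟩; cases b <;> simp } with hev
  refine Fintype.sum_equiv ev _ _ fun k => ?_
  have e1 : ∀ x, ev k (x, false) = (k x).1 := fun x => by simp [hev]
  have e2 : ∀ x, ev k (x, true) = (k x).2 := fun x => by simp [hev]
  rw [e1]
  congr 1
  rw [Finset.prod_pow_eq_pow_sum, Fintype.sum_prod_type]
  congr 1
  unfold cycE
  refine Finset.sum_congr rfl fun x _ => ?_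
  rw [Fintype.sum_bool]
  simp only [if_true, Bool.false_eq_true, if_false, e1, e2]
  ring

lemma lat_sum [Fact (1 < L)] (c : Fin q) (w : ℝ) (hw : 0 ≤ w) :
    ∑ σ : Conf L q, (if σ ((0, 0), false) = c then w ^ Ham L q σ else 0) ≤ (1 + (q : ℝ) ^ 2 * w) ^ (3 * L ^ 2) := by
  have h := label_sum (S := Site L) (E := (ZMod L × ZMod L) × Fin 3) (fun e => (e.1, false))
    (fun e => nb e.2 (e.1, false)) ((0, 0), false) (by
      intro P hP h0
      have h1 : ∀ p, P (p, false) ↔ P (p, true) := fun p => by simpa [nb] using hP (p, 0)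
      have h2 : ∀ x y, P ((x, y), false) ↔ P ((x - 1, y), true) := fun x y => by simpa [nb] using hP ((x, y), 1)
      have h3 : ∀ x y, P ((x, y), false) ↔ P ((x, y - 1), true) := fun x y => by simpa [nb] using hP ((x, y), 2)
      have h4 : ∀ x, P ((x, 0), false) := by
        intro x
        have := zmod_const (fun x => P ((x, 0), false)) (fun x => by simp only [h2 x, h1]) x 0
        rwa [this]
      have h5 : ∀ x y, P ((x, y), false) := by
        intro x y
        have := zmod_const (fun y => P ((x, y), false)) (fun y => by simp only [h3 x y, h1]) y 0
        rw [this]; exact h4 x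
      rintro ⟨⟨x, y⟩, b⟩
      cases b
      · exact h5 x y
      · exact (h1 _).1 (h5 x y)) c w hw
  have hc : Fintype.card ((ZMod L × ZMod L) × Fin 3) = 3 * L ^ 2 := by
    rw [Fintype.card_prod, Fintype.card_prod, ZMod.card, Fintype.card_fin]; ring
  rw [hc] at h
  refine le_trans (le_of_eq ?_) h
  refine Finset.sum_congr rfl fun σ _ => ?_
  congr 1
  rw [Finset.prod_pow_eq_pow_sum, ham_up]
  congr 1
  exact (Fintype.sum_prod_type (fun i : (ZMod L × ZMod L) × Fin 3 => mm (σ (i.1, false)) (σ (nb i.2 (i.1, false))))).symm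

lemma lat_sum_all [Fact (1 < L)] (w : ℝ) (hw : 0 ≤ w) :
    ∑ σ : Conf L q, w ^ Ham L q σ ≤ q * (1 + (q : ℝ) ^ 2 * w) ^ (3 * L ^ 2) := by
  have : ∑ σ : Conf L q, w ^ Ham L q σ =
      ∑ c : Fin q, ∑ σ : Conf L q, (if σ ((0, 0), false) = c then w ^ Ham L q σ else 0) := by
    rw [Finset.sum_comm]
    refine Finset.sum_congr rfl fun σ _ => ?_
    simp
  rw [this]
  refine le_trans (Finset.sum_le_sum fun c _ => lat_sum c w hw) ?_
  simp

lemma cyc_sum_all (w : ℝ) (hw : 0 ≤ w) :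
    ∑ k : ZMod L → Fin q × Fin q, w ^ cycE k ≤ q * (1 + (q : ℝ) ^ 2 * w) ^ (2 * L) := by
  have : ∑ k : ZMod L → Fin q × Fin q, w ^ cycE k =
      ∑ c : Fin q, ∑ k : ZMod L → Fin q × Fin q, (if (k 0).1 = c then w ^ cycE k else 0) := by
    rw [Finset.sum_comm]
    refine Finset.sum_congr rfl fun σ _ => ?_
    simp
  rw [this]
  refine le_trans (Finset.sum_le_sum fun c _ => cyc_sum 0 c w hw) ?_
  simp

lemma cyc_R (x0 : ZMod L) (c : Fin q) (w y : ℝ) (hy : 0 ≤ y) (hyw : y ≤ w) (hw : 0 < w) :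
    ∑ k : ZMod L → Fin q × Fin q, (if (k x0).1 = c then y ^ cycE k else 0) ≤
      1 + (y / w) ^ 2 * (1 + (q : ℝ) ^ 2 * w) ^ (2 * L) := by
  have key : ∀ k : ZMod L → Fin q × Fin q, (if (k x0).1 = c then y ^ cycE k else 0) ≤
      (if k = (fun _ => (c, c)) then 1 else 0) + (y / w) ^ 2 * (if (k x0).1 = c then w ^ cycE k else 0) := by
    intro k
    by_cases h : (k x0).1 = c
    · rw [if_pos h, if_pos h]
      by_cases h0 : cycE k = 0
      · have hk := cyc_zero k h0
        have : k = fun _ => (c, c) := by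
          funext x
          have e : (k 0).1 = c := by rw [← h]; exact (hk x0).1.symm
          rw [← e]
          exact Prod.ext (hk x).1 (hk x).2
        rw [if_pos this, h0]
        simp only [pow_zero, mul_one]
        have : 0 ≤ (y / w) ^ 2 := by positivity
        linarith
      · have h1 := cyc_ne_one k
        have h2 : 2 ≤ cycE k := by omega
        have : y ^ cycE k ≤ (y / w) ^ 2 * w ^ cycE k := by
          obtain ⟨m, hm⟩ := Nat.exists_eq_add_of_le h2
          rw [hm, pow_add, pow_add, div_pow, ← mul_assoc, div_mul_cancel₀ _ (by positivity)]
          gcongr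
        refine le_trans this ?_
        have : (0:ℝ) ≤ if k = (fun _ => (c, c)) then 1 else 0 := by split_ifs <;> norm_num
        linarith
    · rw [if_neg h, if_neg h]
      have : (0:ℝ) ≤ if k = (fun _ => (c, c)) then 1 else 0 := by split_ifs <;> norm_num
      linarith
  refine le_trans (Finset.sum_le_sum fun k _ => key k) ?_
  rw [Finset.sum_add_distrib, ← Finset.mul_sum]
  have := cyc_sum x0 c w hw.le
  have h1 : ∑ k : ZMod L → Fin q × Fin q, (if k = (fun _ => (c, c)) then (1:ℝ) else 0) = 1 := by simp
  rw [h1]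
  gcongr

def confRows : Conf L q ≃ (ZMod L → ZMod L → Fin q × Fin q) where
  toFun σ y x := (σ ((x, y), false), σ ((x, y), true))
  invFun ρ v := if v.2 then (ρ v.1.2 v.1.1).2 else (ρ v.1.2 v.1.1).1
  left_inv σ := by funext ⟨⟨x, y⟩, b⟩; cases b <;> simp
  right_inv ρ := by funext y x; simp

lemma col_sum (x0 : ZMod L) (w y R : ℝ) (hw : 0 < w) (hy : 0 ≤ y) (hR0 : 0 ≤ R)
    (hR : ∀ c : Fin q, ∑ k : ZMod L → Fin q × Fin q, (if (k x0).1 = c then y ^ cycE k else 0) ≤ R) :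
    ∑ σ : Conf L q, w ^ cycE (col σ x0) * y ^ E0 σ ≤ R ^ L * (q * (1 + (q : ℝ) ^ 2 * w) ^ (2 * L)) := by
  have h1 : ∑ σ : Conf L q, w ^ cycE (col σ x0) * y ^ E0 σ =
      ∑ ρ : ZMod L → ZMod L → Fin q × Fin q, w ^ cycE (fun t => ρ t x0) * ∏ t, y ^ cycE (ρ t) := by
    refine Fintype.sum_equiv confRows _ _ fun σ => ?_
    rw [Finset.prod_pow_eq_pow_sum]
    rfl
  have h2 : ∀ ρ : ZMod L → ZMod L → Fin q × Fin q, w ^ cycE (fun t => ρ t x0) * ∏ t, y ^ cycE (ρ t) =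
      ∑ k : ZMod L → Fin q × Fin q, w ^ cycE k * ∏ t, (if ρ t x0 = k t then y ^ cycE (ρ t) else 0) := by
    intro ρ
    rw [Finset.sum_eq_single (fun t => ρ t x0)]
    · simp
    · intro k _ hk
      have : ∃ t, ρ t x0 ≠ k t := by
        by_contra hc
        push Not at hc
        exact hk (funext fun t => (hc t).symm)
      obtain ⟨t, ht⟩ := this
      rw [Finset.prod_eq_zero (Finset.mem_univ t) (if_neg ht), mul_zero]
    · intro h; exact absurd (Finset.mem_univ _) h
  rw [h1, Finset.sum_congr rfl fun ρ _ => h2 ρ, Finset.sum_comm]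
  have h3 : ∀ k : ZMod L → Fin q × Fin q,
      ∑ ρ : ZMod L → ZMod L → Fin q × Fin q, w ^ cycE k * ∏ t, (if ρ t x0 = k t then y ^ cycE (ρ t) else 0) ≤
      w ^ cycE k * R ^ L := by
    intro k
    rw [← Finset.mul_sum]
    have : ∑ ρ : ZMod L → ZMod L → Fin q × Fin q, ∏ t, (if ρ t x0 = k t then y ^ cycE (ρ t) else 0) =
        ∏ t, ∑ r : ZMod L → Fin q × Fin q, (if r x0 = k t then y ^ cycE r else 0) := by
      rw [Finset.prod_univ_sum]; simp
    rw [this]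
    refine mul_le_mul_of_nonneg_left ?_ (by positivity)
    have hc : R ^ L = ∏ t : ZMod L, R := by rw [Finset.prod_const, Finset.card_univ, ZMod.card]
    rw [hc]
    refine Finset.prod_le_prod (fun t _ => Finset.sum_nonneg fun r _ => by split_ifs <;> positivity) fun t _ => ?_
    refine le_trans (Finset.sum_le_sum fun r _ => ?_) (hR (k t).1)
    by_cases h : r x0 = k t
    · rw [if_pos h, if_pos (by rw [h])]
    · rw [if_neg h]; split_ifs <;> positivity
  refine le_trans (Finset.sum_le_sum fun k _ => h3 k) ?_
  rw [← Finset.sum_mul, mul_comm]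
  refine mul_le_mul_of_nonneg_left (cyc_sum_all w hw.le) ?_
  exact pow_nonneg hR0 _

end P9

section P10
variable {L q : ℕ} [NeZero L]

lemma one_add_pow_le {u : ℝ} (hu : 0 ≤ u) (n : ℕ) (h : n * u ≤ 1) : (1 + u) ^ n ≤ 3 := by
  have h1 : (1 + u) ^ n ≤ Real.exp 1 := by
    calc (1 + u) ^ n ≤ (Real.exp u) ^ n := by
          gcongr; rw [add_comm]; exact Real.add_one_le_exp u
      _ = Real.exp (n * u) := by rw [← Real.exp_nat_mul]
      _ ≤ Real.exp 1 := Real.exp_le_exp.2 h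
  have := Real.exp_one_lt_d9
  linarith

lemma M_bound (hL : 40 ≤ L) (hq : 2 ≤ q) (x0 : ZMod L) (y : ℝ) (hy : 0 ≤ y)
    (hy2 : y ^ 2 = 1 / (12 * (q : ℝ) ^ 4 * (L : ℝ) ^ 3)) :
    ∑ σ : Conf L q, (if cycE (col σ x0) ≤ 3 then y ^ E0 σ else 0) ≤ 72 * (q : ℝ) ^ 7 * (L : ℝ) ^ 3 := by
  have hLr : (40 : ℝ) ≤ L := by exact_mod_cast hL
  have hqr : (2 : ℝ) ≤ q := by exact_mod_cast hq
  have hL0 : (0 : ℝ) < L := by linarith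
  have hq0 : (0 : ℝ) < q := by linarith
  set w : ℝ := 1 / (2 * L * (q : ℝ) ^ 2) with hw
  have hw0 : 0 < w := by rw [hw]; positivity
  have hqw : (q : ℝ) ^ 2 * w = 1 / (2 * L) := by rw [hw]; field_simp
  have hyw2 : (y / w) ^ 2 = 1 / (3 * L) := by
    rw [div_pow, hy2, hw]; field_simp; norm_num
  have hyw : y ≤ w := by
    have : y / w ≤ 1 := by
      have h1 : (y / w) ^ 2 ≤ 1 := by
        rw [hyw2, div_le_one (by positivity)]; linarith
      have h0 : 0 ≤ y / w := by positivity
      nlinarith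
    rwa [div_le_one hw0] at this
  have hw1 : w ≤ 1 := by
    rw [hw, div_le_one (by positivity)]
    nlinarith [sq_nonneg ((q:ℝ) - 1)]
  have hpow : (1 + (q : ℝ) ^ 2 * w) ^ (2 * L) ≤ 3 := by
    refine one_add_pow_le (by positivity) _ ?_
    rw [hqw]; push_cast
    rw [mul_one_div, div_self (by positivity)]
  have hR : ∀ c : Fin q, ∑ k : ZMod L → Fin q × Fin q, (if (k x0).1 = c then y ^ cycE k else 0) ≤ 1 + 1 / L := by
    intro c
    refine le_trans (cyc_R x0 c w y hy hyw hw0) ?_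
    rw [hyw2]
    have : 1 / (3 * (L : ℝ)) * (1 + (q : ℝ) ^ 2 * w) ^ (2 * L) ≤ 1 / (3 * (L : ℝ)) * 3 := by gcongr
    have e : 1 / (3 * (L : ℝ)) * 3 = 1 / L := by field_simp
    linarith
  have h := col_sum x0 w y (1 + 1 / L) hw0 hy (by positivity) hR
  have hRL : (1 + 1 / (L : ℝ)) ^ L ≤ 3 := by
    refine one_add_pow_le (by positivity) _ ?_
    rw [mul_one_div, div_self (by positivity)]
  have h2 : ∑ σ : Conf L q, (if cycE (col σ x0) ≤ 3 then y ^ E0 σ else 0) ≤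
      ∑ σ : Conf L q, (1 / w) ^ 3 * (w ^ cycE (col σ x0) * y ^ E0 σ) := by
    refine Finset.sum_le_sum fun σ _ => ?_
    split_ifs with hc
    · have : 1 ≤ (1 / w) ^ 3 * w ^ cycE (col σ x0) := by
        have : w ^ 3 ≤ w ^ cycE (col σ x0) := pow_le_pow_of_le_one hw0.le hw1 hc
        rw [div_pow, one_pow, one_div_mul_eq_div, le_div_iff₀ (by positivity)]
        linarith
      rw [← mul_assoc]
      exact le_mul_of_one_le_left (by positivity) this
    · positivity
  rw [← Finset.mul_sum] at h2
  refine le_trans h2 ?_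
  calc (1 / w) ^ 3 * ∑ σ : Conf L q, w ^ cycE (col σ x0) * y ^ E0 σ
      ≤ (1 / w) ^ 3 * ((1 + 1 / (L : ℝ)) ^ L * (q * (1 + (q : ℝ) ^ 2 * w) ^ (2 * L))) := by gcongr
    _ ≤ (1 / w) ^ 3 * (3 * (q * 3)) := by gcongr
    _ = 72 * (q : ℝ) ^ 7 * (L : ℝ) ^ 3 := by rw [hw]; field_simp; ring

lemma NB_sum [Fact (1 < L)] (hL : 40 ≤ L) (hq : 2 ≤ q) (A : Finset (Fin q)) (δ : ℝ) (hδ : 0 < δ)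
    (hG : 12 * (q : ℝ) ^ 4 * (L : ℝ) ^ 3 * δ ≤ 1) (j : ℕ) (X : Finset (ZMod L)) :
    ∑ σ : Conf L q, (if NB A σ ∧ (∃ x ∈ X, cycE (col σ x) ≤ 3) ∧ 2 * L + j ≤ Ham L q σ then
      δ ^ Ham L q σ / δ ^ (2 * L + 2) else 0) ≤
    X.card * (72 * (q : ℝ) ^ 7 * (L : ℝ) ^ 3) * ((12 * (q : ℝ) ^ 4 * (L : ℝ) ^ 3 * δ) ^ j / δ ^ 2) := by
  have hLr : (40 : ℝ) ≤ L := by exact_mod_cast hL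
  have hqr : (2 : ℝ) ≤ q := by exact_mod_cast hq
  have hL0 : (0 : ℝ) < L := by linarith
  have hq0 : (0 : ℝ) < q := by linarith
  set D : ℝ := 12 * (q : ℝ) ^ 4 * (L : ℝ) ^ 3 with hD
  have hD0 : 0 < D := by positivity
  have hD1 : 1 ≤ D := by
    have a1 : (1:ℝ) ≤ (q : ℝ) ^ 4 := one_le_pow₀ (by linarith)
    have a2 : (1:ℝ) ≤ (L : ℝ) ^ 3 := one_le_pow₀ (by linarith)
    rw [hD]; nlinarith
  set y : ℝ := Real.sqrt (1 / D) with hy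
  have hy0 : 0 ≤ y := Real.sqrt_nonneg _
  have hy2 : y ^ 2 = 1 / D := Real.sq_sqrt (by positivity)
  have hy1 : y ≤ 1 := by
    rw [hy]; apply Real.sqrt_le_one.2 <;> first | exact (div_le_one hD0).2 hD1 | skip
  have key : ∀ σ : Conf L q, (if NB A σ ∧ (∃ x ∈ X, cycE (col σ x) ≤ 3) ∧ 2 * L + j ≤ Ham L q σ then
      δ ^ Ham L q σ / δ ^ (2 * L + 2) else 0) ≤
      ∑ x ∈ X, ((D * δ) ^ j / δ ^ 2) * (if cycE (col σ x) ≤ 3 then y ^ E0 σ else 0) := by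
    intro σ
    have hnn : ∀ x ∈ X, 0 ≤ ((D * δ) ^ j / δ ^ 2) * (if cycE (col σ x) ≤ 3 then y ^ E0 σ else 0) := by
      intro x _; split_ifs <;> positivity
    split_ifs with h
    · obtain ⟨hN, ⟨x, hx, hc⟩, hH⟩ := h
      refine le_trans ?_ (Finset.single_le_sum hnn hx)
      rw [if_pos hc]
      have hE := two_ham σ
      have hE1 := NB_E1 hN
      have hE2 := NB_E2 hN
      obtain ⟨i, hi⟩ := Nat.exists_eq_add_of_le (show 2 * L ≤ Ham L q σ by omega)
      have hji : j ≤ i := by omega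
      have hE0 : E0 σ ≤ 2 * i := by omega
      have e1 : δ ^ Ham L q σ / δ ^ (2 * L + 2) = δ ^ i / δ ^ 2 := by
        rw [hi, pow_add, pow_add, mul_div_mul_left _ _ (by positivity)]
      rw [e1, div_mul_eq_mul_div]
      refine div_le_div_of_nonneg_right ?_ (by positivity)
      have e2 : δ ^ i = (D * δ) ^ i * y ^ (2 * i) := by
        rw [pow_mul, hy2, ← mul_pow]; congr 1; field_simp
      rw [e2]
      gcongr ?_ * ?_
      · exact pow_le_pow_of_le_one (by positivity) hG hji
      · exact pow_le_pow_of_le_one hy0 hy1 hE0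
    · exact Finset.sum_nonneg hnn
  refine le_trans (Finset.sum_le_sum fun σ _ => key σ) ?_
  rw [Finset.sum_comm]
  have : ∀ x ∈ X, ∑ σ : Conf L q, ((D * δ) ^ j / δ ^ 2) * (if cycE (col σ x) ≤ 3 then y ^ E0 σ else 0) ≤
      ((D * δ) ^ j / δ ^ 2) * (72 * (q : ℝ) ^ 7 * (L : ℝ) ^ 3) := by
    intro x _
    rw [← Finset.mul_sum]
    have := M_bound hL hq x y hy0 hy2
    gcongr
  refine le_trans (Finset.sum_le_sum this) ?_
  rw [Finset.sum_const, nsmul_eq_mul]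
  apply le_of_eq; ring

lemma CF_sum_le [Fact (1 < L)] (A : Finset (Fin q)) (Q : ℕ → Prop) [DecidablePred Q] (f : ℕ → ℝ) (hf : ∀ n, 0 ≤ f n) :
    ∑ σ : Conf L q, (if CF A σ ∧ Q (Ham L q σ) then f (Ham L q σ) else 0) ≤
      3 * ∑ σ : Conf L q, (if NB A σ ∧ Q (Ham L q σ) then f (Ham L q σ) else 0) := by
  have key : ∀ σ : Conf L q, (if CF A σ ∧ Q (Ham L q σ) then f (Ham L q σ) else 0) ≤
      ∑ d : Fin 3, (if NB A (σ ∘ th d) ∧ Q (Ham L q (σ ∘ th d)) then f (Ham L q (σ ∘ th d)) else 0) := by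
    intro σ
    have hnn : ∀ d ∈ (Finset.univ : Finset (Fin 3)),
        0 ≤ (if NB A (σ ∘ th d) ∧ Q (Ham L q (σ ∘ th d)) then f (Ham L q (σ ∘ th d)) else 0) := by
      intro d _; split_ifs; exacts [hf _, le_rfl]
    split_ifs with h
    · obtain ⟨d, hd⟩ := (CF_iff A σ).1 h.1
      refine le_trans ?_ (Finset.single_le_sum hnn (Finset.mem_univ d))
      rw [ham_th, if_pos ⟨hd, h.2⟩]
    · exact Finset.sum_nonneg hnn
  refine le_trans (Finset.sum_le_sum fun σ _ => key σ) ?_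
  rw [Finset.sum_comm]
  have : ∀ d ∈ (Finset.univ : Finset (Fin 3)), ∑ σ : Conf L q,
      (if NB A (σ ∘ th d) ∧ Q (Ham L q (σ ∘ th d)) then f (Ham L q (σ ∘ th d)) else 0) =
      ∑ σ : Conf L q, (if NB A σ ∧ Q (Ham L q σ) then f (Ham L q σ) else 0) := by
    intro d _
    refine Fintype.sum_equiv ⟨fun σ => σ ∘ th d, fun σ => σ ∘ th d, comp_th_th d, comp_th_th d⟩ _ _ fun σ => rfl
  rw [Finset.sum_congr rfl this]
  simp

lemma crude [Fact (1 < L)] (hL : 40 ≤ L) (hq : 2 ≤ q) (δ : ℝ) (hδ : 0 < δ)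
    (hG : 3 * (L : ℝ) ^ 2 * (q : ℝ) ^ 2 * δ ≤ 1) :
    ∑ σ : Conf L q, (if 3 * L ≤ Ham L q σ then δ ^ Ham L q σ / δ ^ (2 * L + 2) else 0) ≤
      3 * q * ((3 * (L : ℝ) ^ 2 * (q : ℝ) ^ 2 * δ) ^ (3 * L) / δ ^ (2 * L + 2)) := by
  have hLr : (40 : ℝ) ≤ L := by exact_mod_cast hL
  have hqr : (2 : ℝ) ≤ q := by exact_mod_cast hq
  have hL0 : (0 : ℝ) < L := by linarith
  have hq0 : (0 : ℝ) < q := by linarith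
  set D : ℝ := 3 * (L : ℝ) ^ 2 * (q : ℝ) ^ 2 with hD
  have hD0 : 0 < D := by positivity
  have h := lat_sum_all (L := L) (q := q) (1 / D) (by positivity)
  have h3 : (1 + (q : ℝ) ^ 2 * (1 / D)) ^ (3 * L ^ 2) ≤ 3 := by
    refine one_add_pow_le (by positivity) _ ?_
    rw [hD]; push_cast
    apply le_of_eq; field_simp
  have key : ∀ σ : Conf L q, (if 3 * L ≤ Ham L q σ then δ ^ Ham L q σ / δ ^ (2 * L + 2) else 0) ≤
      ((D * δ) ^ (3 * L) / δ ^ (2 * L + 2)) * (1 / D) ^ Ham L q σ := by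
    intro σ
    split_ifs with hH
    · rw [div_mul_eq_mul_div]
      refine div_le_div_of_nonneg_right ?_ (by positivity)
      have e2 : δ ^ Ham L q σ = (D * δ) ^ Ham L q σ * (1 / D) ^ Ham L q σ := by
        rw [← mul_pow]; congr 1; field_simp
      rw [e2]
      gcongr ?_ * ?_
      exact pow_le_pow_of_le_one (by positivity) hG hH
    · positivity
  refine le_trans (Finset.sum_le_sum fun σ _ => key σ) ?_
  rw [← Finset.mul_sum]
  calc (D * δ) ^ (3 * L) / δ ^ (2 * L + 2) * ∑ σ : Conf L q, (1 / D) ^ Ham L q σ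
      ≤ (D * δ) ^ (3 * L) / δ ^ (2 * L + 2) * (q * 3) := by
        gcongr
        exact le_trans h (by gcongr)
    _ = _ := by ring

noncomputable def Sg (A : Finset (Fin q)) (L : ℕ) [NeZero L] (δ : ℝ) (K : ℕ) : ℝ :=
  ∑ σ : Conf L q, (if CF A σ ∧ 2 * L + K ≤ Ham L q σ then δ ^ Ham L q σ / δ ^ (2 * L + 2) else 0)

lemma Sg5 [Fact (1 < L)] (hL : 40 ≤ L) (hq : 2 ≤ q) (A : Finset (Fin q)) (δ : ℝ) (hδ : 0 < δ)
    (hG : 12 * (q : ℝ) ^ 4 * (L : ℝ) ^ 3 * δ ≤ 1) (hG' : 3 * (L : ℝ) ^ 2 * (q : ℝ) ^ 2 * δ ≤ 1) :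
    Sg A L δ 5 ≤ 3 * (L * (72 * (q : ℝ) ^ 7 * (L : ℝ) ^ 3) * ((12 * (q : ℝ) ^ 4 * (L : ℝ) ^ 3 * δ) ^ 5 / δ ^ 2)) +
      3 * q * ((3 * (L : ℝ) ^ 2 * (q : ℝ) ^ 2 * δ) ^ (3 * L) / δ ^ (2 * L + 2)) := by
  have h1 : Sg A L δ 5 ≤
      ∑ σ : Conf L q, (if CF A σ ∧ (2 * L + 5 ≤ Ham L q σ ∧ Ham L q σ < 3 * L) then δ ^ Ham L q σ / δ ^ (2 * L + 2) else 0) +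
      ∑ σ : Conf L q, (if 3 * L ≤ Ham L q σ then δ ^ Ham L q σ / δ ^ (2 * L + 2) else 0) := by
    unfold Sg
    rw [← Finset.sum_add_distrib]
    refine Finset.sum_le_sum fun σ _ => ?_
    have hp : 0 ≤ δ ^ Ham L q σ / δ ^ (2 * L + 2) := by positivity
    by_cases h : 3 * L ≤ Ham L q σ
    · rw [if_pos h]
      split_ifs <;> linarith
    · rw [if_neg h, add_zero]
      have : Ham L q σ < 3 * L := by omega
      simp only [this, and_true]; exact le_rfl
  refine le_trans h1 (add_le_add ?_ (crude hL hq δ hδ hG'))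
  refine le_trans (CF_sum_le A (fun n => 2 * L + 5 ≤ n ∧ n < 3 * L) (fun n => δ ^ n / δ ^ (2 * L + 2)) (fun n => by positivity)) ?_
  have h2 := NB_sum hL hq A δ hδ hG 5 Finset.univ
  rw [Finset.card_univ, ZMod.card] at h2
  refine mul_le_mul_of_nonneg_left (le_trans (Finset.sum_le_sum fun σ _ => ?_) h2) (by norm_num)
  by_cases hc : NB A σ ∧ (2 * L + 5 ≤ Ham L q σ ∧ Ham L q σ < 3 * L)
  · rw [if_pos hc, if_pos]
    obtain ⟨hN, hH, hH3⟩ := hc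
    refine ⟨hN, ?_, hH⟩
    by_contra hno
    push Not at hno
    have hE := two_ham σ
    have hE2 := NB_E2 hN
    have : ∑ x : ZMod L, 4 ≤ E1 σ := Finset.sum_le_sum fun x _ => hno x (Finset.mem_univ _)
    rw [Finset.sum_const, Finset.card_univ, ZMod.card, smul_eq_mul] at this
    omega
  · rw [if_neg hc]; split_ifs <;> positivity

lemma Sg3 [Fact (1 < L)] (hL : 40 ≤ L) (hq : 2 ≤ q) (A : Finset (Fin q)) (δ : ℝ) (hδ : 0 < δ)
    (hG : 12 * (q : ℝ) ^ 4 * (L : ℝ) ^ 3 * δ ≤ 1) :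
    Sg A L δ 3 ≤ 3 * (9 * (72 * (q : ℝ) ^ 7 * (L : ℝ) ^ 3) * ((12 * (q : ℝ) ^ 4 * (L : ℝ) ^ 3 * δ) ^ 3 / δ ^ 2)) +
      Sg A L δ 5 := by
  have h1 : Sg A L δ 3 ≤
      ∑ σ : Conf L q, (if CF A σ ∧ (2 * L + 3 ≤ Ham L q σ ∧ Ham L q σ < 2 * L + 5) then δ ^ Ham L q σ / δ ^ (2 * L + 2) else 0) +
      Sg A L δ 5 := by
    unfold Sg
    rw [← Finset.sum_add_distrib]
    refine Finset.sum_le_sum fun σ _ => ?_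
    have hp : 0 ≤ δ ^ Ham L q σ / δ ^ (2 * L + 2) := by positivity
    by_cases h : 2 * L + 5 ≤ Ham L q σ
    · have h' : 2 * L + 3 ≤ Ham L q σ := by omega
      simp only [h, h', and_true, true_and]
      split_ifs <;> linarith
    · have : Ham L q σ < 2 * L + 5 := by omega
      simp only [this, h, and_true, and_false, if_false, add_zero]; exact le_rfl
  refine le_trans h1 (add_le_add ?_ le_rfl)
  refine le_trans (CF_sum_le A (fun n => 2 * L + 3 ≤ n ∧ n < 2 * L + 5) (fun n => δ ^ n / δ ^ (2 * L + 2)) (fun n => by positivity)) ?_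
  set X : Finset (ZMod L) := (Finset.range 9).image (fun i : ℕ => (0 : ZMod L) + (i : ZMod L)) with hX
  have hXc : X.card = 9 := by
    rw [hX, Finset.card_image_of_injOn, Finset.card_range]
    intro i hi j hj he
    simp only [Finset.coe_range, Set.mem_Iio] at hi hj
    exact idx_inj 0 (by omega) (by omega) he
  have h2 := NB_sum hL hq A δ hδ hG 3 X
  rw [hXc] at h2
  refine mul_le_mul_of_nonneg_left (le_trans (Finset.sum_le_sum fun σ _ => ?_) (by exact_mod_cast h2)) (by norm_num)
  by_cases hc : NB A σ ∧ (2 * L + 3 ≤ Ham L q σ ∧ Ham L q σ < 2 * L + 5)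
  · rw [if_pos hc, if_pos]
    obtain ⟨hN, hH, hH3⟩ := hc
    refine ⟨hN, ?_, hH⟩
    by_contra hno
    push Not at hno
    have hE := two_ham σ
    have hE2 := NB_E2 hN
    have := sum_ge_two_add (fun x => cycE (col σ x)) X (NB_col hN.1) (fun x hx => by have := hno x hx; omega)
    rw [hXc] at this
    have e1 : E1 σ = ∑ x, cycE (col σ x) := rfl
    omega
  · rw [if_neg hc]; split_ifs <;> positivity

end P10

section P11
variable {L q : ℕ} [NeZero L]

lemma dirichlet_principle {X : Type*} [Fintype X] (c : X → X → ℝ) (hc : ∀ x y, 0 ≤ c x y)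
    (hs : ∀ x y, c x y = c y x) (h f : X → ℝ)
    (hf : ∀ x, f x = h x ∨ ∑ y, c x y * (h x - h y) = 0) :
    ∑ x, ∑ y, c x y * (h y - h x) ^ 2 ≤ ∑ x, ∑ y, c x y * (f y - f x) ^ 2 := by
  have e0 : ∑ x, ∑ y, c x y * (h x - h y) * (f x - h x) = 0 := by
    refine Finset.sum_eq_zero fun x _ => ?_
    rw [← Finset.sum_mul]
    rcases hf x with h1 | h1
    · rw [h1]; ring
    · rw [h1]; ring
  have e1 : ∑ x, ∑ y, c x y * (h x - h y) * (f y - h y) = 0 := by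
    rw [Finset.sum_comm, ← neg_eq_zero, ← Finset.sum_neg_distrib]
    rw [← e0]
    refine Finset.sum_congr rfl fun x _ => ?_
    rw [← Finset.sum_neg_distrib]
    refine Finset.sum_congr rfl fun y _ => ?_
    rw [hs y x]; ring
  have e2 : ∑ x, ∑ y, c x y * (f y - f x) ^ 2 = ∑ x, ∑ y, c x y * (h y - h x) ^ 2 +
      ∑ x, ∑ y, c x y * ((f y - h y) - (f x - h x)) ^ 2 +
      2 * ∑ x, ∑ y, c x y * (h x - h y) * (f x - h x) - 2 * ∑ x, ∑ y, c x y * (h x - h y) * (f y - h y) := by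
    simp only [Finset.mul_sum, ← Finset.sum_add_distrib, ← Finset.sum_sub_distrib]
    refine Finset.sum_congr rfl fun x _ => Finset.sum_congr rfl fun y _ => ?_
    ring
  rw [e2, e0, e1]
  have : 0 ≤ ∑ x, ∑ y, c x y * ((f y - h y) - (f x - h x)) ^ 2 :=
    Finset.sum_nonneg fun x _ => Finset.sum_nonneg fun y _ => mul_nonneg (hc x y) (sq_nonneg _)
  linarith

noncomputable def cw (L q : ℕ) (δ : ℝ) (σ ζ : Conf L q) : ℝ :=
  if oneFlip σ ζ then δ ^ (max (Ham L q σ) (Ham L q ζ)) / δ ^ (2 * L + 2) else 0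

noncomputable def EE (L q : ℕ) [NeZero L] (δ : ℝ) (f : Conf L q → ℝ) : ℝ :=
  ∑ σ : Conf L q, ∑ ζ : Conf L q, cw L q δ σ ζ * (f ζ - f σ) ^ 2

lemma cw_nonneg {δ : ℝ} (hδ : 0 < δ) (σ ζ : Conf L q) : 0 ≤ cw L q δ σ ζ := by
  unfold cw; split_ifs <;> positivity

lemma cw_symm {δ : ℝ} (σ ζ : Conf L q) : cw L q δ σ ζ = cw L q δ ζ σ := by
  unfold cw
  rw [max_comm]
  by_cases h : oneFlip σ ζ
  · rw [if_pos h, if_pos (oneFlip_symm h)]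
  · rw [if_neg h, if_neg (fun h' => h (oneFlip_symm h'))]

lemma Zfun_eq (β : ℝ) : Zfun L q β = ∑ σ : Conf L q, Real.exp (-β) ^ Ham L q σ := by
  unfold Zfun
  rw [tsum_fintype]
  refine Finset.sum_congr rfl fun σ _ => ?_
  rw [← Real.exp_nat_mul]; congr 1; ring

lemma exp_rate (β : ℝ) (σ ζ : Conf L q) : Real.exp (-β * (Ham L q σ : ℝ)) * rate L q β σ ζ =
    cw L q (Real.exp (-β)) σ ζ * Real.exp (-β) ^ (2 * L + 2) := by
  unfold rate cw
  split_ifs with h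
  · rw [div_mul_cancel₀ _ (by positivity), ← Real.exp_add, ← Real.exp_nat_mul]
    congr 1
    push_cast
    rcases le_total (Ham L q σ : ℝ) (Ham L q ζ : ℝ) with h1 | h1
    · rw [max_eq_left (by linarith), max_eq_right h1]; ring
    · rw [max_eq_right (by linarith), max_eq_left h1]; ring
  · simp

lemma dir_eq (β : ℝ) (f : Conf L q → ℝ) :
    dirichletForm L q β f / Real.exp (-(2 * (L : ℝ) + 2) * β) = (1 / 2 * EE L q (Real.exp (-β)) f) / Zfun L q β := by
  have e : Real.exp (-(2 * (L : ℝ) + 2) * β) = Real.exp (-β) ^ (2 * L + 2) := by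
    rw [← Real.exp_nat_mul]; congr 1; push_cast; ring
  unfold dirichletForm EE
  rw [tsum_fintype, Fintype.sum_prod_type, e, mul_div_assoc, mul_div_assoc]
  congr 1
  rw [Finset.sum_div, Finset.sum_div]
  refine Finset.sum_congr rfl fun σ _ => ?_
  rw [Finset.sum_div, Finset.sum_div]
  refine Finset.sum_congr rfl fun ζ _ => ?_
  have h := exp_rate β σ ζ
  unfold gibbsWeight
  have hp : Real.exp (-β) ^ (2 * L + 2) ≠ 0 := by positivity
  simp only
  rw [div_mul_eq_mul_div, h]
  field_simp

lemma harm_cw (β : ℝ) (h : Conf L q → ℝ) (σ : Conf L q) (H : (∑' ζ : Conf L q, rate L q β σ ζ * (h σ - h ζ)) = 0) :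
    ∑ ζ, cw L q (Real.exp (-β)) σ ζ * (h σ - h ζ) = 0 := by
  rw [tsum_fintype] at H
  have hp : Real.exp (-β) ^ (2 * L + 2) ≠ 0 := by positivity
  have : (∑ ζ, cw L q (Real.exp (-β)) σ ζ * (h σ - h ζ)) * Real.exp (-β) ^ (2 * L + 2) =
      Real.exp (-β * (Ham L q σ : ℝ)) * ∑ ζ : Conf L q, rate L q β σ ζ * (h σ - h ζ) := by
    rw [Finset.sum_mul, Finset.mul_sum]
    refine Finset.sum_congr rfl fun ζ _ => ?_
    rw [← mul_assoc, exp_rate]; ring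
  rw [H, mul_zero] at this
  exact (mul_eq_zero.1 this).resolve_right hp

lemma EE_le (β : ℝ) (A : Finset (Fin q)) (h : Conf L q → ℝ)
    (hh : IsEqPotential L q β {σ : Conf L q | ∃ a ∈ A, σ = groundConf L q a}
      {σ : Conf L q | ∃ b ∈ Aᶜ, σ = groundConf L q b} h) :
    EE L q (Real.exp (-β)) h ≤ EE L q (Real.exp (-β)) (ff A) := by
  obtain ⟨h1, h2, h3⟩ := hh
  refine dirichlet_principle _ (fun x y => cw_nonneg (Real.exp_pos _) x y) cw_symm _ _ fun σ => ?_
  by_cases hA : ∃ a ∈ A, σ = groundConf L q a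
  · left
    rw [h1 σ hA]
    obtain ⟨a, ha, rfl⟩ := hA
    exact ff_ground_A ha
  by_cases hB : ∃ b ∈ Aᶜ, σ = groundConf L q b
  · left
    rw [h2 σ hB]
    obtain ⟨a, ha, rfl⟩ := hB
    exact ff_ground_B (by simpa using ha)
  right
  exact harm_cw β h σ (h3 σ hA hB)

lemma card_nbr [Fact (1 < L)] (σ : Conf L q) :
    ∑ ζ : Conf L q, (if oneFlip σ ζ then (1:ℝ) else 0) ≤ 2 * (L:ℝ) ^ 2 * q := by
  have h1 : ∀ ζ : Conf L q, (if oneFlip σ ζ then (1:ℝ) else 0) ≤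
      ∑ z : Site L, ∑ c : Fin q, (if ζ = Function.update σ z c then (1:ℝ) else 0) := by
    intro ζ
    have hnn : ∀ z : Site L, ∀ c : Fin q, (0:ℝ) ≤ (if ζ = Function.update σ z c then (1:ℝ) else 0) := by
      intro z c; split_ifs <;> norm_num
    split_ifs with h
    · obtain ⟨z, c, _, hz⟩ := (oneFlip_iff _ _).1 h
      refine le_trans ?_ (Finset.single_le_sum (fun z _ => Finset.sum_nonneg fun c _ => hnn z c) (Finset.mem_univ z))
      refine le_trans ?_ (Finset.single_le_sum (fun c _ => hnn z c) (Finset.mem_univ c))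
      rw [if_pos hz]
    · exact Finset.sum_nonneg fun z _ => Finset.sum_nonneg fun c _ => hnn z c
  refine le_trans (Finset.sum_le_sum fun ζ _ => h1 ζ) ?_
  rw [Finset.sum_comm]
  simp_rw [Finset.sum_comm (s := (Finset.univ : Finset (Conf L q)))]
  simp only [Finset.sum_ite_eq', Finset.mem_univ, if_true, Finset.sum_const, Finset.card_univ, nsmul_eq_mul, mul_one,
    Fintype.card_prod, Fintype.card_bool, Fintype.card_fin, ZMod.card]
  push_cast
  apply le_of_eq; ring

noncomputable def Wt (A : Finset (Fin q)) (L : ℕ) [NeZero L] (δ : ℝ) (K : ℕ) (σ : Conf L q) : ℝ :=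
  if CF A σ ∧ 2 * L + K ≤ Ham L q σ then δ ^ Ham L q σ / δ ^ (2 * L + 2) else 0

lemma Wt_nonneg (A : Finset (Fin q)) {δ : ℝ} (hδ : 0 < δ) (K : ℕ) (σ : Conf L q) : 0 ≤ Wt A L δ K σ := by
  unfold Wt; split_ifs <;> positivity

lemma cw_le_Wt (A : Finset (Fin q)) {δ : ℝ} (hδ : 0 < δ) (hδ1 : δ ≤ 1) (K : ℕ) (σ ζ : Conf L q)
    (h : CF A σ ∧ 2 * L + K ≤ Ham L q σ) : cw L q δ σ ζ ≤ Wt A L δ K σ := by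
  unfold Wt cw
  rw [if_pos h]
  split_ifs
  · gcongr ?_ / _
    exact pow_le_pow_of_le_one hδ.le hδ1 (le_max_left _ _)
  · positivity

lemma EE_ff_le [Fact (1 < L)] (hL : 40 ≤ L) (A : Finset (Fin q)) {δ : ℝ} (hδ : 0 < δ) (hδ1 : δ ≤ 1) :
    1 / 2 * EE L q δ (ff A) ≤ 48 * ((A.card : ℝ) * (Aᶜ.card : ℝ)) * (L * (((L - 12 : ℕ) : ℝ) * (L * L))) / (NN L : ℝ) ^ 2 +
      2 * (L : ℝ) ^ 2 * q * (9 / (NN L : ℝ) ^ 2 * Sg A L δ 3 + Sg A L δ 5) := by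
  have hN : (0:ℝ) < NN L := by exact_mod_cast NN_pos hL
  let M : Conf L q → Conf L q → ℝ := fun σ ζ => (1 / (NN L : ℝ) ^ 2) * (if Active A σ ζ then (1:ℝ) else 0)
  let G : Conf L q → Conf L q → ℝ := fun σ ζ => (9 / (NN L : ℝ) ^ 2 * Wt A L δ 3 σ + Wt A L δ 5 σ) * (if oneFlip σ ζ then (1:ℝ) else 0)
  have hM0 : ∀ σ ζ, 0 ≤ M σ ζ := by
    intro σ ζ; simp only [M]; split_ifs <;> positivity
  have hW0 : ∀ σ : Conf L q, 0 ≤ 9 / (NN L : ℝ) ^ 2 * Wt A L δ 3 σ + Wt A L δ 5 σ := by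
    intro σ
    have := Wt_nonneg A hδ 3 σ
    have := Wt_nonneg A hδ 5 σ
    positivity
  have hG0 : ∀ σ ζ, 0 ≤ G σ ζ := by
    intro σ ζ; simp only [G]; split_ifs
    · simpa using hW0 σ
    · simp
  have hGl : ∀ σ ζ, oneFlip σ ζ → ∀ x : ℝ, |x| ≤ 3 / NN L → CF A σ ∧ 2 * L + 3 ≤ Ham L q σ → cw L q δ σ ζ * x ^ 2 ≤ G σ ζ := by
    intro σ ζ hf x hx hc
    have h1 := cw_le_Wt A hδ hδ1 3 σ ζ hc
    have h2 : x ^ 2 ≤ 9 / (NN L : ℝ) ^ 2 := by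
      rw [← sq_abs]
      calc |x| ^ 2 ≤ (3 / (NN L : ℝ)) ^ 2 := by gcongr
        _ = _ := by rw [div_pow]; norm_num
    simp only [G, if_pos hf, mul_one]
    have := Wt_nonneg A hδ 5 σ
    have := mul_le_mul h1 h2 (sq_nonneg x) (Wt_nonneg A hδ 3 σ)
    linarith
  have hGl5 : ∀ σ ζ, oneFlip σ ζ → ∀ x : ℝ, |x| ≤ 1 → CF A σ ∧ 2 * L + 5 ≤ Ham L q σ → cw L q δ σ ζ * x ^ 2 ≤ G σ ζ := by
    intro σ ζ hf x hx hc
    have h1 := cw_le_Wt A hδ hδ1 5 σ ζ hc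
    have h2 : x ^ 2 ≤ 1 := by
      rw [← sq_abs]
      exact pow_le_one₀ (abs_nonneg x) hx
    simp only [G, if_pos hf, mul_one]
    have := mul_nonneg (by positivity : 0 ≤ 9 / (NN L : ℝ) ^ 2) (Wt_nonneg A hδ 3 σ)
    have := mul_le_mul h1 h2 (sq_nonneg x) (Wt_nonneg A hδ 5 σ)
    linarith
  have hMl : ∀ σ ζ, ∀ x : ℝ, |x| ≤ 1 / NN L → Active A σ ζ → cw L q δ σ ζ * x ^ 2 ≤ M σ ζ := by
    intro σ ζ x hx hc
    have hl : Ham L q ζ ≤ 2 * L + 1 := hc.2.1.2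
    have h1 : cw L q δ σ ζ = 1 := by
      unfold cw
      rw [if_pos hc.2.2.1, hc.1, max_eq_left (by omega), div_self (by positivity)]
    have h2 : x ^ 2 ≤ 1 / (NN L : ℝ) ^ 2 := by
      rw [← sq_abs]
      calc |x| ^ 2 ≤ (1 / (NN L : ℝ)) ^ 2 := by gcongr
        _ = _ := by rw [div_pow]; norm_num
    simp only [M, if_pos hc, mul_one]
    rw [h1]; linarith
  have key : ∀ σ ζ, cw L q δ σ ζ * (ff A ζ - ff A σ) ^ 2 ≤ (M σ ζ + M ζ σ) + (G σ ζ + G ζ σ) := by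
    intro σ ζ
    have a1 := hM0 σ ζ
    have a2 := hM0 ζ σ
    have a3 := hG0 σ ζ
    have a4 := hG0 ζ σ
    by_cases hf : oneFlip σ ζ
    · have hf' := oneFlip_symm hf
      have es : (ff A ζ - ff A σ) ^ 2 = (ff A σ - ff A ζ) ^ 2 := by ring
      rw [es]
      rcases ff_edge hL (A := A) hf with h | ⟨h, h'⟩ | ⟨h, h'⟩ | ⟨h, h'⟩
      · rw [h]; simp; positivity
      · rcases h' with h' | h'
        · have := hMl σ ζ _ h h'; linarith
        · have := hMl ζ σ _ h h'; rw [cw_symm]; linarith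
      · rcases h' with h' | h'
        · have := hGl σ ζ hf _ h h'; linarith
        · have := hGl ζ σ hf' _ h h'; rw [cw_symm]; linarith
      · rcases h' with h' | h'
        · have := hGl5 σ ζ hf _ h h'; linarith
        · have := hGl5 ζ σ hf' _ h h'; rw [cw_symm]; linarith
    · have : cw L q δ σ ζ = 0 := by unfold cw; rw [if_neg hf]
      rw [this]; linarith
  have hsum : EE L q δ (ff A) ≤ ∑ σ, ∑ ζ, ((M σ ζ + M ζ σ) + (G σ ζ + G ζ σ)) :=
    Finset.sum_le_sum fun σ _ => Finset.sum_le_sum fun ζ _ => key σ ζ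
  have e1 : ∑ σ, ∑ ζ, ((M σ ζ + M ζ σ) + (G σ ζ + G ζ σ)) = 2 * (∑ σ, ∑ ζ, M σ ζ) + 2 * (∑ σ, ∑ ζ, G σ ζ) := by
    simp only [Finset.sum_add_distrib]
    rw [Finset.sum_comm (f := fun σ ζ => M ζ σ), Finset.sum_comm (f := fun σ ζ => G ζ σ)]
    ring
  have e2 : ∑ σ, ∑ ζ, M σ ζ ≤ 48 * ((A.card : ℝ) * (Aᶜ.card : ℝ)) * (L * (((L - 12 : ℕ) : ℝ) * (L * L))) / (NN L : ℝ) ^ 2 := by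
    simp only [M, ← Finset.mul_sum]
    rw [one_div_mul_eq_div]
    gcongr
    exact active_count hL A
  have e3 : ∑ σ, ∑ ζ, G σ ζ ≤ 2 * (L : ℝ) ^ 2 * q * (9 / (NN L : ℝ) ^ 2 * Sg A L δ 3 + Sg A L δ 5) := by
    simp only [G, ← Finset.mul_sum]
    have : ∀ K, Sg A L δ K = ∑ σ, Wt A L δ K σ := fun K => rfl
    rw [this, this, Finset.mul_sum, ← Finset.sum_add_distrib, Finset.mul_sum]
    refine Finset.sum_le_sum fun σ _ => ?_
    rw [mul_comm (2 * (L : ℝ) ^ 2 * q)]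
    exact mul_le_mul_of_nonneg_left (card_nbr σ) (hW0 σ)
  linarith

end P11

section P12
variable {L q : ℕ} [NeZero L]

lemma crude_small (L q : ℕ) (hL : 40 ≤ L) (hq : 2 ≤ q) (hLq : 27 * (q:ℝ) ^ 6 ≤ L) (δ : ℝ) (hδ : 0 < δ)
    (hu : (L:ℝ) ^ 10 * δ ≤ 1) :
    (3 * (L : ℝ) ^ 2 * (q : ℝ) ^ 2 * δ) ^ (3 * L) / δ ^ (2 * L + 2) ≤ 729 * (q:ℝ) ^ 12 / (L:ℝ) ^ 3 := by
  have hLr : (40 : ℝ) ≤ L := by exact_mod_cast hL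
  have hL0 : (0 : ℝ) < L := by linarith
  obtain ⟨n, rfl⟩ : ∃ n, L = n + 2 := ⟨L - 2, by omega⟩
  set l : ℝ := ((n + 2 : ℕ) : ℝ) with hl
  have e : (3 * l ^ 2 * (q : ℝ) ^ 2 * δ) ^ (3 * (n + 2)) / δ ^ (2 * (n + 2) + 2) =
      (27 * l ^ 6 * (q:ℝ) ^ 6) ^ 2 * (27 * l ^ 6 * (q:ℝ) ^ 6 * δ) ^ n := by
    rw [div_eq_iff (by positivity), pow_mul]
    have : (3 * l ^ 2 * (q : ℝ) ^ 2 * δ) ^ 3 = 27 * l ^ 6 * (q:ℝ) ^ 6 * δ ^ 3 := by ring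
    rw [this]
    simp only [mul_pow, pow_add, ← pow_mul]
    ring
  rw [e]
  have h1 : 27 * l ^ 6 * (q:ℝ) ^ 6 * δ ≤ 1 / l ^ 3 := by
    rw [le_div_iff₀ (by positivity)]
    calc 27 * l ^ 6 * (q:ℝ) ^ 6 * δ * l ^ 3 = (27 * (q:ℝ) ^ 6) * (l ^ 9 * δ) := by ring
      _ ≤ l * (l ^ 9 * δ) := by gcongr
      _ = l ^ 10 * δ := by ring
      _ ≤ 1 := hu
  have h2 : (27 * l ^ 6 * (q:ℝ) ^ 6 * δ) ^ n ≤ 1 / l ^ 15 := by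
    calc (27 * l ^ 6 * (q:ℝ) ^ 6 * δ) ^ n ≤ (1 / l ^ 3) ^ n := by gcongr
      _ ≤ (1 / l ^ 3) ^ 5 := by
          refine pow_le_pow_of_le_one (by positivity) ?_ (by omega)
          rw [div_le_one (by positivity)]
          exact one_le_pow₀ (by linarith)
      _ = 1 / l ^ 15 := by rw [div_pow, one_pow, ← pow_mul]
  calc (27 * l ^ 6 * (q:ℝ) ^ 6) ^ 2 * (27 * l ^ 6 * (q:ℝ) ^ 6 * δ) ^ n
      ≤ (27 * l ^ 6 * (q:ℝ) ^ 6) ^ 2 * (1 / l ^ 15) := by gcongr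
    _ = _ := by field_simp; ring

lemma upper_explicit [Fact (1 < L)] (hL : 40 ≤ L) (hq : 2 ≤ q) (hLq : 27 * (q:ℝ) ^ 6 ≤ L) (A : Finset (Fin q))
    (δ : ℝ) (hδ : 0 < δ) (hu : (L:ℝ) ^ 10 * δ ≤ 1) :
    1 / 2 * EE L q δ (ff A) ≤ 48 * ((A.card : ℝ) * (Aᶜ.card : ℝ)) * ((L:ℝ) ^ 3 / (((L:ℝ) - 12) * (2 * (L:ℝ) - 8) ^ 2)) +
      (72 * 27 * 72 * 1728 * (q:ℝ) ^ 20 * ((L:ℝ) ^ 10 * δ) + 4 * 3 * 72 * 12 ^ 5 * (q:ℝ) ^ 28 * ((L:ℝ) ^ 10 * δ)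
        + 12 * 729 * (q:ℝ) ^ 14 * (1 / L)) := by
  have hLr : (40 : ℝ) ≤ L := by exact_mod_cast hL
  have hqr : (2 : ℝ) ≤ q := by exact_mod_cast hq
  have hL0 : (0 : ℝ) < L := by linarith
  have hq0 : (0 : ℝ) < q := by linarith
  set l : ℝ := (L : ℝ) with hl
  have hl1 : 1 ≤ l := by linarith
  have hδ1 : δ ≤ 1 := by
    have : (1:ℝ) ≤ l ^ 10 := one_le_pow₀ hl1
    nlinarith
  have hq1 : (1:ℝ) ≤ q := by linarith
  have hG : 12 * (q : ℝ) ^ 4 * l ^ 3 * δ ≤ 1 := by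
    refine le_trans ?_ hu
    have h4 : (q:ℝ) ^ 4 ≤ (q:ℝ) ^ 6 := pow_le_pow_right₀ hq1 (by norm_num)
    have : 12 * (q : ℝ) ^ 4 ≤ l := by linarith [pow_pos hq0 6]
    calc 12 * (q : ℝ) ^ 4 * l ^ 3 * δ ≤ l * l ^ 3 * δ := by gcongr
      _ = l ^ 4 * δ := by ring
      _ ≤ l ^ 10 * δ := by gcongr; norm_num
  have hG' : 3 * l ^ 2 * (q : ℝ) ^ 2 * δ ≤ 1 := by
    refine le_trans ?_ hG
    have h4 : (q:ℝ) ^ 2 ≤ (q:ℝ) ^ 4 := pow_le_pow_right₀ hq1 (by norm_num)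
    have h5 : l ^ 2 ≤ l ^ 3 := pow_le_pow_right₀ hl1 (by norm_num)
    calc 3 * l ^ 2 * (q : ℝ) ^ 2 * δ ≤ 12 * l ^ 3 * (q : ℝ) ^ 4 * δ := by gcongr; norm_num
      _ = _ := by ring
  have h3 := Sg3 hL hq A δ hδ hG
  have h5 := Sg5 hL hq A δ hδ hG hG'
  have hcr := crude_small L q hL hq hLq δ hδ hu
  have hNN : (l - 12) * (2 * l - 8) ≤ NN L := by
    have := NN_ge hL
    have h2 : (((L - 12) * (2 * L - 8) : ℕ) : ℝ) ≤ NN L := by exact_mod_cast this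
    rw [Nat.cast_mul, Nat.cast_sub (by omega), Nat.cast_sub (by omega)] at h2
    push_cast at h2
    exact h2
  have hN2 : l ^ 2 / 2 ≤ NN L := by nlinarith
  have hNp : (0:ℝ) < NN L := lt_of_lt_of_le (by positivity) hN2
  have hS5 : 0 ≤ Sg A L δ 5 := Finset.sum_nonneg fun σ _ => Wt_nonneg A hδ 5 σ
  have hS3 : 0 ≤ Sg A L δ 3 := Finset.sum_nonneg fun σ _ => Wt_nonneg A hδ 3 σ
  have m1 := EE_ff_le hL A hδ hδ1
  have hmain : 48 * ((A.card : ℝ) * (Aᶜ.card : ℝ)) * (l * (((L - 12 : ℕ) : ℝ) * (l * l))) / (NN L : ℝ) ^ 2 ≤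
      48 * ((A.card : ℝ) * (Aᶜ.card : ℝ)) * (l ^ 3 / ((l - 12) * (2 * l - 8) ^ 2)) := by
    rw [Nat.cast_sub (by omega)]
    push_cast
    have p1 : 0 < l - 12 := by linarith
    have p2 : 0 < 2 * l - 8 := by linarith
    calc 48 * ((A.card : ℝ) * (Aᶜ.card : ℝ)) * (l * ((l - 12) * (l * l))) / (NN L : ℝ) ^ 2
        ≤ 48 * ((A.card : ℝ) * (Aᶜ.card : ℝ)) * (l * ((l - 12) * (l * l))) / ((l - 12) * (2 * l - 8)) ^ 2 := by gcongr
      _ = _ := by field_simp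
  have h9 : 9 / (NN L : ℝ) ^ 2 ≤ 36 / l ^ 4 := by
    calc 9 / (NN L : ℝ) ^ 2 ≤ 9 / (l ^ 2 / 2) ^ 2 := by gcongr
      _ = _ := by field_simp; norm_num
  have h36 : 36 / l ^ 4 ≤ 1 := by
    rw [div_le_one (by positivity)]
    nlinarith [pow_le_pow_right₀ hl1 (show 1 ≤ 4 by norm_num)]
  have e3 : 3 * (9 * (72 * (q : ℝ) ^ 7 * l ^ 3) * ((12 * (q : ℝ) ^ 4 * l ^ 3 * δ) ^ 3 / δ ^ 2)) =
      27 * 72 * 1728 * (q:ℝ) ^ 19 * l ^ 12 * δ := by field_simp; ring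
  have e5 : 3 * (l * (72 * (q : ℝ) ^ 7 * l ^ 3) * ((12 * (q : ℝ) ^ 4 * l ^ 3 * δ) ^ 5 / δ ^ 2)) =
      3 * 72 * 12 ^ 5 * (q:ℝ) ^ 27 * l ^ 19 * δ ^ 3 := by field_simp
  rw [e3] at h3
  rw [e5] at h5
  have t1 : 9 / (NN L : ℝ) ^ 2 * Sg A L δ 3 + Sg A L δ 5 ≤
      36 / l ^ 4 * (27 * 72 * 1728 * (q:ℝ) ^ 19 * l ^ 12 * δ) + 2 * Sg A L δ 5 := by
    have a1 : 9 / (NN L : ℝ) ^ 2 * Sg A L δ 3 ≤ 36 / l ^ 4 * (27 * 72 * 1728 * (q:ℝ) ^ 19 * l ^ 12 * δ + Sg A L δ 5) := by gcongr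
    have a2 : 36 / l ^ 4 * Sg A L δ 5 ≤ 1 * Sg A L δ 5 := by gcongr
    linarith
  have h5' : Sg A L δ 5 ≤ 3 * 72 * 12 ^ 5 * (q:ℝ) ^ 27 * l ^ 19 * δ ^ 3 + 3 * q * (729 * (q:ℝ) ^ 12 / l ^ 3) := by
    refine le_trans h5 ?_
    gcongr
  have hu3 : l ^ 21 * δ ^ 3 ≤ l ^ 10 * δ := by
    calc l ^ 21 * δ ^ 3 ≤ l ^ 30 * δ ^ 3 := by gcongr; norm_num
      _ = (l ^ 10 * δ) ^ 2 * (l ^ 10 * δ) := by ring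
      _ ≤ 1 * (l ^ 10 * δ) := by
          gcongr
          exact pow_le_one₀ (by positivity) hu
      _ = _ := one_mul _
  have t2 : 2 * l ^ 2 * q * (9 / (NN L : ℝ) ^ 2 * Sg A L δ 3 + Sg A L δ 5) ≤
      72 * 27 * 72 * 1728 * (q:ℝ) ^ 20 * (l ^ 10 * δ) + 4 * 3 * 72 * 12 ^ 5 * (q:ℝ) ^ 28 * (l ^ 10 * δ)
        + 12 * 729 * (q:ℝ) ^ 14 * (1 / l) := by
    calc 2 * l ^ 2 * q * (9 / (NN L : ℝ) ^ 2 * Sg A L δ 3 + Sg A L δ 5)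
        ≤ 2 * l ^ 2 * q * (36 / l ^ 4 * (27 * 72 * 1728 * (q:ℝ) ^ 19 * l ^ 12 * δ) +
          2 * (3 * 72 * 12 ^ 5 * (q:ℝ) ^ 27 * l ^ 19 * δ ^ 3 + 3 * q * (729 * (q:ℝ) ^ 12 / l ^ 3))) := by
          refine mul_le_mul_of_nonneg_left ?_ (by positivity)
          linarith
      _ = 72 * 27 * 72 * 1728 * (q:ℝ) ^ 20 * (l ^ 10 * δ) + 4 * 3 * 72 * 12 ^ 5 * (q:ℝ) ^ 28 * (l ^ 21 * δ ^ 3)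
        + 12 * 729 * (q:ℝ) ^ 14 * (1 / l) := by field_simp; ring
      _ ≤ _ := by gcongr
  linarith

lemma tendsto_main_ratio : Filter.Tendsto (fun L : ℕ => (L:ℝ) ^ 3 / (((L:ℝ) - 12) * (2 * (L:ℝ) - 8) ^ 2))
    Filter.atTop (nhds (1 / 4)) := by
  have h0 : Filter.Tendsto (fun L : ℕ => (1:ℝ) / (L:ℝ)) Filter.atTop (nhds 0) := tendsto_one_div_atTop_nhds_zero_nat
  have h1 : Filter.Tendsto (fun L : ℕ => 1 / ((1 - 12 * ((1:ℝ) / (L:ℝ))) * (2 - 8 * ((1:ℝ) / (L:ℝ))) ^ 2))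
      Filter.atTop (nhds (1 / ((1 - 12 * 0) * (2 - 8 * 0) ^ 2))) := by
    refine Filter.Tendsto.div tendsto_const_nhds ?_ (by norm_num)
    exact (tendsto_const_nhds.sub (h0.const_mul 12)).mul ((tendsto_const_nhds.sub (h0.const_mul 8)).pow 2)
  have e : (1:ℝ) / ((1 - 12 * 0) * (2 - 8 * 0) ^ 2) = 1 / 4 := by norm_num
  rw [e] at h1
  refine h1.congr' ?_
  filter_upwards [Filter.eventually_ge_atTop 40] with L hL
  have hLr : (40 : ℝ) ≤ L := by exact_mod_cast hL
  have p0 : (0:ℝ) < L := by linarith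
  have p1 : (0:ℝ) < L - 12 := by linarith
  have p2 : (0:ℝ) < 2 * L - 8 := by linarith
  have e1 : (1 - 12 * ((1:ℝ) / (L:ℝ))) = (L - 12) / L := by field_simp
  have e2 : (2 - 8 * ((1:ℝ) / (L:ℝ))) = (2 * L - 8) / L := by field_simp
  rw [e1, e2]
  field_simp

lemma upper_limit (q : ℕ) (hq : 2 ≤ q) (A : Finset (Fin q)) (δ : ℕ → ℝ) (hδ : ∀ L, 0 < δ L)
    (hu : Filter.Tendsto (fun L : ℕ => (L:ℝ) ^ 10 * δ L) Filter.atTop (nhds 0)) :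
    ∃ U : ℕ → ℝ, Filter.Tendsto U Filter.atTop (nhds (12 * (A.card : ℝ) * (Aᶜ.card : ℝ))) ∧
      ∀ᶠ L in Filter.atTop, 40 ≤ L ∧ ∀ (_ : NeZero L), 1 / 2 * EE L q (δ L) (ff A) ≤ U L := by
  refine ⟨fun L => 48 * ((A.card : ℝ) * (Aᶜ.card : ℝ)) * ((L:ℝ) ^ 3 / (((L:ℝ) - 12) * (2 * (L:ℝ) - 8) ^ 2)) +
      (72 * 27 * 72 * 1728 * (q:ℝ) ^ 20 * ((L:ℝ) ^ 10 * δ L) + 4 * 3 * 72 * 12 ^ 5 * (q:ℝ) ^ 28 * ((L:ℝ) ^ 10 * δ L)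
        + 12 * 729 * (q:ℝ) ^ 14 * (1 / L)), ?_, ?_⟩
  · have h := (tendsto_main_ratio.const_mul (48 * ((A.card : ℝ) * (Aᶜ.card : ℝ)))).add
      (((hu.const_mul (72 * 27 * 72 * 1728 * (q:ℝ) ^ 20)).add (hu.const_mul (4 * 3 * 72 * 12 ^ 5 * (q:ℝ) ^ 28))).add
        ((tendsto_one_div_atTop_nhds_zero_nat (𝕜 := ℝ)).const_mul (12 * 729 * (q:ℝ) ^ 14)))
    convert h using 2
    ring
  · have h1 : ∀ᶠ L : ℕ in Filter.atTop, (L:ℝ) ^ 10 * δ L ≤ 1 := by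
      filter_upwards [hu.eventually (gt_mem_nhds (show (0:ℝ) < 1 by norm_num))] with L h using le_of_lt h
    filter_upwards [h1, Filter.eventually_ge_atTop 40, Filter.eventually_ge_atTop (27 * q ^ 6)] with L h1 h2 h3
    refine ⟨h2, fun _ => ?_⟩
    have : Fact (1 < L) := ⟨by omega⟩
    exact upper_explicit h2 hq (by exact_mod_cast h3) A (δ L) (hδ L) h1

lemma Z_limit (q : ℕ) (hq : 2 ≤ q) (β : ℕ → ℝ)
    (hu : Filter.Tendsto (fun L : ℕ => (L:ℝ) ^ 10 * Real.exp (-β L)) Filter.atTop (nhds 0)) :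
    Filter.Tendsto (fun L => Zfun L q (β L)) Filter.atTop (nhds (q:ℝ)) := by
  have h2 : Filter.Tendsto (fun L : ℕ => (q:ℝ) * Real.exp (3 * (q:ℝ) ^ 2 * ((L:ℝ) ^ 10 * Real.exp (-β L)))) Filter.atTop
      (nhds (q:ℝ)) := by
    have := ((Real.continuous_exp.tendsto _).comp (hu.const_mul (3 * (q:ℝ) ^ 2))).const_mul (q:ℝ)
    simpa using this
  refine tendsto_of_tendsto_of_tendsto_of_le_of_le' tendsto_const_nhds h2 ?_ ?_
  · filter_upwards [Filter.eventually_ge_atTop 40] with L hL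
    have : NeZero L := ⟨by omega⟩
    rw [Zfun_eq]
    have hinj : Function.Injective (groundConf L q) := fun a b h => congrFun h ((0, 0), false)
    have h1 : ∑ σ ∈ Finset.univ.image (groundConf L q), Real.exp (-β L) ^ Ham L q σ ≤
        ∑ σ : Conf L q, Real.exp (-β L) ^ Ham L q σ :=
      Finset.sum_le_univ_sum_of_nonneg fun σ => by positivity
    rw [Finset.sum_image (fun a _ b _ h => hinj h)] at h1
    refine le_trans (le_of_eq ?_) h1
    have : ∀ a : Fin q, Ham L q (groundConf L q a) = 0 := by
      intro a
      unfold Ham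
      have : IsEmpty {e : Site L × Site L // e.1.2 = false ∧ hexAdj e.1 e.2 ∧ groundConf L q a e.1 ≠ groundConf L q a e.2} :=
        ⟨fun e => e.2.2.2 rfl⟩
      exact Nat.card_of_isEmpty
    simp [this]
  · filter_upwards [Filter.eventually_ge_atTop 40] with L hL
    have : NeZero L := ⟨by omega⟩
    have : Fact (1 < L) := ⟨by omega⟩
    rw [Zfun_eq]
    refine le_trans (lat_sum_all (Real.exp (-β L)) (Real.exp_pos _).le) ?_
    gcongr
    have hl1 : (1:ℝ) ≤ L := by exact_mod_cast (by omega : 1 ≤ L)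
    calc (1 + (q : ℝ) ^ 2 * Real.exp (-β L)) ^ (3 * L ^ 2) ≤ (Real.exp ((q : ℝ) ^ 2 * Real.exp (-β L))) ^ (3 * L ^ 2) := by
          gcongr; rw [add_comm]; exact Real.add_one_le_exp _
      _ = Real.exp (3 * (q:ℝ) ^ 2 * ((L:ℝ) ^ 2 * Real.exp (-β L))) := by
          rw [← Real.exp_nat_mul]; congr 1; push_cast; ring
      _ ≤ _ := by
          apply Real.exp_le_exp.2
          have : (L:ℝ) ^ 2 ≤ (L:ℝ) ^ 10 := pow_le_pow_right₀ hl1 (by norm_num)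
          gcongr

end P12

section P13
variable {L q : ℕ} [NeZero L]

/-- the site with offset `i` in row `y0` -/
def st (x0 y0 : ZMod L) (i : ℕ) (c : Bool) : Site L := ((x0 + (i : ZMod L), y0), c)

lemma st_eq (x0 y0 : ZMod L) {i j k : ℕ} (hi : i < L) (hj : j < L) (hk : k < L) (c c' : Bool) :
    (((x0 + (i : ZMod L), y0 + (j : ZMod L)), c) : Site L) = st x0 y0 k c' ↔ i = k ∧ j = 0 ∧ c = c' := by
  unfold st
  constructor
  · intro h
    simp only [Prod.mk.injEq] at h
    refine ⟨idx_inj x0 hi hk h.1.1, ?_, h.2⟩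
    exact idx_inj y0 hj (Nat.pos_of_ne_zero (NeZero.ne L)) (by simpa using h.1.2)
  · rintro ⟨rfl, rfl, rfl⟩
    simp

lemma st_inj (x0 y0 : ZMod L) {i k : ℕ} (hi : i < L) (hk : k < L) {c c' : Bool}
    (h : st x0 y0 i c = st x0 y0 k c') : i = k ∧ c = c' := by
  unfold st at h
  simp only [Prod.mk.injEq] at h
  exact ⟨idx_inj x0 hi hk h.1.1, h.2⟩

lemma lowConf_st (a b : Fin q) (y0 : ZMod L) (n : ℕ) (x0 : ZMod L) (p : ℕ) {i : ℕ} (hi : i < L) (c : Bool) :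
    lowConf a b y0 n x0 p (st x0 y0 i c) = if i + c.toNat < p then b else a :=
  lowConf_row0 a b y0 n x0 p hi c

lemma lowConf_at' (a b : Fin q) (y0 : ZMod L) (n : ℕ) (x0 : ZMod L) (p : ℕ) {i j : ℕ} (hi : i < L) (hj : j < L) (c : Bool) :
    lowConf a b y0 n (x0 + 1) p ((x0 + (i : ZMod L), y0 + (j : ZMod L)), c) =
      if j = 0 then (if (if i = 0 then L - 1 else i - 1) + c.toNat < p then b else a) else if j ≤ n then a else b := by
  have e : x0 + (i : ZMod L) = (x0 + 1) + ((if i = 0 then L - 1 else i - 1 : ℕ) : ZMod L) := by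
    split_ifs with h
    · rw [← idx_pred, h]; simp
    · obtain ⟨k, rfl⟩ : ∃ k, i = k + 1 := ⟨i - 1, by omega⟩
      rw [Nat.add_sub_cancel]; push_cast; ring
  rw [e, lowConf_at a b y0 n (x0 + 1) p (by split_ifs <;> omega) hj]

lemma conf_ext {σ τ : Conf L q} (x0 y0 : ZMod L)
    (h : ∀ i j c, i < L → j < L → σ ((x0 + (i : ZMod L), y0 + (j : ZMod L)), c) = τ ((x0 + (i : ZMod L), y0 + (j : ZMod L)), c)) :
    σ = τ := by
  funext v
  obtain ⟨⟨x, y⟩, c⟩ := v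
  obtain ⟨i, hi, rfl⟩ := exists_idx x x0
  obtain ⟨j, hj, rfl⟩ := exists_idx y y0
  exact h i j c hi hj

lemma mid1 (a b : Fin q) (y0 : ZMod L) (n : ℕ) (x0 : ZMod L) (p : ℕ) (hp : 2 ≤ p) (hpL : p ≤ L) :
    Function.update (lowConf a b y0 n x0 p) (st x0 y0 (p - 1) false) a =
    Function.update (lowConf a b y0 n x0 (p - 1)) (st x0 y0 (p - 2) true) b := by
  refine conf_ext x0 y0 fun i j c hi hj => ?_
  rw [Function.update_apply, Function.update_apply, lowConf_at a b y0 n x0 _ hi hj, lowConf_at a b y0 n x0 _ hi hj]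
  simp only [st_eq x0 y0 hi hj (show p - 1 < L by omega), st_eq x0 y0 hi hj (show p - 2 < L by omega)]
  cases c <;> simp <;> split_ifs <;> first | rfl | omega

lemma mid2 (a b : Fin q) (y0 : ZMod L) (n : ℕ) (x0 : ZMod L) (p : ℕ) (hp : 2 ≤ p) (hpL : p ≤ L) :
    Function.update (lowConf a b y0 n x0 p) (st x0 y0 (p - 2) true) a =
    Function.update (lowConf a b y0 n x0 (p - 1)) (st x0 y0 (p - 1) false) b := by
  refine conf_ext x0 y0 fun i j c hi hj => ?_
  rw [Function.update_apply, Function.update_apply, lowConf_at a b y0 n x0 _ hi hj, lowConf_at a b y0 n x0 _ hi hj]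
  simp only [st_eq x0 y0 hi hj (show p - 2 < L by omega), st_eq x0 y0 hi hj (show p - 1 < L by omega)]
  cases c <;> simp <;> split_ifs <;> first | rfl | omega

lemma st_pred (x0 y0 : ZMod L) (c : Bool) : st (x0 + 1) y0 (L - 1) c = st x0 y0 0 c := by
  unfold st
  rw [← idx_pred]; simp

lemma mid3 (a b : Fin q) (y0 : ZMod L) (n : ℕ) (x0 : ZMod L) (p : ℕ) (hp : 2 ≤ p) (hpL : p ≤ L) :
    Function.update (lowConf a b y0 n x0 p) (st x0 y0 0 false) a =
    Function.update (lowConf a b y0 n (x0 + 1) (p - 1)) (st (x0 + 1) y0 (L - 1) true) b := by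
  refine conf_ext x0 y0 fun i j c hi hj => ?_
  rw [Function.update_apply, Function.update_apply, lowConf_at a b y0 n x0 _ hi hj, lowConf_at' a b y0 n x0 _ hi hj, st_pred]
  simp only [st_eq x0 y0 hi hj (show 0 < L by omega)]
  cases c <;> simp <;> split_ifs <;> first | rfl | omega

lemma mid4 (a b : Fin q) (y0 : ZMod L) (n : ℕ) (x0 : ZMod L) (p : ℕ) (hp : 2 ≤ p) (hpL : p ≤ L) :
    Function.update (lowConf a b y0 n x0 p) (st x0 y0 0 true) a =
    Function.update (lowConf a b y0 n (x0 + 1) (p - 1)) (st (x0 + 1) y0 (L - 1) false) b := by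
  refine conf_ext x0 y0 fun i j c hi hj => ?_
  rw [Function.update_apply, Function.update_apply, lowConf_at a b y0 n x0 _ hi hj, lowConf_at' a b y0 n x0 _ hi hj, st_pred]
  simp only [st_eq x0 y0 hi hj (show 0 < L by omega)]
  cases c <;> simp <;> split_ifs <;> first | rfl | omega

lemma mis_u (hL : 2 ≤ L) (a b : Fin q) (y0 : ZMod L) (n : ℕ) (x0 : ZMod L) (p : ℕ) (hpL : p ≤ L) {i : ℕ} (hi : i < L) (c : Fin q) :
    mis (lowConf a b y0 n x0 p) (st x0 y0 i false) c =
      mm c (if i + 1 < p then b else a) + mm c (if i ≠ 0 ∧ i < p then b else a) + mm c (if L - 1 ≤ n then a else b) := by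
  unfold mis
  rw [Fin.sum_univ_three]
  congr 1
  · congr 1
    · have : nb 0 (st x0 y0 i false) = st x0 y0 i true := rfl
      rw [this, lowConf_st a b y0 n x0 p hi]; rfl
    · have : nb 1 (st x0 y0 i false) = st x0 y0 (if i = 0 then L - 1 else i - 1) true := by
        simp only [nb, st]
        split_ifs with h
        · rw [← idx_pred, h]; simp
        · obtain ⟨k, rfl⟩ : ∃ k, i = k + 1 := ⟨i - 1, by omega⟩
          rw [idx_succ_sub]; simp
      rw [this, lowConf_st a b y0 n x0 p (by split_ifs <;> omega)]
      congr 1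
      by_cases h0 : i = 0
      · simp [h0]; omega
      · simp only [h0, if_false, Bool.toNat_true, ne_eq, not_false_eq_true, true_and]
        rw [Nat.sub_add_cancel (by omega)]
  · congr 1
    have : nb 2 (st x0 y0 i false) = ((x0 + (i : ZMod L), y0 + ((L - 1 : ℕ) : ZMod L)), true) := by
      rw [← idx_pred]; rfl
    rw [this, lowConf_rowj a b y0 n x0 _ p (by omega) (by omega)]

lemma mis_v (hL : 2 ≤ L) (a b : Fin q) (y0 : ZMod L) (n : ℕ) (x0 : ZMod L) (p : ℕ) (hp : 1 ≤ p) (hpL : p ≤ L) {i : ℕ} (hi : i < L) (c : Fin q) :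
    mis (lowConf a b y0 n x0 p) (st x0 y0 i true) c =
      mm c (if i < p then b else a) + mm c (if i + 1 = L ∨ i + 1 < p then b else a) + mm c (if 1 ≤ n then a else b) := by
  unfold mis
  rw [Fin.sum_univ_three]
  congr 1
  · congr 1
    · have : nb 0 (st x0 y0 i true) = st x0 y0 i false := rfl
      rw [this, lowConf_st a b y0 n x0 p hi]; rfl
    · have : nb 1 (st x0 y0 i true) = st x0 y0 (if i + 1 = L then 0 else i + 1) false := by
        simp only [nb, st]
        split_ifs with h
        · have : ((i + 1 : ℕ) : ZMod L) = 0 := by rw [h]; simp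
          push_cast at this
          rw [add_assoc, this]; simp
        · push_cast; rw [add_assoc]
      rw [this, lowConf_st a b y0 n x0 p (by split_ifs <;> omega)]
      congr 1
      by_cases h0 : i + 1 = L
      · simp [h0]; omega
      · simp [h0]
  · congr 1
    have : nb 2 (st x0 y0 i true) = ((x0 + (i : ZMod L), y0 + ((1 : ℕ) : ZMod L)), false) := by
      simp [nb, st]
    rw [this, lowConf_rowj a b y0 n x0 _ p (by omega) (by omega)]

end P13

section P14
variable {L q : ℕ} [NeZero L]

lemma ham_m1 [Fact (1 < L)] {a b : Fin q} (hab : a ≠ b) (y0 : ZMod L) (n : ℕ) (x0 : ZMod L) (p : ℕ)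
    (hp : 2 ≤ p) (hpL : p ≤ L) :
    Ham L q (Function.update (lowConf a b y0 n x0 p) (st x0 y0 (p - 1) false) a) + (if L - 1 ≤ n then 2 else 0) =
      Ham L q (lowConf a b y0 n x0 p) + 1 := by
  have h := ham_flip (lowConf a b y0 n x0 p) (st x0 y0 (p - 1) false) a
  rw [lowConf_st a b y0 n x0 p (by omega), mis_u (by omega) a b y0 n x0 p hpL (by omega),
    mis_u (by omega) a b y0 n x0 p hpL (by omega)] at h
  have e1 : p - 1 + (false).toNat < p := by simp; omega
  have e2 : ¬ (p - 1 + 1 < p) := by omega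
  have e3 : p - 1 ≠ 0 ∧ p - 1 < p := by omega
  rw [if_pos e1, if_neg e2, if_pos e3] at h
  split_ifs at h ⊢ <;> simp only [mm_self, mm_ne hab, mm_ne hab.symm] at h <;> omega

lemma ham_m1' [Fact (1 < L)] {a b : Fin q} (hab : a ≠ b) (y0 : ZMod L) (n : ℕ) (x0 : ZMod L) (p : ℕ)
    (hp : 2 ≤ p) (hpL : p ≤ L) :
    Ham L q (Function.update (lowConf a b y0 n x0 p) (st x0 y0 (p - 1) false) a) + (if n = 0 then 2 else 0) =
      Ham L q (lowConf a b y0 n x0 (p - 1)) + 1 := by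
  rw [mid1 a b y0 n x0 p hp hpL]
  have h := ham_flip (lowConf a b y0 n x0 (p - 1)) (st x0 y0 (p - 2) true) b
  rw [lowConf_st a b y0 n x0 (p - 1) (by omega), mis_v (by omega) a b y0 n x0 (p - 1) (by omega) (by omega) (by omega),
    mis_v (by omega) a b y0 n x0 (p - 1) (by omega) (by omega) (by omega)] at h
  have e1 : ¬ (p - 2 + (true).toNat < p - 1) := by simp; omega
  have e2 : p - 2 < p - 1 := by omega
  have e3 : ¬ (p - 2 + 1 = L ∨ p - 2 + 1 < p - 1) := by omega
  rw [if_neg e1, if_pos e2, if_neg e3] at h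
  split_ifs at h ⊢ <;> simp only [mm_self, mm_ne hab, mm_ne hab.symm] at h <;> omega

lemma ham_ground [Fact (1 < L)] (a : Fin q) : Ham L q (groundConf L q a) = 0 := by
  rw [ham_up]
  refine Finset.sum_eq_zero fun p _ => ?_
  simp [mis, groundConf, mm_self]

lemma low_end0 (hL : 2 ≤ L) (a b : Fin q) (y0 x0 : ZMod L) :
    lowConf a b y0 0 x0 L = Function.update (groundConf L q b) (st x0 y0 (L - 1) true) a := by
  refine conf_ext x0 y0 fun i j c hi hj => ?_
  rw [Function.update_apply, lowConf_at a b y0 0 x0 _ hi hj]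
  simp only [st_eq x0 y0 hi hj (show L - 1 < L by omega), groundConf]
  cases c <;> simp <;> split_ifs <;> first | rfl | omega

lemma low_end1 (hL : 2 ≤ L) (a b : Fin q) (y0 x0 : ZMod L) :
    lowConf a b y0 (L - 1) x0 1 = Function.update (groundConf L q a) (st x0 y0 0 false) b := by
  refine conf_ext x0 y0 fun i j c hi hj => ?_
  rw [Function.update_apply, lowConf_at a b y0 (L - 1) x0 _ hi hj]
  simp only [st_eq x0 y0 hi hj (show 0 < L by omega), groundConf]
  cases c
  · simp; split_ifs <;> first | rfl | omega
  · simp; intros; omega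

lemma low_plateau (hL : 2 ≤ L) (a b : Fin q) (y0 : ZMod L) (n : ℕ) (hn : n + 2 ≤ L) (x0 : ZMod L) :
    Function.update (lowConf a b (y0 + 1) n x0 1) (st x0 (y0 + 1) 0 false) a =
    Function.update (lowConf a b y0 (n + 1) x0 L) (st x0 y0 (L - 1) true) b := by
  refine conf_ext x0 (y0 + 1) fun i j c hi hj => ?_
  rw [Function.update_apply, Function.update_apply, lowConf_at a b (y0 + 1) n x0 _ hi hj]
  have e : (y0 + 1) + (j : ZMod L) = y0 + ((if j + 1 = L then 0 else j + 1 : ℕ) : ZMod L) := by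
    split_ifs with h
    · have : ((j + 1 : ℕ) : ZMod L) = 0 := by rw [h]; simp
      push_cast at this
      rw [add_assoc, add_comm (1 : ZMod L), this]; simp
    · push_cast; ring
  simp only [st_eq x0 (y0 + 1) hi hj (show 0 < L by omega)]
  rw [e]
  have hj' : (if j + 1 = L then 0 else j + 1) < L := by split_ifs <;> omega
  rw [lowConf_at a b y0 (n + 1) x0 _ hi hj']
  simp only [st_eq x0 y0 hi hj' (show L - 1 < L by omega)]
  cases c <;> simp <;> split_ifs <;> first | rfl | omega

lemma ham_end0 [Fact (1 < L)] (hL : 2 ≤ L) (a b : Fin q) (y0 x0 : ZMod L) : Ham L q (lowConf a b y0 0 x0 L) ≤ 3 := by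
  rw [low_end0 hL]
  have h := ham_flip (groundConf L q b) (st x0 y0 (L - 1) true) a
  have h2 := mis_le (groundConf L q b) (st x0 y0 (L - 1) true) a
  rw [ham_ground] at h
  omega

lemma ham_end1 [Fact (1 < L)] (hL : 2 ≤ L) (a b : Fin q) (y0 x0 : ZMod L) : Ham L q (lowConf a b y0 (L - 1) x0 1) ≤ 3 := by
  rw [low_end1 hL]
  have h := ham_flip (groundConf L q a) (st x0 y0 0 false) b
  have h2 := mis_le (groundConf L q a) (st x0 y0 0 false) b
  rw [ham_ground] at h
  omega

lemma ham_n0 [Fact (1 < L)] (hL : 3 ≤ L) {a b : Fin q} (hab : a ≠ b) (y0 x0 : ZMod L) (k : ℕ) (hk : k + 1 ≤ L) :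
    Ham L q (lowConf a b y0 0 x0 (L - k)) ≤ 3 + 2 * k := by
  induction k with
  | zero => simpa using ham_end0 (by omega) a b y0 x0
  | succ k ih =>
    have h1 := ham_m1 hab y0 0 x0 (L - k) (by omega) (by omega)
    have h2 := ham_m1' hab y0 0 x0 (L - k) (by omega) (by omega)
    rw [if_neg (by omega)] at h1
    rw [if_pos rfl] at h2
    have h3 := ih (by omega)
    rw [show L - (k + 1) = L - k - 1 by omega]
    omega

lemma ham_nL [Fact (1 < L)] (hL : 3 ≤ L) {a b : Fin q} (hab : a ≠ b) (y0 x0 : ZMod L) (k : ℕ) (hk : k + 1 ≤ L) :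
    Ham L q (lowConf a b y0 (L - 1) x0 (k + 1)) ≤ 3 + 2 * k := by
  induction k with
  | zero => simpa using ham_end1 (by omega) a b y0 x0
  | succ k ih =>
    have h1 := ham_m1 hab y0 (L - 1) x0 (k + 2) (by omega) (by omega)
    have h2 := ham_m1' hab y0 (L - 1) x0 (k + 2) (by omega) (by omega)
    rw [if_pos (by omega)] at h1
    rw [if_neg (by omega)] at h2
    have h3 := ih (by omega)
    rw [show k + 2 - 1 = k + 1 by omega] at h1 h2
    rw [show k + 1 + 1 = k + 2 by omega]
    omega

lemma ham_lc_le [Fact (1 < L)] (hL : 3 ≤ L) {a b : Fin q} (hab : a ≠ b) (y0 : ZMod L) (n : ℕ) (x0 : ZMod L) (p : ℕ)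
    (hn : n + 1 ≤ L) (hp : 1 ≤ p) (hpL : p ≤ L) : Ham L q (lowConf a b y0 n x0 p) ≤ 2 * L + 1 := by
  by_cases h0 : n = 0
  · have := ham_n0 hL hab y0 x0 (L - p) (by omega)
    rw [show L - (L - p) = p by omega] at this
    subst h0; omega
  by_cases h1 : n = L - 1
  · have := ham_nL hL hab y0 x0 (p - 1) (by omega)
    rw [show p - 1 + 1 = p by omega] at this
    subst h1; omega
  · exact (lowConf_ham hab y0 n x0 p hp hpL (by omega) (by omega)).le

lemma ham_m1_low [Fact (1 < L)] (hL : 3 ≤ L) {a b : Fin q} (hab : a ≠ b) (y0 : ZMod L) (n : ℕ) (x0 : ZMod L) (p : ℕ)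
    (hn : n = 0 ∨ n = L - 1) (hp : 2 ≤ p) (hpL : p ≤ L) :
    Ham L q (Function.update (lowConf a b y0 n x0 p) (st x0 y0 (p - 1) false) a) ≤ 2 * L + 1 := by
  have h1 := ham_m1 hab y0 n x0 p hp hpL
  have h2 := ham_m1' hab y0 n x0 p hp hpL
  have h3 := ham_lc_le hL hab y0 n x0 p (by omega) (by omega) hpL
  have h4 := ham_lc_le hL hab y0 n x0 (p - 1) (by omega) (by omega) (by omega)
  rcases hn with h | h
  · rw [if_pos h] at h2; omega
  · rw [if_pos (by omega)] at h1; omega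

lemma ham_plateau [Fact (1 < L)] (hL : 3 ≤ L) {a b : Fin q} (hab : a ≠ b) (y0 : ZMod L) (n : ℕ) (x0 : ZMod L) (hn : n + 2 ≤ L) :
    Ham L q (Function.update (lowConf a b y0 n x0 1) (st x0 y0 0 false) a) ≤ 2 * L + 1 := by
  have h := ham_flip (lowConf a b y0 n x0 1) (st x0 y0 0 false) a
  have h3 := ham_lc_le hL hab y0 n x0 1 (by omega) (by omega) (by omega)
  rw [lowConf_st a b y0 n x0 1 (by omega), mis_u (by omega) a b y0 n x0 1 (by omega) (by omega),
    mis_u (by omega) a b y0 n x0 1 (by omega) (by omega)] at h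
  rw [if_neg (show ¬ L - 1 ≤ n by omega)] at h
  simp [mm_self, mm_ne hab, mm_ne hab.symm] at h
  omega

/-- the four shrinking sites -/
lemma ham_shrink [Fact (1 < L)] (hL : 3 ≤ L) {a b : Fin q} (hab : a ≠ b) (y0 : ZMod L) (n : ℕ) (x0 : ZMod L) (p : ℕ)
    (hn : 1 ≤ n) (hn2 : n + 2 ≤ L) (hp : 2 ≤ p) (hpL : p ≤ L) :
    Ham L q (Function.update (lowConf a b y0 n x0 p) (st x0 y0 (p - 1) false) a) = 2 * L + 2 ∧
    Ham L q (Function.update (lowConf a b y0 n x0 p) (st x0 y0 (p - 2) true) a) = 2 * L + 2 ∧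
    Ham L q (Function.update (lowConf a b y0 n x0 p) (st x0 y0 0 false) a) = 2 * L + 2 ∧
    Ham L q (Function.update (lowConf a b y0 n x0 p) (st x0 y0 0 true) a) = 2 * L + 2 := by
  have h0 := lowConf_ham hab y0 n x0 p (by omega) hpL hn hn2
  refine ⟨?_, ?_, ?_, ?_⟩
  · have := ham_m1 hab y0 n x0 p hp hpL
    rw [if_neg (by omega)] at this
    omega
  · have h := ham_flip (lowConf a b y0 n x0 p) (st x0 y0 (p - 2) true) a
    rw [lowConf_st a b y0 n x0 p (by omega), mis_v (by omega) a b y0 n x0 p (by omega) hpL (by omega),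
      mis_v (by omega) a b y0 n x0 p (by omega) hpL (by omega), if_pos (show p - 2 + (true).toNat < p by simp; omega),
      if_pos (show p - 2 < p by omega), if_pos (show p - 2 + 1 = L ∨ p - 2 + 1 < p by omega), if_pos hn] at h
    simp only [mm_self, mm_ne hab, mm_ne hab.symm] at h
    omega
  · have h := ham_flip (lowConf a b y0 n x0 p) (st x0 y0 0 false) a
    rw [lowConf_st a b y0 n x0 p (by omega), mis_u (by omega) a b y0 n x0 p hpL (by omega),
      mis_u (by omega) a b y0 n x0 p hpL (by omega), if_pos (show 0 + (false).toNat < p by simp; omega),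
      if_pos (show 0 + 1 < p by omega), if_neg (show ¬ (0 ≠ 0 ∧ 0 < p) by omega), if_neg (show ¬ L - 1 ≤ n by omega)] at h
    simp only [mm_self, mm_ne hab, mm_ne hab.symm] at h
    omega
  · have h := ham_flip (lowConf a b y0 n x0 p) (st x0 y0 0 true) a
    rw [lowConf_st a b y0 n x0 p (by omega), mis_v (by omega) a b y0 n x0 p (by omega) hpL (by omega),
      mis_v (by omega) a b y0 n x0 p (by omega) hpL (by omega), if_pos (show 0 + (true).toNat < p by simp; omega),
      if_pos (show 0 < p by omega), if_pos (show 0 + 1 = L ∨ 0 + 1 < p by omega), if_pos hn] at h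
    simp only [mm_self, mm_ne hab, mm_ne hab.symm] at h
    omega

end P14

section P15
variable {L q : ℕ} [NeZero L]

def Lo (g : Conf L q → ℝ) (ε : ℝ) : Prop :=
  ∀ σ ζ : Conf L q, oneFlip σ ζ → Ham L q σ ≤ 2 * L + 1 → Ham L q ζ ≤ 2 * L + 1 → |g σ - g ζ| ≤ ε

lemma of_upd (σ : Conf L q) (z : Site L) (c : Fin q) (h : c ≠ σ z) : oneFlip σ (Function.update σ z c) :=
  (oneFlip_iff _ _).2 ⟨z, c, h, rfl⟩

lemma lo_two {g : Conf L q → ℝ} {ε : ℝ} (hg : Lo g ε) {σ τ ζ : Conf L q} (h1 : oneFlip σ τ) (h2 : oneFlip ζ τ)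
    (e1 : Ham L q σ ≤ 2 * L + 1) (e2 : Ham L q τ ≤ 2 * L + 1) (e3 : Ham L q ζ ≤ 2 * L + 1) : |g σ - g ζ| ≤ 2 * ε := by
  have a1 := hg _ _ h1 e1 e2
  have a2 := hg _ _ h2 e3 e2
  rw [abs_le] at *
  constructor <;> linarith [a1.1, a1.2, a2.1, a2.2]

lemma lo_ground_b [Fact (1 < L)] (hL : 3 ≤ L) {g : Conf L q → ℝ} {ε : ℝ} (hg : Lo g ε) {a b : Fin q} (hab : a ≠ b) (y0 x0 : ZMod L) :
    |g (lowConf a b y0 0 x0 L) - g (groundConf L q b)| ≤ ε := by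
  refine hg _ _ (oneFlip_symm ?_) ?_ ?_
  · rw [low_end0 (by omega)]
    exact of_upd _ _ _ hab
  · exact (ham_end0 (by omega) a b y0 x0).trans (by omega)
  · rw [ham_ground]; omega

lemma lo_ground_a [Fact (1 < L)] (hL : 3 ≤ L) {g : Conf L q → ℝ} {ε : ℝ} (hg : Lo g ε) {a b : Fin q} (hab : a ≠ b) (y0 x0 : ZMod L) :
    |g (lowConf a b y0 (L - 1) x0 1) - g (groundConf L q a)| ≤ ε := by
  refine hg _ _ (oneFlip_symm ?_) ?_ ?_
  · rw [low_end1 (by omega)]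
    exact of_upd _ _ _ hab.symm
  · exact (ham_end1 (by omega) a b y0 x0).trans (by omega)
  · rw [ham_ground]; omega

lemma flip_m1 {a b : Fin q} (hab : a ≠ b) (y0 : ZMod L) (n : ℕ) (x0 : ZMod L) (p : ℕ) (hp : 2 ≤ p) (hpL : p ≤ L) :
    oneFlip (lowConf a b y0 n x0 p) (Function.update (lowConf a b y0 n x0 p) (st x0 y0 (p - 1) false) a) ∧
    oneFlip (lowConf a b y0 n x0 (p - 1)) (Function.update (lowConf a b y0 n x0 p) (st x0 y0 (p - 1) false) a) := by
  constructor
  · apply of_upd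
    rw [lowConf_st a b y0 n x0 p (by omega), if_pos (by simp; omega)]
    exact hab
  · rw [mid1 a b y0 n x0 p hp hpL]
    apply of_upd
    rw [lowConf_st a b y0 n x0 _ (by omega), if_neg (by simp; omega)]
    exact hab.symm

lemma lo_m1 [Fact (1 < L)] (hL : 3 ≤ L) {g : Conf L q → ℝ} {ε : ℝ} (hg : Lo g ε) {a b : Fin q} (hab : a ≠ b) (y0 : ZMod L) (n : ℕ)
    (hn : n = 0 ∨ n = L - 1) (x0 : ZMod L) (p : ℕ) (hp : 2 ≤ p) (hpL : p ≤ L) :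
    |g (lowConf a b y0 n x0 (p - 1)) - g (lowConf a b y0 n x0 p)| ≤ 2 * ε := by
  obtain ⟨f1, f2⟩ := flip_m1 hab y0 n x0 p hp hpL
  exact lo_two hg f2 f1 (ham_lc_le hL hab y0 n x0 _ (by omega) (by omega) (by omega))
    (ham_m1_low hL hab y0 n x0 p hn hp hpL) (ham_lc_le hL hab y0 n x0 _ (by omega) (by omega) (by omega))

lemma lo_plat [Fact (1 < L)] (hL : 3 ≤ L) {g : Conf L q → ℝ} {ε : ℝ} (hg : Lo g ε) {a b : Fin q} (hab : a ≠ b) (y0 : ZMod L) (n : ℕ)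
    (hn : n + 2 ≤ L) (x0 : ZMod L) :
    |g (lowConf a b y0 (n + 1) x0 L) - g (lowConf a b (y0 + 1) n x0 1)| ≤ 2 * ε := by
  refine lo_two hg (τ := Function.update (lowConf a b (y0 + 1) n x0 1) (st x0 (y0 + 1) 0 false) a) ?_ ?_
    (ham_lc_le hL hab _ _ x0 _ (by omega) (by omega) (by omega)) (ham_plateau hL hab _ n x0 hn)
    (ham_lc_le hL hab _ _ x0 _ (by omega) (by omega) (by omega))
  · rw [low_plateau (by omega) a b y0 n hn x0]
    apply of_upd
    rw [lowConf_st a b y0 _ x0 _ (by omega), if_neg (by simp; omega)]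
    exact hab.symm
  · apply of_upd
    rw [lowConf_st a b _ n x0 _ (by omega), if_pos (by simp)]
    exact hab

noncomputable def GG (g : Conf L q → ℝ) (a b : Fin q) (n p : ℕ) : ℝ :=
  ∑ z : ZMod L × ZMod L, g (lowConf a b z.1 n z.2 p)

lemma card_ZZ : (Finset.univ : Finset (ZMod L × ZMod L)).card = L ^ 2 := by
  rw [Finset.card_univ, Fintype.card_prod, ZMod.card, sq]

lemma sum_abs_bd (f f' : ZMod L × ZMod L → ℝ) {ε : ℝ} (h : ∀ z, |f z - f' z| ≤ ε) :
    |(∑ z, f z) - ∑ z, f' z| ≤ (L : ℝ) ^ 2 * ε := by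
  rw [← Finset.sum_sub_distrib]
  refine (Finset.abs_sum_le_sum_abs _ _).trans ((Finset.sum_le_sum fun z _ => h z).trans ?_)
  rw [Finset.sum_const, card_ZZ, nsmul_eq_mul]; push_cast; rfl

lemma GG_b [Fact (1 < L)] (hL : 3 ≤ L) {g : Conf L q → ℝ} {ε : ℝ} (hg : Lo g ε) {a b : Fin q} (hab : a ≠ b) :
    |GG g a b 0 L - (L : ℝ) ^ 2 * g (groundConf L q b)| ≤ (L : ℝ) ^ 2 * ε := by
  have := sum_abs_bd (fun z : ZMod L × ZMod L => g (lowConf a b z.1 0 z.2 L)) (fun _ => g (groundConf L q b))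
    (fun z => lo_ground_b hL hg hab z.1 z.2)
  rw [Finset.sum_const, card_ZZ, nsmul_eq_mul] at this
  push_cast at this
  exact this

lemma GG_a [Fact (1 < L)] (hL : 3 ≤ L) {g : Conf L q → ℝ} {ε : ℝ} (hg : Lo g ε) {a b : Fin q} (hab : a ≠ b) :
    |GG g a b (L - 1) 1 - (L : ℝ) ^ 2 * g (groundConf L q a)| ≤ (L : ℝ) ^ 2 * ε := by
  have := sum_abs_bd (fun z : ZMod L × ZMod L => g (lowConf a b z.1 (L - 1) z.2 1)) (fun _ => g (groundConf L q a))
    (fun z => lo_ground_a hL hg hab z.1 z.2)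
  rw [Finset.sum_const, card_ZZ, nsmul_eq_mul] at this
  push_cast at this
  exact this

lemma GG_plat [Fact (1 < L)] (hL : 3 ≤ L) {g : Conf L q → ℝ} {ε : ℝ} (hg : Lo g ε) {a b : Fin q} (hab : a ≠ b) (n : ℕ) (hn : n + 2 ≤ L) :
    |GG g a b (n + 1) L - GG g a b n 1| ≤ (L : ℝ) ^ 2 * (2 * ε) := by
  have e : GG g a b n 1 = ∑ z : ZMod L × ZMod L, g (lowConf a b (z.1 + 1) n z.2 1) := by
    unfold GG
    rw [Fintype.sum_prod_type, Fintype.sum_prod_type]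
    exact (Equiv.sum_comp (Equiv.addRight (1 : ZMod L)) (fun y => ∑ x, g (lowConf a b y n x 1))).symm
  rw [e]
  exact sum_abs_bd _ _ (fun z => lo_plat hL hg hab z.1 n hn z.2)

lemma GG_m1 [Fact (1 < L)] (hL : 3 ≤ L) {g : Conf L q → ℝ} {ε : ℝ} (hg : Lo g ε) {a b : Fin q} (hab : a ≠ b) (n : ℕ)
    (hn : n = 0 ∨ n = L - 1) (p : ℕ) (hp : 2 ≤ p) (hpL : p ≤ L) :
    |GG g a b n (p - 1) - GG g a b n p| ≤ (L : ℝ) ^ 2 * (2 * ε) :=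
  sum_abs_bd _ _ (fun z => lo_m1 hL hg hab z.1 n hn z.2 p hp hpL)

lemma GG_tele (g : Conf L q → ℝ) (a b : Fin q) (n : ℕ) (M : ℕ) (hM : 1 ≤ M) :
    ∑ p ∈ Finset.Icc 2 M, (GG g a b n (p - 1) - GG g a b n p) = GG g a b n 1 - GG g a b n M := by
  induction M, hM using Nat.le_induction with
  | base => simp
  | succ M hM ih =>
    rw [Finset.sum_Icc_succ_top (by omega), ih, Nat.add_sub_cancel]; ring

lemma tele2 (u v : ℕ → ℝ) (M : ℕ) :
    ∑ n ∈ Finset.range (M + 1), (u n - v n) + ∑ n ∈ Finset.range M, (v (n + 1) - u n) = u M - v 0 := by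
  induction M with
  | zero => simp
  | succ M ih => rw [Finset.sum_range_succ, Finset.sum_range_succ (fun n => v (n + 1) - u n)]; linarith

lemma GG_end [Fact (1 < L)] (hL : 3 ≤ L) {g : Conf L q → ℝ} {ε : ℝ} (hg : Lo g ε) {a b : Fin q} (hab : a ≠ b) (n : ℕ)
    (hn : n = 0 ∨ n = L - 1) : |GG g a b n 1 - GG g a b n L| ≤ ((L : ℝ) - 1) * ((L : ℝ) ^ 2 * (2 * ε)) := by
  rw [← GG_tele g a b n L (by omega)]
  refine (Finset.abs_sum_le_sum_abs _ _).trans ?_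
  refine (Finset.sum_le_sum (g := fun _ => (L : ℝ) ^ 2 * (2 * ε)) fun p hp => ?_).trans ?_
  · rw [Finset.mem_Icc] at hp
    exact GG_m1 hL hg hab n hn p hp.1 hp.2
  · rw [Finset.sum_const, Nat.card_Icc, nsmul_eq_mul, show L + 1 - 2 = L - 1 by omega, Nat.cast_sub (by omega)]; simp

lemma GG_main [Fact (1 < L)] (hL : 3 ≤ L) {g : Conf L q → ℝ} {ε : ℝ} (hε : 0 ≤ ε) (hg : Lo g ε) {a b : Fin q} (hab : a ≠ b)
    (h1 : g (groundConf L q a) - g (groundConf L q b) = 1) :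
    (L : ℝ) ^ 2 * (1 - 6 * L * ε) ≤
      ∑ n ∈ Finset.Icc 1 (L - 2), ∑ p ∈ Finset.Icc 2 L, (GG g a b n (p - 1) - GG g a b n p) := by
  obtain ⟨M, rfl⟩ : ∃ M, L = M + 3 := ⟨L - 3, by omega⟩
  rw [Finset.sum_congr rfl fun n _ => GG_tele g a b n (M + 3) (by omega)]
  have t := tele2 (fun n => GG g a b n 1) (fun n => GG g a b n (M + 3)) (M + 2)
  rw [Finset.sum_range_succ, Finset.sum_range_succ'] at t
  have e : ∑ n ∈ Finset.Icc 1 (M + 3 - 2), (GG g a b n 1 - GG g a b n (M + 3)) =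
      ∑ n ∈ Finset.range (M + 1), (GG g a b (n + 1) 1 - GG g a b (n + 1) (M + 3)) := by
    rw [Finset.range_eq_Ico, Finset.sum_Ico_add' (fun n => GG g a b n 1 - GG g a b n (M + 3)) 0 (M + 1) 1]
    rfl
  rw [e]
  have b1 := abs_le.1 (GG_b hL hg hab)
  have b2 := abs_le.1 (GG_a hL hg hab)
  have b3 := abs_le.1 (GG_end hL hg hab 0 (Or.inl rfl))
  have b4 := abs_le.1 (GG_end hL hg hab (M + 3 - 1) (Or.inr rfl))
  have b5 : |∑ n ∈ Finset.range (M + 2), (GG g a b (n + 1) (M + 3) - GG g a b n 1)| ≤ ((M : ℝ) + 2) * ((((M + 3 : ℕ) : ℝ)) ^ 2 * (2 * ε)) := by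
    refine (Finset.abs_sum_le_sum_abs _ _).trans ?_
    refine (Finset.sum_le_sum (g := fun _ => (((M + 3 : ℕ) : ℝ)) ^ 2 * (2 * ε)) fun n hn => ?_).trans ?_
    · rw [Finset.mem_range] at hn
      exact GG_plat hL hg hab n (by omega)
    · rw [Finset.sum_const, Finset.card_range, nsmul_eq_mul]; push_cast; rfl
  have b5 := abs_le.1 b5
  rw [show M + 3 - 1 = M + 2 by omega] at b2 b4
  have hsq : 0 ≤ ((M + 3 : ℕ) : ℝ) ^ 2 * ε := by positivity
  set W := ((M + 3 : ℕ) : ℝ) ^ 2 with hW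
  have hWe : W * (g (groundConf (M + 3) q a)) - W * (g (groundConf (M + 3) q b)) = W := by rw [← mul_sub, h1, mul_one]
  have hc : ((M + 3 : ℕ) : ℝ) = M + 3 := by push_cast; rfl
  rw [hc] at b3 b4 ⊢
  have expand : W * (1 - 6 * ((M : ℝ) + 3) * ε) = W - 6 * ((M : ℝ) + 3) * (W * ε) := by ring
  have z3 : ((M : ℝ) + 3 - 1) * (W * (2 * ε)) = (2 * M + 4) * (W * ε) := by ring
  have z5 : ((M : ℝ) + 2) * (W * (2 * ε)) = (2 * M + 4) * (W * ε) := by ring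
  rw [z3] at b3 b4
  rw [z5] at b5
  rw [expand]
  have := mul_nonneg (Nat.cast_nonneg (α := ℝ) M) hsq
  beta_reduce at t
  linarith [b1.1, b1.2, b2.1, b2.2, b3.1, b3.2, b4.1, b4.2, b5.1, b5.2]

end P15

section P16
variable {L q : ℕ} [NeZero L]

lemma cs_one {Z : Type*} [Fintype Z] (A B M N : Z → ℝ) (h : ∑ z, M z = ∑ z, N z) :
    ((∑ z, B z) - ∑ z, A z) ^ 2 ≤ 2 * (Fintype.card Z : ℝ) * ∑ z, ((M z - A z) ^ 2 + (N z - B z) ^ 2) := by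
  have e : (∑ z, B z) - ∑ z, A z = ∑ z, ((M z - A z) - (N z - B z)) := by
    simp only [Finset.sum_sub_distrib]; linarith
  rw [e]
  refine (sq_sum_le_card_mul_sum_sq (s := Finset.univ) (f := fun z => (M z - A z) - (N z - B z))).trans ?_
  rw [Finset.card_univ, mul_comm (2 : ℝ), mul_assoc, Finset.mul_sum _ _ (2 : ℝ)]
  refine mul_le_mul_of_nonneg_left (Finset.sum_le_sum fun z _ => ?_) (Nat.cast_nonneg (α := ℝ) (Fintype.card Z))
  nlinarith [sq_nonneg ((M z - A z) + (N z - B z))]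

lemma cs_four {Z : Type*} [Fintype Z] (A B M1 M2 M3 M4 N1 N2 N3 N4 : Z → ℝ) (h1 : ∑ z, M1 z = ∑ z, N1 z)
    (h2 : ∑ z, M2 z = ∑ z, N2 z) (h3 : ∑ z, M3 z = ∑ z, N3 z) (h4 : ∑ z, M4 z = ∑ z, N4 z) :
    ((∑ z, B z) - ∑ z, A z) ^ 2 ≤ 1 / 2 * (Fintype.card Z : ℝ) *
      ∑ z, (((M1 z - A z) ^ 2 + (M2 z - A z) ^ 2 + (M3 z - A z) ^ 2 + (M4 z - A z) ^ 2) +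
        ((N1 z - B z) ^ 2 + (N2 z - B z) ^ 2 + (N3 z - B z) ^ 2 + (N4 z - B z) ^ 2)) := by
  have e : (∑ z, B z) - ∑ z, A z = 1 / 4 * ∑ z, (((M1 z - A z) - (N1 z - B z)) + ((M2 z - A z) - (N2 z - B z)) +
      ((M3 z - A z) - (N3 z - B z)) + ((M4 z - A z) - (N4 z - B z))) := by
    simp only [Finset.sum_sub_distrib, Finset.sum_add_distrib]; linarith
  rw [e, mul_pow]
  have := (sq_sum_le_card_mul_sum_sq (s := Finset.univ) (f := fun z => ((M1 z - A z) - (N1 z - B z)) + ((M2 z - A z) - (N2 z - B z)) +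
      ((M3 z - A z) - (N3 z - B z)) + ((M4 z - A z) - (N4 z - B z))))
  rw [Finset.card_univ] at this
  refine (mul_le_mul_of_nonneg_left this (by positivity)).trans ?_
  rw [mul_left_comm, mul_comm (1 / 2 : ℝ), mul_assoc]
  refine mul_le_mul_of_nonneg_left ?_ (Nat.cast_nonneg _)
  rw [Finset.mul_sum, Finset.mul_sum]
  refine Finset.sum_le_sum fun z _ => ?_
  generalize M1 z - A z = a1
  generalize M2 z - A z = a2
  generalize M3 z - A z = a3
  generalize M4 z - A z = a4
  generalize N1 z - B z = b1
  generalize N2 z - B z = b2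
  generalize N3 z - B z = b3
  generalize N4 z - B z = b4
  have q2 : ∀ x y : ℝ, (x + y) ^ 2 ≤ 2 * (x ^ 2 + y ^ 2) := fun x y => by nlinarith [sq_nonneg (x - y)]
  have q2' : ∀ x y : ℝ, (x - y) ^ 2 ≤ 2 * (x ^ 2 + y ^ 2) := fun x y => by nlinarith [sq_nonneg (x + y)]
  have r1 := q2 (a1 - b1 + (a2 - b2)) (a3 - b3 + (a4 - b4))
  rw [← add_assoc] at r1
  linarith [q2 (a1 - b1) (a2 - b2), q2 (a3 - b3) (a4 - b4), q2' a1 b1, q2' a2 b2, q2' a3 b3, q2' a4 b4]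

/-- squared increment -/
noncomputable def dq (g : Conf L q → ℝ) (ζ : Conf L q) (s : Site L) (c : Fin q) : ℝ := (g (Function.update ζ s c) - g ζ) ^ 2

noncomputable def ES (g : Conf L q → ℝ) (a b : Fin q) (n p : ℕ) (z : ZMod L × ZMod L) : ℝ :=
  if p = 2 ∨ p = L then dq g (lowConf a b z.1 n z.2 p) (st z.2 z.1 (p - 1) false) a else
    dq g (lowConf a b z.1 n z.2 p) (st z.2 z.1 (p - 1) false) a + dq g (lowConf a b z.1 n z.2 p) (st z.2 z.1 (p - 2) true) a +
    dq g (lowConf a b z.1 n z.2 p) (st z.2 z.1 0 false) a + dq g (lowConf a b z.1 n z.2 p) (st z.2 z.1 0 true) a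

noncomputable def EG (g : Conf L q → ℝ) (a b : Fin q) (n p : ℕ) (z : ZMod L × ZMod L) : ℝ :=
  if p = 1 ∨ p + 1 = L then dq g (lowConf a b z.1 n z.2 p) (st z.2 z.1 (p - 1) true) b else
    dq g (lowConf a b z.1 n z.2 p) (st z.2 z.1 (p - 1) true) b + dq g (lowConf a b z.1 n z.2 p) (st z.2 z.1 p false) b +
    dq g (lowConf a b z.1 n z.2 p) (st z.2 z.1 (L - 1) true) b + dq g (lowConf a b z.1 n z.2 p) (st z.2 z.1 (L - 1) false) b

noncomputable def cp (L p : ℕ) : ℝ := if p = 2 ∨ p = L then 2 else 1 / 2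

lemma shift_sum (f : ZMod L × ZMod L → ℝ) : ∑ z : ZMod L × ZMod L, f (z.1, z.2 + 1) = ∑ z, f z := by
  rw [Fintype.sum_prod_type, Fintype.sum_prod_type]
  refine Finset.sum_congr rfl fun y _ => ?_
  exact Equiv.sum_comp (Equiv.addRight (1 : ZMod L)) (fun x => f (y, x))

lemma step_bound (g : Conf L q → ℝ) (a b : Fin q) (n p : ℕ) (hp : 2 ≤ p) (hpL : p ≤ L) :
    (GG g a b n (p - 1) - GG g a b n p) ^ 2 ≤ (cp L p * (L : ℝ) ^ 2) * ∑ z, (ES g a b n p z + EG g a b n (p - 1) z) := by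
  have hc : (Fintype.card (ZMod L × ZMod L) : ℝ) = (L : ℝ) ^ 2 := by
    rw [← Finset.card_univ, card_ZZ]; push_cast; rfl
  by_cases h : p = 2 ∨ p = L
  · have h' : p - 1 = 1 ∨ p - 1 + 1 = L := by omega
    simp only [ES, EG, cp, if_pos h, if_pos h']
    rw [← hc]
    refine cs_one (fun z : ZMod L × ZMod L => g (lowConf a b z.1 n z.2 p)) (fun z => g (lowConf a b z.1 n z.2 (p - 1))) _ _ ?_
    refine Finset.sum_congr rfl fun z _ => ?_
    rw [mid1 a b z.1 n z.2 p hp hpL]; rfl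
  · have h' : ¬ (p - 1 = 1 ∨ p - 1 + 1 = L) := by omega
    simp only [ES, EG, cp, if_neg h, if_neg h']
    rw [← hc]
    refine cs_four (fun z : ZMod L × ZMod L => g (lowConf a b z.1 n z.2 p)) (fun z => g (lowConf a b z.1 n z.2 (p - 1))) _ _ _ _ _ _ _ _ ?_ ?_ ?_ ?_
    · refine Finset.sum_congr rfl fun z _ => ?_
      rw [mid1 a b z.1 n z.2 p hp hpL]; rfl
    · refine Finset.sum_congr rfl fun z _ => ?_
      rw [mid2 a b z.1 n z.2 p hp hpL]
    · rw [← shift_sum (fun z : ZMod L × ZMod L => g (Function.update (lowConf a b z.1 n z.2 (p - 1)) (st z.2 z.1 (L - 1) true) b))]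
      refine Finset.sum_congr rfl fun z _ => ?_
      rw [mid3 a b z.1 n z.2 p hp hpL]
    · rw [← shift_sum (fun z : ZMod L × ZMod L => g (Function.update (lowConf a b z.1 n z.2 (p - 1)) (st z.2 z.1 (L - 1) false) b))]
      refine Finset.sum_congr rfl fun z _ => ?_
      rw [mid4 a b z.1 n z.2 p hp hpL]

lemma cp_nonneg (L p : ℕ) : 0 ≤ cp L p := by unfold cp; split_ifs <;> norm_num

lemma cp_sum (hL : 3 ≤ L) : ∑ p ∈ Finset.Icc 2 L, cp L p ≤ (L : ℝ) / 2 + 4 := by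
  have h : ∀ p ∈ Finset.Icc 2 L, cp L p ≤ 1 / 2 + ((if p = 2 then 3 / 2 else 0) + (if p = L then 3 / 2 else 0) : ℝ) := by
    intro p _
    unfold cp
    split_ifs <;> first | (exfalso; omega) | norm_num
  refine (Finset.sum_le_sum h).trans ?_
  rw [Finset.sum_add_distrib, Finset.sum_add_distrib, Finset.sum_ite_eq', Finset.sum_ite_eq', Finset.sum_const, Nat.card_Icc,
    if_pos (by simp; omega), if_pos (by simp; omega), nsmul_eq_mul, show L + 1 - 2 = L - 1 by omega, Nat.cast_sub (by omega)]
  push_cast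
  linarith

lemma es_nonneg (g : Conf L q → ℝ) (a b : Fin q) (n p : ℕ) (z : ZMod L × ZMod L) : 0 ≤ ES g a b n p z := by
  unfold ES dq; split_ifs <;> positivity

lemma eg_nonneg (g : Conf L q → ℝ) (a b : Fin q) (n p : ℕ) (z : ZMod L × ZMod L) : 0 ≤ EG g a b n p z := by
  unfold EG dq; split_ifs <;> positivity

noncomputable def Tot (g : Conf L q → ℝ) (a b : Fin q) (n p : ℕ) (z : ZMod L × ZMod L) : ℝ :=
  (if 2 ≤ p then ES g a b n p z else 0) + (if p + 1 ≤ L then EG g a b n p z else 0)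

lemma tot_sum (hL : 3 ≤ L) (g : Conf L q → ℝ) (a b : Fin q) (n : ℕ) (z : ZMod L × ZMod L) :
    ∑ p ∈ Finset.Icc 2 L, (ES g a b n p z + EG g a b n (p - 1) z) = ∑ p ∈ Finset.Icc 1 L, Tot g a b n p z := by
  obtain ⟨M, rfl⟩ : ∃ M, L = M + 1 := ⟨L - 1, by omega⟩
  unfold Tot
  rw [Finset.sum_add_distrib, Finset.sum_add_distrib, ← Finset.sum_filter, ← Finset.sum_filter]
  congr 1
  · refine Finset.sum_congr ?_ fun _ _ => rfl
    ext p; simp; omega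
  · have : Finset.filter (fun p => p + 1 ≤ M + 1) (Finset.Icc 1 (M + 1)) = Finset.Ico 1 (M + 1) := by
      ext p; simp; omega
    rw [this]
    have e := Finset.sum_Ico_add' (fun p => EG g a b n (p - 1) z) 1 (M + 1) 1
    simp only [Nat.add_sub_cancel] at e
    rw [e]; rfl

lemma kappa_bound [Fact (1 < L)] (hL : 3 ≤ L) {g : Conf L q → ℝ} {ε : ℝ} (hε : 0 ≤ ε) (hε2 : 6 * L * ε ≤ 1) (hg : Lo g ε) {a b : Fin q}
    (hab : a ≠ b) (h1 : g (groundConf L q a) - g (groundConf L q b) = 1) :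
    (1 - 6 * L * ε) ^ 2 ≤ (1 / 2 + 4 / L) *
      ∑ n ∈ Finset.Icc 1 (L - 2), ∑ z, ∑ p ∈ Finset.Icc 1 L, Tot g a b n p z := by
  have hm := GG_main hL hε hg hab h1
  rw [← Finset.sum_product'] at hm
  have cs := Finset.sum_sq_le_sum_mul_sum_of_sq_le_mul (Finset.Icc 1 (L - 2) ×ˢ Finset.Icc 2 L)
    (r := fun k : ℕ × ℕ => GG g a b k.1 (k.2 - 1) - GG g a b k.1 k.2) (f := fun k => cp L k.2 * (L : ℝ) ^ 2)
    (g := fun k => ∑ z, (ES g a b k.1 k.2 z + EG g a b k.1 (k.2 - 1) z))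
    (fun k _ => mul_nonneg (cp_nonneg _ _) (by positivity))
    (fun k _ => Finset.sum_nonneg fun z _ => add_nonneg (es_nonneg _ _ _ _ _ _) (eg_nonneg _ _ _ _ _ _))
    (fun k hk => by
      simp only [Finset.mem_product, Finset.mem_Icc] at hk
      exact step_bound g a b k.1 k.2 hk.2.1 hk.2.2)
  have e1 : ∑ k ∈ Finset.Icc 1 (L - 2) ×ˢ Finset.Icc 2 L, ∑ z, (ES g a b k.1 k.2 z + EG g a b k.1 (k.2 - 1) z) =
      ∑ n ∈ Finset.Icc 1 (L - 2), ∑ z, ∑ p ∈ Finset.Icc 1 L, Tot g a b n p z := by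
    rw [Finset.sum_product]
    refine Finset.sum_congr rfl fun n _ => ?_
    rw [Finset.sum_comm]
    exact Finset.sum_congr rfl fun z _ => tot_sum hL g a b n z
  rw [e1] at cs
  set Q := ∑ n ∈ Finset.Icc 1 (L - 2), ∑ z, ∑ p ∈ Finset.Icc 1 L, Tot g a b n p z with hQ
  have hQ0 : 0 ≤ Q := by
    rw [← e1]
    exact Finset.sum_nonneg fun k _ => Finset.sum_nonneg fun z _ => add_nonneg (es_nonneg _ _ _ _ _ _) (eg_nonneg _ _ _ _ _ _)
  have hLp : (3 : ℝ) ≤ L := by exact_mod_cast hL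
  have e2 : ∑ k ∈ Finset.Icc 1 (L - 2) ×ˢ Finset.Icc 2 L, cp L k.2 * (L : ℝ) ^ 2 ≤ (L : ℝ) ^ 4 * (1 / 2 + 4 / L) := by
    rw [Finset.sum_product]
    simp only
    rw [Finset.sum_const, Nat.card_Icc, nsmul_eq_mul, ← Finset.sum_mul]
    have c1 := cp_sum hL
    have c2 : ((L - 2 + 1 - 1 : ℕ) : ℝ) ≤ L := by exact_mod_cast (by omega : L - 2 + 1 - 1 ≤ L)
    calc _ ≤ (L : ℝ) * (((L : ℝ) / 2 + 4) * (L : ℝ) ^ 2) := by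
          gcongr
          exact mul_nonneg (Finset.sum_nonneg fun p _ => cp_nonneg L p) (by positivity)
      _ = _ := by field_simp
  have c3 : 0 ≤ (L : ℝ) ^ 2 * (1 - 6 * L * ε) := by apply mul_nonneg; positivity; linarith
  have c4 := (pow_le_pow_left₀ c3 hm 2).trans (cs.trans (mul_le_mul_of_nonneg_right e2 hQ0))
  have c5 : (0 : ℝ) < (L : ℝ) ^ 4 := by positivity
  have c6 : (L : ℝ) ^ 4 * (1 - 6 * L * ε) ^ 2 ≤ (L : ℝ) ^ 4 * ((1 / 2 + 4 / L) * Q) := by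
    calc _ = ((L : ℝ) ^ 2 * (1 - 6 * L * ε)) ^ 2 := by ring
      _ ≤ _ := c4
      _ = _ := by ring
  exact le_of_mul_le_mul_left c6 c5

end P16

section P17
variable {L q : ℕ} [NeZero L]

noncomputable def NNe (g : Conf L q → ℝ) (ζ : Conf L q) : ℝ :=
  ∑ σ : Conf L q, if oneFlip ζ σ ∧ Ham L q σ = 2 * L + 2 then (g σ - g ζ) ^ 2 else 0

noncomputable def ww (g : Conf L q → ℝ) (ζ : Conf L q) (s : Site L) (c : Fin q) : ℝ :=
  if c ≠ ζ s ∧ Ham L q (Function.update ζ s c) = 2 * L + 2 then dq g ζ s c else 0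

lemma ww_nonneg (g : Conf L q → ℝ) (ζ : Conf L q) (s : Site L) (c : Fin q) : 0 ≤ ww g ζ s c := by
  unfold ww dq; split_ifs <;> positivity

lemma ww_eq (g : Conf L q → ℝ) (ζ : Conf L q) (s : Site L) (c : Fin q) (h : c ≠ ζ s)
    (h2 : Ham L q (Function.update ζ s c) = 2 * L + 2) : dq g ζ s c = ww g ζ s c := by
  unfold ww; rw [if_pos ⟨h, h2⟩]

lemma nn_ge (g : Conf L q → ℝ) (ζ : Conf L q) {a b : Fin q} (hab : a ≠ b) :
    ∑ s, ww g ζ s a + ∑ s, ww g ζ s b ≤ NNe g ζ := by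
  have h1 : ∑ s, ww g ζ s a + ∑ s, ww g ζ s b ≤ ∑ s, ∑ c, ww g ζ s c := by
    rw [← Finset.sum_add_distrib]
    refine Finset.sum_le_sum fun s _ => ?_
    rw [← Finset.sum_pair (f := fun c => ww g ζ s c) hab]
    exact Finset.sum_le_univ_sum_of_nonneg fun c => ww_nonneg _ _ _ _
  refine h1.trans ?_
  rw [← Fintype.sum_prod_type']
  unfold ww NNe
  rw [← Finset.sum_filter, ← Finset.sum_filter]
  have hinj : Set.InjOn (fun k : Site L × Fin q => Function.update ζ k.1 k.2)
      ((Finset.univ.filter fun k : Site L × Fin q => k.2 ≠ ζ k.1 ∧ Ham L q (Function.update ζ k.1 k.2) = 2 * L + 2 : Finset _) : Set (Site L × Fin q)) := by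
    rintro ⟨s, c⟩ h ⟨s', c'⟩ h' e
    simp only [Finset.coe_filter, Finset.mem_univ, true_and, Set.mem_setOf_eq] at h h' e
    have e1 := congrFun e s
    rw [Function.update_self, Function.update_apply] at e1
    by_cases hs : s = s'
    · rw [if_pos hs] at e1; rw [hs, e1]
    · rw [if_neg hs] at e1; exact absurd e1 h.1
  have e := Finset.sum_image (f := fun σ : Conf L q => (g σ - g ζ) ^ 2) hinj
  refine le_trans (le_of_eq e.symm) ?_
  refine Finset.sum_le_sum_of_subset_of_nonneg ?_ (fun _ _ _ => by positivity)
  intro σ hσ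
  simp only [Finset.mem_image, Finset.mem_filter, Finset.mem_univ, true_and] at hσ ⊢
  obtain ⟨k, hk, rfl⟩ := hσ
  exact ⟨of_upd _ _ _ hk.1, hk.2⟩

lemma four_le {ι : Type*} [Fintype ι] (w : ι → ℝ) (hw : ∀ i, 0 ≤ w i) {i j k l : ι} (h1 : i ≠ j) (h2 : i ≠ k) (h3 : i ≠ l)
    (h4 : j ≠ k) (h5 : j ≠ l) (h6 : k ≠ l) : w i + w j + w k + w l ≤ ∑ x, w x := by
  have : ∑ x ∈ ({i, j, k, l} : Finset ι), w x = w i + w j + w k + w l := by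
    rw [Finset.sum_insert (by simp [*]), Finset.sum_insert (by simp [*]), Finset.sum_pair h6]; ring
  rw [← this]
  exact Finset.sum_le_univ_sum_of_nonneg hw

lemma one_le_sum {ι : Type*} [Fintype ι] (w : ι → ℝ) (hw : ∀ i, 0 ≤ w i) (i : ι) : w i ≤ ∑ x, w x :=
  Finset.single_le_sum (fun i _ => hw i) (Finset.mem_univ i)

lemma st_ne (x0 y0 : ZMod L) {i k : ℕ} (hi : i < L) (hk : k < L) {c c' : Bool} (h : i ≠ k ∨ c ≠ c') :
    st x0 y0 i c ≠ st x0 y0 k c' := by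
  intro e
  have := st_inj x0 y0 hi hk e
  tauto

lemma es_le [Fact (1 < L)] (hL : 3 ≤ L) (g : Conf L q → ℝ) {a b : Fin q} (hab : a ≠ b) (n p : ℕ) (hn : 1 ≤ n) (hn2 : n + 2 ≤ L)
    (hp : 2 ≤ p) (hpL : p ≤ L) (z : ZMod L × ZMod L) : ES g a b n p z ≤ ∑ s, ww g (lowConf a b z.1 n z.2 p) s a := by
  obtain ⟨m1, m2, m3, m4⟩ := ham_shrink hL hab z.1 n z.2 p hn hn2 hp hpL
  have k : ∀ i c, i < L → i + c.toNat < p → a ≠ lowConf a b z.1 n z.2 p (st z.2 z.1 i c) := by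
    intro i c hi hc
    rw [lowConf_st a b z.1 n z.2 p hi, if_pos hc]; exact hab
  have w1 := ww_eq g _ _ _ (k (p - 1) false (by omega) (by simp; omega)) m1
  have w2 := ww_eq g _ _ _ (k (p - 2) true (by omega) (by simp; omega)) m2
  have w3 := ww_eq g _ _ _ (k 0 false (by omega) (by simp; omega)) m3
  have w4 := ww_eq g _ _ _ (k 0 true (by omega) (by simp; omega)) m4
  unfold ES
  split_ifs with h
  · rw [w1]; exact one_le_sum _ (fun s => ww_nonneg _ _ s _) _
  · rw [w1, w2, w3, w4]
    refine four_le _ (fun s => ww_nonneg _ _ s _) ?_ ?_ ?_ ?_ ?_ ?_ <;> apply st_ne <;> first | omega | simp | (left; omega)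

lemma eg_le [Fact (1 < L)] (hL : 3 ≤ L) (g : Conf L q → ℝ) {a b : Fin q} (hab : a ≠ b) (n p : ℕ) (hn : 1 ≤ n) (hn2 : n + 2 ≤ L)
    (hp : 1 ≤ p) (hpL : p + 1 ≤ L) (z : ZMod L × ZMod L) : EG g a b n p z ≤ ∑ s, ww g (lowConf a b z.1 n z.2 p) s b := by
  obtain ⟨m1, m2, -, -⟩ := ham_shrink hL hab z.1 n z.2 (p + 1) hn hn2 (by omega) hpL
  obtain ⟨-, -, m3, m4⟩ := ham_shrink hL hab z.1 n (z.2 - 1) (p + 1) hn hn2 (by omega) hpL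
  rw [mid1 a b z.1 n z.2 (p + 1) (by omega) hpL] at m1
  rw [mid2 a b z.1 n z.2 (p + 1) (by omega) hpL] at m2
  rw [mid3 a b z.1 n (z.2 - 1) (p + 1) (by omega) hpL, sub_add_cancel] at m3
  rw [mid4 a b z.1 n (z.2 - 1) (p + 1) (by omega) hpL, sub_add_cancel] at m4
  rw [Nat.add_sub_cancel] at m1 m2 m3 m4
  rw [show p + 1 - 2 = p - 1 by omega] at m1
  have k : ∀ i c, i < L → ¬ i + c.toNat < p → b ≠ lowConf a b z.1 n z.2 p (st z.2 z.1 i c) := by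
    intro i c hi hc
    rw [lowConf_st a b z.1 n z.2 p hi, if_neg hc]; exact hab.symm
  have w1 := ww_eq g _ _ _ (k (p - 1) true (by omega) (by simp; omega)) m1
  have w2 := ww_eq g _ _ _ (k p false (by omega) (by simp)) m2
  have w3 := ww_eq g _ _ _ (k (L - 1) true (by omega) (by simp; omega)) m3
  have w4 := ww_eq g _ _ _ (k (L - 1) false (by omega) (by simp; omega)) m4
  unfold EG
  split_ifs with h
  · rw [w1]; exact one_le_sum _ (fun s => ww_nonneg _ _ s _) _
  · rw [w1, w2, w3, w4]
    refine four_le _ (fun s => ww_nonneg _ _ s _) ?_ ?_ ?_ ?_ ?_ ?_ <;> apply st_ne <;> first | omega | simp | (left; omega)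

lemma sum_ww_nonneg (g : Conf L q → ℝ) (ζ : Conf L q) (c : Fin q) : 0 ≤ ∑ s, ww g ζ s c :=
  Finset.sum_nonneg fun s _ => ww_nonneg _ _ _ _

lemma tot_le [Fact (1 < L)] (hL : 3 ≤ L) (g : Conf L q → ℝ) {a b : Fin q} (hab : a ≠ b) (n p : ℕ) (hn : 1 ≤ n) (hn2 : n + 2 ≤ L)
    (hp : 1 ≤ p) (hpL : p ≤ L) (z : ZMod L × ZMod L) : Tot g a b n p z ≤ NNe g (lowConf a b z.1 n z.2 p) := by
  refine le_trans ?_ (nn_ge g _ hab)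
  unfold Tot
  refine add_le_add ?_ ?_
  · split_ifs with h
    · exact es_le hL g hab n p hn hn2 h hpL z
    · exact sum_ww_nonneg _ _ _
  · split_ifs with h
    · exact eg_le hL g hab n p hn hn2 hp h z
    · exact sum_ww_nonneg _ _ _

/-- composition with a lattice symmetry -/
lemma nn_th [Fact (1 < L)] (h : Conf L q → ℝ) (d : Fin 3) (s : ℝ) (hs : s ^ 2 = 1) (ζ : Conf L q) :
    NNe (fun σ => s * h (σ ∘ th d)) ζ = NNe h (ζ ∘ th d) := by
  unfold NNe
  refine Fintype.sum_equiv (Equiv.arrowCongr (thE d) (Equiv.refl _)) _ _ fun σ => ?_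
  have e : (Equiv.arrowCongr (thE d) (Equiv.refl (Fin q))) σ = σ ∘ th d := rfl
  rw [e, oneFlip_th_iff, ham_th]
  have : (s * h (σ ∘ th d) - s * h (ζ ∘ th d)) ^ 2 = (h (σ ∘ th d) - h (ζ ∘ th d)) ^ 2 := by
    rw [← mul_sub, mul_pow, hs, one_mul]
  rw [this]

lemma lo_th [Fact (1 < L)] {h : Conf L q → ℝ} {ε : ℝ} (hh : Lo h ε) (d : Fin 3) (s : ℝ) (hs : |s| = 1) :
    Lo (fun σ => s * h (σ ∘ th d)) ε := by
  intro σ ζ hf h1 h2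
  rw [← mul_sub, abs_mul, hs, one_mul]
  exact hh _ _ (oneFlip_th d hf) (by rwa [ham_th]) (by rwa [ham_th])

/-- per direction and pair of spins -/
lemma kappa_bound' [Fact (1 < L)] (hL : 3 ≤ L) {h : Conf L q → ℝ} {ε : ℝ} (hε : 0 ≤ ε) (hε2 : 6 * L * ε ≤ 1) (hg : Lo h ε) {a b : Fin q}
    (hab : a ≠ b) (h1 : |h (groundConf L q a) - h (groundConf L q b)| = 1) (d : Fin 3) :
    (1 - 6 * L * ε) ^ 2 ≤ (1 / 2 + 4 / L) *
      ∑ n ∈ Finset.Icc 1 (L - 2), ∑ z : ZMod L × ZMod L, ∑ p ∈ Finset.Icc 1 L, NNe h (lowConf a b z.1 n z.2 p ∘ th d) := by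
  obtain ⟨s, hs, hs1⟩ : ∃ s : ℝ, |s| = 1 ∧ s * (h (groundConf L q a) - h (groundConf L q b)) = 1 := by
    refine ⟨h (groundConf L q a) - h (groundConf L q b), h1, ?_⟩
    rw [← abs_mul_abs_self, h1]; norm_num
  have hs2 : s ^ 2 = 1 := by rw [← sq_abs, hs]; norm_num
  have := kappa_bound (g := fun σ => s * h (σ ∘ th d)) hL hε hε2 (lo_th hg d s hs) hab (by
    rw [← mul_sub]; exact hs1)
  refine this.trans (mul_le_mul_of_nonneg_left ?_ (by positivity))
  refine Finset.sum_le_sum fun n hn => Finset.sum_le_sum fun z _ => Finset.sum_le_sum fun p hp => ?_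
  rw [Finset.mem_Icc] at hn hp
  rw [← nn_th h d s hs2]
  exact tot_le hL _ hab n p hn.1 (by omega) hp.1 hp.2 z

end P17

section P18
variable {L q : ℕ} [NeZero L]

lemma row_a (hL : 3 ≤ L) (a b : Fin q) (y0 : ZMod L) (n : ℕ) (x0 : ZMod L) (p : ℕ) (hn : 1 ≤ n) (v : Site L) (hv : v.1.2 = y0 + 1) :
    lowConf a b y0 n x0 p v = a := by
  obtain ⟨⟨x, y⟩, c⟩ := v
  simp only at hv
  have := lowConf_rowj a b y0 n x0 x p (j := 1) (by omega) (by omega) c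
  rw [Nat.cast_one, ← hv, if_pos hn] at this
  exact this

lemma row_b (hL : 3 ≤ L) (a b : Fin q) (y0 : ZMod L) (n : ℕ) (x0 : ZMod L) (p : ℕ) (hn : n + 2 ≤ L) (v : Site L) (hv : v.1.2 = y0 - 1) :
    lowConf a b y0 n x0 p v = b := by
  obtain ⟨⟨x, y⟩, c⟩ := v
  simp only at hv
  have := lowConf_rowj a b y0 n x0 x p (j := L - 1) (by omega) (by omega) c
  rw [← idx_pred, ← hv, if_neg (by omega)] at this
  exact this

lemma row_meet [Fact (1 < L)] {d d' : Fin 3} (h : d ≠ d') (y y' : ZMod L) :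
    ∃ v : Site L, (th d v).1.2 = y ∧ (th d' v).1.2 = y' := by
  obtain ⟨u, -, -, h1, -, h2, -⟩ := strip_meet h (th d (((0 : ZMod L), y), false)) (th d' (((0 : ZMod L), y'), false))
  have key : ∀ (d : Fin 3) (y : ZMod L), sidx d u = sidx d (th d (((0 : ZMod L), y), false)) → (th d u).1.2 = y := by
    intro d y h
    have hd : tp d d = 0 := by fin_cases d <;> rfl
    have := (sidx_th d d u (th d (((0 : ZMod L), y), false))).2 h
    rw [hd, th_th] at this
    exact this
  exact ⟨u, key d y h1, key d' y' h2⟩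

lemma inj_dir [Fact (1 < L)] (hL : 3 ≤ L) {a b a' b' : Fin q} (hab : a ≠ b) {y0 y0' x0 x0' : ZMod L} {n n' p p' : ℕ}
    (hn : 1 ≤ n) (hn2 : n + 2 ≤ L) (hn' : 1 ≤ n') {d d' : Fin 3}
    (h : lowConf a b y0 n x0 p ∘ th d = lowConf a' b' y0' n' x0' p' ∘ th d') : d = d' := by
  by_contra hd
  obtain ⟨v, h1, h2⟩ := row_meet hd (y0 + 1) (y0' + 1)
  obtain ⟨w, h3, h4⟩ := row_meet hd (y0 - 1) (y0' + 1)
  have e1 := congrFun h v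
  have e2 := congrFun h w
  simp only [Function.comp] at e1 e2
  rw [row_a hL a b y0 n x0 p hn _ h1, row_a hL a' b' y0' n' x0' p' hn' _ h2] at e1
  rw [row_b hL a b y0 n x0 p hn2 _ h3, row_a hL a' b' y0' n' x0' p' hn' _ h4] at e2
  exact hab (e1.trans e2.symm)

lemma inj_y {a b a' b' : Fin q} (hab' : a' ≠ b') {y0 y0' x0 x0' : ZMod L} {n n' p p' : ℕ}
    (hp' : 1 ≤ p') (hpL' : p' ≤ L) (h : lowConf a b y0 n x0 p = lowConf a' b' y0' n' x0' p') : y0 = y0' := by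
  by_contra hne
  obtain ⟨j, hj, hy⟩ := exists_idx y0' y0
  have hj0 : j ≠ 0 := by
    rintro rfl
    apply hne; rw [hy]; simp
  have hL0 : 0 < L := Nat.pos_of_ne_zero (NeZero.ne L)
  have e1 := congrFun h (st x0' y0' 0 false)
  have e2 := congrFun h (st x0' y0' (L - 1) true)
  rw [lowConf_st a' b' y0' n' x0' p' (by omega), if_pos (by simp; omega)] at e1
  rw [lowConf_st a' b' y0' n' x0' p' (by omega), if_neg (by simp; omega)] at e2
  rw [hy] at e1 e2
  unfold st at e1 e2
  rw [lowConf_rowj a b y0 n x0 _ p hj hj0] at e1 e2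
  exact hab' (e2.symm.trans e1)

lemma inj_n {a b : Fin q} (hab : a ≠ b) {y0 x0 x0' : ZMod L} {n n' p p' : ℕ} (hn' : n' + 2 ≤ L)
    (h : lowConf a b y0 n x0 p = lowConf a b y0 n' x0' p') : n' ≤ n := by
  by_contra hlt
  have e1 := congrFun h ((x0, y0 + ((n + 1 : ℕ) : ZMod L)), false)
  rw [lowConf_rowj a b y0 n x0 _ p (by omega) (by omega), lowConf_rowj a b y0 n' x0' _ p' (by omega) (by omega),
    if_neg (by omega), if_pos (by omega)] at e1
  exact hab e1.symm

lemma inj_x {a b : Fin q} (hab : a ≠ b) {y0 x0 x0' : ZMod L} {n n' p p' : ℕ} (hp' : 1 ≤ p') (hpL' : p' ≤ L)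
    (h : lowConf a b y0 n x0 p = lowConf a b y0 n' x0' p') : x0 = x0' := by
  obtain ⟨i, hi, hx⟩ := exists_idx x0' x0
  by_contra hne
  have hi0 : i ≠ 0 := by
    rintro rfl
    apply hne; rw [hx]; simp
  have e1 := congrFun h (st x0' y0 0 false)
  have e2 := congrFun h (st x0' y0 (L - 1) true)
  rw [lowConf_st a b y0 n' x0' p' (by omega), if_pos (by simp; omega)] at e1
  rw [lowConf_st a b y0 n' x0' p' (by omega), if_neg (by simp; omega)] at e2
  have s1 : st x0' y0 0 false = st x0 y0 i false := by
    unfold st; rw [hx]; simp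
  have s2 : st x0' y0 (L - 1) true = st x0 y0 (i - 1) true := by
    unfold st
    rw [← idx_pred, hx]
    obtain ⟨k, rfl⟩ : ∃ k, i = k + 1 := ⟨i - 1, by omega⟩
    rw [idx_succ_sub]; simp
  rw [s1, lowConf_st a b y0 n x0 p hi] at e1
  rw [s2, lowConf_st a b y0 n x0 p (by omega)] at e2
  have z1 : i + (false).toNat = i := by simp
  have z2 : i - 1 + (true).toNat = i := by simp; omega
  rw [z1] at e1
  rw [z2, e1] at e2
  exact hab e2.symm

lemma inj_p {a b : Fin q} (hab : a ≠ b) {y0 x0 : ZMod L} {n n' p p' : ℕ} (hpL' : p' ≤ L)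
    (h : lowConf a b y0 n x0 p = lowConf a b y0 n' x0 p') : p' ≤ p := by
  by_contra hlt
  have e1 := congrFun h (st x0 y0 p false)
  rw [lowConf_st a b y0 n x0 p (by omega), lowConf_st a b y0 n' x0 p' (by omega), if_neg (by simp),
    if_pos (by simp; omega)] at e1
  exact hab e1

abbrev KK (L q : ℕ) := Fin 3 × (Fin q × Fin q) × ℕ × (ZMod L × ZMod L) × ℕ

def kc (k : KK L q) : Conf L q := lowConf k.2.1.1 k.2.1.2 k.2.2.2.1.1 k.2.2.1 k.2.2.2.1.2 k.2.2.2.2 ∘ th k.1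

noncomputable def KS (L : ℕ) {q : ℕ} [NeZero L] (P : Finset (Fin q × Fin q)) : Finset (KK L q) :=
  Finset.univ ×ˢ P ×ˢ Finset.Icc 1 (L - 2) ×ˢ Finset.univ ×ˢ Finset.Icc 1 L

lemma kc_inj [Fact (1 < L)] (hL : 3 ≤ L) (P : Finset (Fin q × Fin q)) (hP : ∀ k ∈ P, k.1 ≠ k.2) :
    Set.InjOn (kc (L := L) (q := q)) (KS L P : Set (KK L q)) := by
  rintro ⟨d, ⟨a, b⟩, n, ⟨y0, x0⟩, p⟩ hk ⟨d', ⟨a', b'⟩, n', ⟨y0', x0'⟩, p'⟩ hk' h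
  simp only [KS, Finset.mem_coe, Finset.mem_product, Finset.mem_univ, true_and, Finset.mem_Icc] at hk hk'
  obtain ⟨hab, ⟨hn, hn2⟩, hp, hpL⟩ := hk
  obtain ⟨hab', ⟨hn', hn2'⟩, hp', hpL'⟩ := hk'
  replace hab : a ≠ b := hP _ hab
  replace hab' : a' ≠ b' := hP _ hab'
  simp only [kc] at h
  obtain rfl := inj_dir hL hab hn (by omega) hn' h
  have h2 : lowConf a b y0 n x0 p = lowConf a' b' y0' n' x0' p' := by
    have := congrArg (fun σ => σ ∘ th d) h
    simp only [comp_th_th] at this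
    exact this
  obtain rfl := inj_y hab' hp' hpL' h2
  obtain rfl : a = a' := by
    have := congrFun h2 (((0 : ZMod L), y0 + 1), false)
    rwa [row_a hL a b y0 n x0 p hn _ rfl, row_a hL a' b' y0 n' x0' p' hn' _ rfl] at this
  obtain rfl : b = b' := by
    have := congrFun h2 (((0 : ZMod L), y0 - 1), false)
    rwa [row_b hL a b y0 n x0 p (by omega) _ rfl, row_b hL a b' y0 n' x0' p' (by omega) _ rfl] at this
  obtain rfl : n = n' := le_antisymm (inj_n hab (by omega) h2.symm) (inj_n hab (by omega) h2)
  obtain rfl := inj_x hab hp' hpL' h2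
  obtain rfl : p = p' := le_antisymm (inj_p hab hpL h2.symm) (inj_p hab hpL' h2)
  rfl

lemma ee_ge {δ : ℝ} (hδ : 0 < δ) (h : Conf L q → ℝ) :
    ∑ ζ : Conf L q, (if Ham L q ζ = 2 * L + 1 then NNe h ζ else 0) ≤ 1 / 2 * EE L q δ h := by
  set F : Conf L q → Conf L q → ℝ := fun ζ σ => if Ham L q ζ = 2 * L + 1 ∧ oneFlip ζ σ ∧ Ham L q σ = 2 * L + 2 then (h σ - h ζ) ^ 2 else 0 with hF
  have e1 : ∑ ζ : Conf L q, (if Ham L q ζ = 2 * L + 1 then NNe h ζ else 0) = ∑ ζ, ∑ σ, F ζ σ := by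
    refine Finset.sum_congr rfl fun ζ _ => ?_
    simp only [hF, NNe]
    split_ifs with h1
    · simp only [h1, true_and]
    · simp [h1]
  have e2 : ∑ ζ, ∑ σ, F ζ σ + ∑ ζ, ∑ σ, F ζ σ ≤ EE L q δ h := by
    nth_rewrite 2 [Finset.sum_comm]
    rw [← Finset.sum_add_distrib]
    unfold EE
    refine Finset.sum_le_sum fun ζ _ => ?_
    rw [← Finset.sum_add_distrib]
    refine Finset.sum_le_sum fun σ _ => ?_
    by_cases hf : oneFlip ζ σ
    · have hf' := oneFlip_symm hf
      have hne : δ ^ (2 * L + 2) ≠ 0 := by positivity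
      by_cases c1 : Ham L q ζ = 2 * L + 1 ∧ Ham L q σ = 2 * L + 2
      · have z1 : F ζ σ = (h σ - h ζ) ^ 2 := by simp only [hF]; rw [if_pos ⟨c1.1, hf, c1.2⟩]
        have z2 : F σ ζ = 0 := by simp only [hF]; rw [if_neg (by omega)]
        rw [z1, z2, cw, if_pos hf, c1.1, c1.2, max_eq_right (by omega), div_self hne]; linarith
      · by_cases c2 : Ham L q σ = 2 * L + 1 ∧ Ham L q ζ = 2 * L + 2
        · have z1 : F σ ζ = (h ζ - h σ) ^ 2 := by simp only [hF]; rw [if_pos ⟨c2.1, hf', c2.2⟩]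
          have z2 : F ζ σ = 0 := by simp only [hF]; rw [if_neg (by omega)]
          rw [z1, z2, cw, if_pos hf, c2.1, c2.2, max_eq_left (by omega), div_self hne]
          apply le_of_eq; ring
        · have z1 : F ζ σ = 0 := by simp only [hF]; rw [if_neg (by tauto)]
          have z2 : F σ ζ = 0 := by simp only [hF]; rw [if_neg (by tauto)]
          rw [z1, z2, add_zero]
          exact mul_nonneg (cw_nonneg hδ _ _) (sq_nonneg _)
    · have hf' : ¬ oneFlip σ ζ := fun h => hf (oneFlip_symm h)
      have z1 : F ζ σ = 0 := by simp only [hF]; rw [if_neg (by tauto)]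
      have z2 : F σ ζ = 0 := by simp only [hF]; rw [if_neg (by tauto)]
      rw [z1, z2, add_zero]
      exact mul_nonneg (cw_nonneg hδ _ _) (sq_nonneg _)
  rw [e1]; linarith

lemma nne_nonneg (h : Conf L q → ℝ) (ζ : Conf L q) : 0 ≤ NNe h ζ :=
  Finset.sum_nonneg fun σ _ => by split_ifs <;> positivity

lemma kc_sum [Fact (1 < L)] (hL : 3 ≤ L) {δ : ℝ} (hδ : 0 < δ) (h : Conf L q → ℝ) (P : Finset (Fin q × Fin q)) (hP : ∀ k ∈ P, k.1 ≠ k.2) :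
    ∑ d : Fin 3, ∑ ab ∈ P, ∑ n ∈ Finset.Icc 1 (L - 2), ∑ z : ZMod L × ZMod L, ∑ p ∈ Finset.Icc 1 L,
      NNe h (lowConf ab.1 ab.2 z.1 n z.2 p ∘ th d) ≤ 1 / 2 * EE L q δ h := by
  have e : ∑ d : Fin 3, ∑ ab ∈ P, ∑ n ∈ Finset.Icc 1 (L - 2), ∑ z : ZMod L × ZMod L, ∑ p ∈ Finset.Icc 1 L,
      NNe h (lowConf ab.1 ab.2 z.1 n z.2 p ∘ th d) = ∑ k ∈ KS L P, NNe h (kc k) := by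
    unfold KS
    simp only [Finset.sum_product]
    rfl
  rw [e, ← Finset.sum_image (f := fun σ => NNe h σ) (kc_inj hL P hP)]
  refine le_trans ?_ (ee_ge hδ h)
  rw [← Finset.sum_filter]
  refine Finset.sum_le_sum_of_subset_of_nonneg ?_ fun _ _ _ => nne_nonneg h _
  intro σ hσ
  simp only [Finset.mem_image, Finset.mem_filter, Finset.mem_univ, true_and] at hσ ⊢
  obtain ⟨⟨d, ⟨a, b⟩, n, ⟨y0, x0⟩, p⟩, hk, rfl⟩ := hσ
  simp only [KS, Finset.mem_product, Finset.mem_univ, true_and, Finset.mem_Icc] at hk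
  simp only [kc]
  rw [ham_th]
  exact lowConf_ham (hP _ hk.1) y0 n x0 p hk.2.2.1 hk.2.2.2 hk.2.1.1 (by omega)

lemma lo_of_EE {δ : ℝ} (hδ : 0 < δ) (hδ1 : δ ≤ 1) (h : Conf L q → ℝ) {U : ℝ} (hU : 1 / 2 * EE L q δ h ≤ U) :
    Lo h (Real.sqrt (2 * U * δ)) := by
  intro σ ζ hf h1 h2
  have hc : 1 / δ ≤ cw L q δ σ ζ := by
    rw [cw, if_pos hf, div_le_div_iff₀ hδ (by positivity), one_mul, ← pow_succ]
    exact pow_le_pow_of_le_one hδ.le hδ1 (by have := max_le h1 h2; omega)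
  have h3 : cw L q δ σ ζ * (h ζ - h σ) ^ 2 ≤ EE L q δ h := by
    unfold EE
    refine le_trans (Finset.single_le_sum (f := fun ζ => cw L q δ σ ζ * (h ζ - h σ) ^ 2) (fun i _ => mul_nonneg (cw_nonneg hδ _ _) (sq_nonneg _)) (Finset.mem_univ ζ)) ?_
    exact Finset.single_le_sum (f := fun σ => ∑ ζ, cw L q δ σ ζ * (h ζ - h σ) ^ 2)
      (fun i _ => Finset.sum_nonneg fun j _ => mul_nonneg (cw_nonneg hδ _ _) (sq_nonneg _)) (Finset.mem_univ σ)
  apply Real.le_sqrt_of_sq_le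
  rw [sq_abs]
  have h4 : 1 / δ * (h ζ - h σ) ^ 2 ≤ 2 * U :=
    (mul_le_mul_of_nonneg_right hc (sq_nonneg _)).trans (h3.trans (by linarith))
  rw [one_div, inv_mul_le_iff₀ hδ] at h4
  calc (h σ - h ζ) ^ 2 = (h ζ - h σ) ^ 2 := by ring
    _ ≤ δ * (2 * U) := h4
    _ = _ := by ring

lemma lower_explicit [Fact (1 < L)] (hL : 3 ≤ L) {δ : ℝ} (hδ : 0 < δ) (A : Finset (Fin q)) (h : Conf L q → ℝ)
    {ε : ℝ} (hε : 0 ≤ ε) (hε2 : 6 * L * ε ≤ 1) (hg : Lo h ε) (hA : ∀ a ∈ A, h (groundConf L q a) = 1)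
    (hB : ∀ a ∈ Aᶜ, h (groundConf L q a) = 0) :
    6 * (A.card : ℝ) * (Aᶜ.card : ℝ) * (1 - 6 * L * ε) ^ 2 ≤ (1 / 2 + 4 / L) * (1 / 2 * EE L q δ h) := by
  set P : Finset (Fin q × Fin q) := A ×ˢ Aᶜ ∪ Aᶜ ×ˢ A with hPdef
  have hdis : Disjoint (A ×ˢ Aᶜ) (Aᶜ ×ˢ A) := by
    rw [Finset.disjoint_left]
    rintro ⟨a, b⟩ h1 h2
    simp only [Finset.mem_product, Finset.mem_compl] at h1 h2
    exact h2.1 h1.1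
  have hcard : (P.card : ℝ) = 2 * (A.card : ℝ) * (Aᶜ.card : ℝ) := by
    rw [hPdef, Finset.card_union_of_disjoint hdis, Finset.card_product, Finset.card_product]
    push_cast; ring
  have hP : ∀ k ∈ P, k.1 ≠ k.2 := by
    rintro ⟨a, b⟩ hk
    simp only [hPdef, Finset.mem_union, Finset.mem_product, Finset.mem_compl] at hk
    intro hab
    have hab2 : a = b := hab
    subst hab2
    tauto
  have hone : ∀ k ∈ P, |h (groundConf L q k.1) - h (groundConf L q k.2)| = 1 := by
    rintro ⟨a, b⟩ hk
    simp only [hPdef, Finset.mem_union, Finset.mem_product] at hk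
    rcases hk with hk | hk
    · simp only; rw [hA a hk.1, hB b hk.2]; norm_num
    · simp only; rw [hB a hk.1, hA b hk.2]; norm_num
  have key := mul_le_mul_of_nonneg_left (kc_sum hL hδ h P hP) (show (0 : ℝ) ≤ 1 / 2 + 4 / L by positivity)
  refine le_trans ?_ key
  rw [Finset.mul_sum]
  have : ∑ d : Fin 3, ∑ ab ∈ P, (1 - 6 * (L : ℝ) * ε) ^ 2 = 6 * (A.card : ℝ) * (Aᶜ.card : ℝ) * (1 - 6 * L * ε) ^ 2 := by
    rw [Finset.sum_const, Finset.sum_const, nsmul_eq_mul, nsmul_eq_mul, hcard, Finset.card_univ, Fintype.card_fin]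
    push_cast; ring
  rw [← this]
  refine Finset.sum_le_sum fun d _ => ?_
  rw [Finset.mul_sum]
  exact Finset.sum_le_sum fun ab hk => kappa_bound' hL hε hε2 hg (hP _ hk) (hone _ hk) d

end P18

/-- Theorem 8.1, capacity estimate (hexagonal lattice): if `L^{10} ≪ e^{β_L}` and `(A,B)`
is a proper partition of `Ω`, then
`Cap_β(S(A), S(B)) = [12|A|(q-|A|)/q + o_L(1)] e^{-(2L+2)β}`; the capacity is the
Dirichlet form of the equilibrium potential, formalized via its harmonic
characterization. -/
theorem capacity_estimate (q : ℕ) (hq : 2 ≤ q) (β : ℕ → ℝ)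
    (hβ : Filter.Tendsto β Filter.atTop Filter.atTop)
    (hcond : Filter.Tendsto (fun L : ℕ => (L : ℝ) ^ (10 : ℕ) / Real.exp (β L))
      Filter.atTop (nhds 0))
    (A B : Finset (Fin q)) (hA : A.Nonempty) (hB : B.Nonempty)
    (hdisj : Disjoint A B) (hunion : A ∪ B = Finset.univ)
    (h : ∀ L : ℕ, Conf L q → ℝ)
    (hh : ∀ L : ℕ, 8 ≤ L → IsEqPotential L q (β L)
      {σ : Conf L q | ∃ a ∈ A, σ = groundConf L q a}
      {σ : Conf L q | ∃ b ∈ B, σ = groundConf L q b} (h L)) :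
    Filter.Tendsto
      (fun L : ℕ =>
        dirichletForm L q (β L) (h L) / Real.exp (-(2 * (L : ℝ) + 2) * β L))
      Filter.atTop
      (nhds (12 * (A.card : ℝ) * ((q : ℝ) - (A.card : ℝ)) / (q : ℝ))) := by
  have hBA : B = Aᶜ := by
    ext b
    have h1 : b ∈ A ∪ B := by rw [hunion]; exact Finset.mem_univ b
    rw [Finset.mem_union] at h1
    rw [Finset.mem_compl]
    have h2 : b ∈ A → b ∉ B := fun h => Finset.disjoint_left.1 hdisj h
    tauto
  subst hBA
  have hcard : (Aᶜ.card : ℝ) = (q : ℝ) - A.card := by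
    have : A.card + Aᶜ.card = q := by simpa using Finset.card_add_card_compl A
    have h2 : (A.card : ℝ) + Aᶜ.card = q := by exact_mod_cast this
    linarith
  rw [← hcard]
  have hu : Filter.Tendsto (fun L : ℕ => (L:ℝ) ^ 10 * Real.exp (-β L)) Filter.atTop (nhds 0) := by
    refine hcond.congr fun L => ?_
    rw [Real.exp_neg, div_eq_mul_inv]
  have hZ := Z_limit q hq β hu
  have hq0 : (0 : ℝ) < q := by have : 0 < q := by omega
                               exact_mod_cast this
  obtain ⟨U, hU, hUev⟩ := upper_limit q hq A (fun L => Real.exp (-β L)) (fun L => Real.exp_pos _) hu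
  set ε : ℕ → ℝ := fun L => Real.sqrt (2 * U L * Real.exp (-β L)) with hεdef
  -- `L ε → 0`
  have hL2 : Filter.Tendsto (fun L : ℕ => (L:ℝ) ^ 2 * Real.exp (-β L)) Filter.atTop (nhds 0) := by
    refine squeeze_zero' (Filter.Eventually.of_forall fun L => by positivity) ?_ hu
    filter_upwards [Filter.eventually_ge_atTop 1] with L hL
    have : (1 : ℝ) ≤ L := by exact_mod_cast hL
    exact mul_le_mul_of_nonneg_right (pow_le_pow_right₀ this (by norm_num)) (Real.exp_pos _).le
  have hLε : Filter.Tendsto (fun L : ℕ => (L:ℝ) * ε L) Filter.atTop (nhds 0) := by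
    have h1 : Filter.Tendsto (fun L : ℕ => Real.sqrt (2 * U L * ((L:ℝ) ^ 2 * Real.exp (-β L)))) Filter.atTop (nhds 0) := by
      have := (Real.continuous_sqrt.tendsto _).comp ((hU.const_mul 2).mul hL2)
      simpa [Function.comp_def] using this
    refine h1.congr fun L => ?_
    rw [hεdef]
    have e : 2 * U L * ((L:ℝ) ^ 2 * Real.exp (-β L)) = (L:ℝ) ^ 2 * (2 * U L * Real.exp (-β L)) := by ring
    rw [e, Real.sqrt_mul (by positivity), Real.sqrt_sq (by positivity)]
  have h6 : Filter.Tendsto (fun L : ℕ => 6 * (L:ℝ) * ε L) Filter.atTop (nhds 0) := by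
    have := hLε.const_mul 6
    simpa [mul_assoc] using this
  have hlow : Filter.Tendsto (fun L : ℕ => 6 * (A.card : ℝ) * (Aᶜ.card : ℝ) * (1 - 6 * (L:ℝ) * ε L) ^ 2
      / (1 / 2 + 4 / (L:ℝ)) / Zfun L q (β L)) Filter.atTop
      (nhds (12 * (A.card : ℝ) * (Aᶜ.card : ℝ) / (q : ℝ))) := by
    have h4 : Filter.Tendsto (fun L : ℕ => (1/2 : ℝ) + 4 / (L:ℝ)) Filter.atTop (nhds (1/2)) := by
      have := (tendsto_const_div_atTop_nhds_zero_nat (4:ℝ)).const_add (1/2 : ℝ)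
      simpa using this
    have h5 := ((((h6.const_sub 1).pow 2).const_mul (6 * (A.card : ℝ) * (Aᶜ.card : ℝ))).div h4 (by norm_num)).div hZ hq0.ne'
    have e : 6 * (A.card : ℝ) * (Aᶜ.card : ℝ) * (1 - 0) ^ 2 / (1/2) / q = 12 * (A.card : ℝ) * (Aᶜ.card : ℝ) / (q : ℝ) := by
      ring
    rw [e] at h5
    exact h5
  have hup := hU.div hZ hq0.ne'
  have hZpos : ∀ᶠ L in Filter.atTop, 0 < Zfun L q (β L) := hZ.eventually_const_lt hq0
  have main : ∀ᶠ L : ℕ in Filter.atTop,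
      6 * (A.card : ℝ) * (Aᶜ.card : ℝ) * (1 - 6 * (L:ℝ) * ε L) ^ 2 / (1 / 2 + 4 / (L:ℝ)) / Zfun L q (β L)
        ≤ dirichletForm L q (β L) (h L) / Real.exp (-(2 * (L : ℝ) + 2) * β L) ∧
      dirichletForm L q (β L) (h L) / Real.exp (-(2 * (L : ℝ) + 2) * β L) ≤ U L / Zfun L q (β L) := by
    filter_upwards [hUev, hZpos, h6.eventually_le_const one_pos, hβ.eventually_ge_atTop 0] with L hL hz h6L hb
    obtain ⟨hL40, hEE⟩ := hL
    have : NeZero L := ⟨by omega⟩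
    have : Fact (1 < L) := ⟨by omega⟩
    have hp := hh L (by omega)
    have hle : 1 / 2 * EE L q (Real.exp (-β L)) (h L) ≤ U L := by
      refine le_trans ?_ (hEE inferInstance)
      have := EE_le (β L) A (h L) hp
      linarith
    rw [dir_eq]
    refine ⟨?_, div_le_div_of_nonneg_right hle hz.le⟩
    refine div_le_div_of_nonneg_right ?_ hz.le
    have hlo := lo_of_EE (Real.exp_pos _) (by rw [Real.exp_le_one_iff]; linarith) (h L) hle
    have := lower_explicit (by omega) (Real.exp_pos (-β L)) A (h L) (Real.sqrt_nonneg _) h6L hlo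
      (fun a ha => hp.1 _ ⟨a, ha, rfl⟩) (fun a ha => hp.2.1 _ ⟨a, ha, rfl⟩)
    rw [div_le_iff₀ (by positivity), mul_comm (1 / 2 * EE L q (Real.exp (-β L)) (h L))]
    exact this
  exact tendsto_of_tendsto_of_tendsto_of_le_of_le' hlow hup (main.mono fun _ h => h.1) (main.mono fun _ h => h.2)

end IsingHex
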